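/- Let F ∈ ℤ[t] be an irreducible polynomial of degree g ≥ 2 and let 0 < δ < 1. There exist constants γ > 0, y₀ and c > 0, depending only on F and δ, such that for all reals x, y, z with y₀ ≤ y ≤ x^{1−δ} and z = e^η y with 1/100 ≤ η ≤ γ · log y: H_F(x, y, z) − H_F(x/2, y, z) ≥ c · x · u^𝓔/(log(2/u))^{3/2}, where u = η/log y and 𝓔 = 1 − (1 + log log 2)/log 2. -/

import Mathlib

open Real MeasureTheory
open scoped Classical

/-- number of residues n mod d with F(n) ≡ 0 (mod d) -/
noncomputable def polyRho (F : Polynomial ℤ) (d : ℕ) : ℕ :=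
  ((Finset.range d).filter (fun n => (d : ℤ) ∣ F.eval (n : ℤ))).card

/-- H_F(x,y,z): number of positive n ≤ x with F(n) having a divisor in (y,z] -/
noncomputable def polyH (F : Polynomial ℤ) (x y z : ℝ) : ℕ :=
  {n : ℕ | 0 < n ∧ (n : ℝ) ≤ x ∧
    ∃ d : ℕ, 0 < d ∧ (d : ℤ) ∣ F.eval (n : ℤ) ∧ y < (d : ℝ) ∧ (d : ℝ) ≤ z}.ncard

/-- H(x,y,z): number of positive n ≤ x having a divisor in (y,z] -/
noncomputable def Hdiv (x y z : ℝ) : ℕ :=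
  {n : ℕ | 0 < n ∧ (n : ℝ) ≤ x ∧
    ∃ d : ℕ, 0 < d ∧ d ∣ n ∧ y < (d : ℝ) ∧ (d : ℝ) ≤ z}.ncard

/-- L(a;σ) -/
noncomputable def Lfun (a : ℕ) (σ : ℝ) : ℝ :=
  (volume {x : ℝ | ∃ d : ℕ, d ∣ a ∧ Real.exp x < (d : ℝ) ∧ (d : ℝ) ≤ Real.exp (x + σ)}).toReal

/-- W(a;σ): ordered pairs of divisors near each other -/
noncomputable def Wfun (a : ℕ) (σ : ℝ) : ℕ :=
  {p : ℕ × ℕ | p.1 ∣ a ∧ p.2 ∣ a ∧ |Real.log ((p.1 : ℝ) / (p.2 : ℝ))| ≤ σ}.ncard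

/-- 𝒫(s,t): squarefree integers with all prime factors in (s,t] -/
def Psf (s t : ℝ) : Set ℕ :=
  {a : ℕ | 0 < a ∧ Squarefree a ∧ ∀ p : ℕ, p.Prime → p ∣ a → s < (p : ℝ) ∧ (p : ℝ) ≤ t}

/-- φ_F(n) = n ∏_{p|n} (1 - ρ(p)/p) -/
noncomputable def polyPhi (F : Polynomial ℤ) (n : ℕ) : ℝ :=
  (n : ℝ) * ∏ p ∈ n.primeFactors, (1 - (polyRho F p : ℝ) / p)

/-- P⁺(n): largest prime factor, P⁺(1)=0 -/
def Pplus (n : ℕ) : ℕ := n.primeFactors.sup id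

/-- h(n;X): least prime q with ∏_{p^ν ∥ n, p ≤ q} p^ν > √X -/
noncomputable def hfun (n : ℕ) (X : ℝ) : ℕ :=
  sInf {q : ℕ | q.Prime ∧
    Real.sqrt X < ∏ p ∈ n.primeFactors.filter (fun p => p ≤ q), (p : ℝ) ^ (n.factorization p)}

open Finset in
/-- Weighted count of lattice paths staying below the diagonal. -/
noncomputable def pathWt (x : ℕ → ℝ) : ℕ → ℕ → ℝ
  | 0, m => if m = 0 then 1 else 0
  | J + 1, m => if m ≤ J + 1 then
      ∑ p ∈ HasAntidiagonal.antidiagonal m, x J ^ p.1 / (p.1.factorial : ℝ) * pathWt x J p.2 else 0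

/-- The closed form of `pathWt` for unit weights. -/
noncomputable def ballotT (J m : ℕ) : ℝ :=
  ((J + 1 : ℝ) ^ m - m * (J + 1 : ℝ) ^ (m - 1)) / (m.factorial : ℝ)

theorem pathWt_nonneg {x : ℕ → ℝ} (hx : ∀ j, 0 ≤ x j) (J m : ℕ) : 0 ≤ pathWt x J m := by
  induction J generalizing m with
  | zero => rw [pathWt]; split_ifs <;> norm_num
  | succ J ih =>
    rw [pathWt]
    split_ifs
    · exact Finset.sum_nonneg fun p _ => mul_nonneg (div_nonneg (pow_nonneg (hx _) _) (by positivity)) (ih _)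
    · exact le_rfl

theorem pathWt_eq_zero {x : ℕ → ℝ} {J m : ℕ} (h : J < m) : pathWt x J m = 0 := by
  cases J with
  | zero => rw [pathWt, if_neg (by omega)]
  | succ J => rw [pathWt, if_neg (by omega)]

theorem sum_antidiagonal_pow_div_factorial (a b : ℝ) (m : ℕ) :
    ∑ p ∈ Finset.HasAntidiagonal.antidiagonal m, a ^ p.1 / (p.1.factorial : ℝ) * (b ^ p.2 / (p.2.factorial : ℝ))
      = (a + b) ^ m / (m.factorial : ℝ) := by
  rw [add_pow, Finset.Nat.sum_antidiagonal_eq_sum_range_succ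
    (fun i l => a ^ i / (i.factorial : ℝ) * (b ^ l / (l.factorial : ℝ))), Finset.sum_div]
  refine Finset.sum_congr rfl fun i hi => ?_
  have hi' : i ≤ m := by simpa [Nat.lt_succ_iff] using hi
  rw [Nat.cast_choose ℝ hi']
  have := Nat.factorial_ne_zero m
  have := Nat.factorial_ne_zero i
  have := Nat.factorial_ne_zero (m - i)
  field_simp

theorem ballotT_zero (J : ℕ) : ballotT J 0 = 1 := by simp [ballotT]

theorem ballotT_succ (J m : ℕ) : ballotT J (m + 1) =
    (J + 1 : ℝ) ^ (m + 1) / ((m + 1).factorial : ℝ) - (J + 1 : ℝ) ^ m / (m.factorial : ℝ) := by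
  rw [ballotT, sub_div, Nat.add_sub_cancel, Nat.factorial_succ]
  push_cast
  have := Nat.factorial_ne_zero m
  have : (m : ℝ) + 1 ≠ 0 := by positivity
  field_simp

theorem ballotT_self_succ (J : ℕ) : ballotT J (J + 1) = 0 := by
  rw [ballotT, Nat.add_sub_cancel]
  push_cast
  rw [pow_succ]; ring

theorem ballotT_conv (J m : ℕ) :
    ∑ p ∈ Finset.HasAntidiagonal.antidiagonal m, 1 / (p.1.factorial : ℝ) * ballotT J p.2 = ballotT (J + 1) m := by
  cases m with
  | zero => simp [ballotT_zero]
  | succ m =>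
    have h1 := sum_antidiagonal_pow_div_factorial 1 (J + 1 : ℝ) (m + 1)
    have h2 := sum_antidiagonal_pow_div_factorial 1 (J + 1 : ℝ) m
    rw [Finset.Nat.sum_antidiagonal_succ'] at h1 ⊢
    simp only [one_pow] at h1 h2
    simp only [ballotT_succ, mul_sub, Finset.sum_sub_distrib, h2, ballotT_zero]
    have e : ((J + 1 : ℕ) : ℝ) + 1 = 1 + (J + 1 : ℝ) := by push_cast; ring
    rw [e]
    simp only [pow_zero, Nat.factorial_zero, Nat.cast_one, div_one] at h1
    linarith

theorem pathWt_one_eq {x : ℕ → ℝ} {J m : ℕ} (hm : m ≤ J + 1) (hx : ∀ j < J, x j = 1) :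
    pathWt x J m = ballotT J m := by
  induction J generalizing m with
  | zero =>
    interval_cases m
    · simp [pathWt, ballotT_zero]
    · rw [pathWt_eq_zero (by omega), ballotT_self_succ]
  | succ J ih =>
    rcases hm.lt_or_eq with h | h
    · rw [pathWt, if_pos (by omega), hx J (by omega), ← ballotT_conv]
      refine Finset.sum_congr rfl fun p hp => ?_
      have := Finset.HasAntidiagonal.mem_antidiagonal.1 hp
      rw [ih (by omega) (fun j hj => hx j (by omega)), one_pow]
    · rw [h, pathWt_eq_zero (by omega), ballotT_self_succ]

theorem pathWt_smul (c : ℝ) (x : ℕ → ℝ) (J m : ℕ) :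
    pathWt (fun j => c * x j) J m = c ^ m * pathWt x J m := by
  induction J generalizing m with
  | zero => rw [pathWt, pathWt]; split_ifs with h <;> simp [h]
  | succ J ih =>
    rw [pathWt, pathWt]
    split_ifs
    · rw [Finset.mul_sum]
      refine Finset.sum_congr rfl fun p hp => ?_
      rw [ih, ← Finset.HasAntidiagonal.mem_antidiagonal.1 hp, mul_pow, pow_add]; ring
    · simp

theorem pathWt_congr {x x' : ℕ → ℝ} {J : ℕ} (m : ℕ) (h : ∀ j < J, x j = x' j) :
    pathWt x J m = pathWt x' J m := by
  induction J generalizing m with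
  | zero => rw [pathWt, pathWt]
  | succ J ih =>
    rw [pathWt, pathWt, h J (by omega)]
    split_ifs
    · exact Finset.sum_congr rfl fun p _ => by rw [ih _ fun j hj => h j (by omega)]
    · rfl

/-- A recursively defined family with the path recursion up to a factor is dominated by `pathWt`. -/
theorem le_prod_mul_pathWt {Z : ℕ → ℕ → ℝ} {e : ℕ → ℕ → ℝ} {x ε : ℕ → ℝ} {N : ℕ}
    (hx : ∀ j, 0 ≤ x j) (hε : ∀ j, 0 ≤ ε j) (hZ0 : ∀ J m, 0 ≤ Z J m)
    (hZ00 : ∀ m, Z 0 m ≤ if m = 0 then 1 else 0)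
    (hZbig : ∀ J m, J < m → Z J m = 0)
    (hrec : ∀ J m, J < N → m ≤ J + 1 → Z (J + 1) m ≤ ∑ p ∈ Finset.HasAntidiagonal.antidiagonal m, e J p.1 * Z J p.2)
    (he : ∀ J i, J < N → i ≤ J + 1 → e J i ≤ (1 + ε J) ^ i * (x J ^ i / (i.factorial : ℝ)))
    (J m : ℕ) (hJ : J ≤ N) :
    Z J m ≤ (∏ l ∈ Finset.range J, (1 + ε l) ^ (l + 1)) * pathWt x J m := by
  induction J generalizing m with
  | zero => rw [pathWt]; simpa using hZ00 m
  | succ J ih =>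
    by_cases hm : m ≤ J + 1
    swap
    · rw [hZbig _ _ (by omega), pathWt_eq_zero (by omega), mul_zero]
    rw [pathWt, if_pos hm, Finset.prod_range_succ, mul_assoc, Finset.mul_sum, Finset.mul_sum]
    refine (hrec J m (by omega) hm).trans (Finset.sum_le_sum fun p hp => ?_)
    have hp' := Finset.HasAntidiagonal.mem_antidiagonal.1 hp
    have h1 := he J p.1 (by omega) (by omega)
    have h2 := ih p.2 (by omega)
    have h3 : (1 + ε J) ^ p.1 ≤ (1 + ε J) ^ (J + 1) :=
      pow_le_pow_right₀ (by linarith [hε J]) (by omega)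
    have h4 : 0 ≤ x J ^ p.1 / (p.1.factorial : ℝ) := div_nonneg (pow_nonneg (hx _) _) (by positivity)
    calc e J p.1 * Z J p.2
        ≤ ((1 + ε J) ^ (J + 1) * (x J ^ p.1 / (p.1.factorial : ℝ))) * Z J p.2 :=
          mul_le_mul_of_nonneg_right (h1.trans (mul_le_mul_of_nonneg_right h3 h4)) (hZ0 _ _)
      _ ≤ ((1 + ε J) ^ (J + 1) * (x J ^ p.1 / (p.1.factorial : ℝ))) *
          ((∏ l ∈ Finset.range J, (1 + ε l) ^ (l + 1)) * pathWt x J p.2) :=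
          mul_le_mul_of_nonneg_left h2 (mul_nonneg (pow_nonneg (by linarith [hε J]) _) h4)
      _ = _ := by ring

/-- A recursively defined family with the path recursion up to a factor dominates `pathWt`. -/
theorem prod_mul_pathWt_le {Z : ℕ → ℕ → ℝ} {e : ℕ → ℕ → ℝ} {x ε : ℕ → ℝ} {N : ℕ}
    (hx : ∀ j, 0 ≤ x j) (hε : ∀ j, 0 ≤ ε j ∧ ε j ≤ 1) (hZ0 : ∀ J m, 0 ≤ Z J m)
    (hZ00 : 1 ≤ Z 0 0)
    (hrec : ∀ J m, J < N → m ≤ J + 1 → ∑ p ∈ Finset.HasAntidiagonal.antidiagonal m, e J p.1 * Z J p.2 ≤ Z (J + 1) m)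
    (he : ∀ J i, J < N → i ≤ J + 1 → (1 - ε J) ^ i * (x J ^ i / (i.factorial : ℝ)) ≤ e J i)
    (J m : ℕ) (hJ : J ≤ N) :
    (∏ l ∈ Finset.range J, (1 - ε l) ^ (l + 1)) * pathWt x J m ≤ Z J m := by
  induction J generalizing m with
  | zero =>
    rw [pathWt]
    split_ifs with h
    · subst h; simpa using hZ00
    · simpa using hZ0 0 m
  | succ J ih =>
    by_cases hm : m ≤ J + 1
    swap
    · rw [pathWt_eq_zero (by omega), mul_zero]; exact hZ0 _ _
    rw [pathWt, if_pos hm, Finset.prod_range_succ, mul_assoc, Finset.mul_sum, Finset.mul_sum]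
    refine (Finset.sum_le_sum fun p hp => ?_).trans (hrec J m (by omega) hm)
    have hp' := Finset.HasAntidiagonal.mem_antidiagonal.1 hp
    have h1 := he J p.1 (by omega) (by omega)
    have h2 := ih p.2 (by omega)
    have h0 := hε J
    have h3 : (1 - ε J) ^ (J + 1) ≤ (1 - ε J) ^ p.1 :=
      pow_le_pow_of_le_one (by linarith) (by linarith) (by omega)
    have h4 : 0 ≤ x J ^ p.1 / (p.1.factorial : ℝ) := div_nonneg (pow_nonneg (hx _) _) (by positivity)
    have h5 : 0 ≤ (1 - ε J) ^ (J + 1) := pow_nonneg (by linarith) _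
    have h6 := h1.trans' (mul_le_mul_of_nonneg_right h3 h4)
    calc _ = ((1 - ε J) ^ (J + 1) * (x J ^ p.1 / (p.1.factorial : ℝ))) *
          ((∏ l ∈ Finset.range J, (1 - ε l) ^ (l + 1)) * pathWt x J p.2) := by ring
      _ ≤ ((1 - ε J) ^ (J + 1) * (x J ^ p.1 / (p.1.factorial : ℝ))) * Z J p.2 :=
          mul_le_mul_of_nonneg_left h2 (mul_nonneg h5 h4)
      _ ≤ e J p.1 * Z J p.2 := mul_le_mul_of_nonneg_right h6 (hZ0 _ _)

/-- Number of weighted path continuations starting at distance `h` below the diagonal. -/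
noncomputable def contV (h : ℕ) : ℕ → ℕ → ℝ
  | 0, r => if r = 0 then 1 else 0
  | n + 1, r => if r ≤ h + n + 1 then
      ∑ p ∈ Finset.HasAntidiagonal.antidiagonal r, 1 / (p.1.factorial : ℝ) * contV h n p.2 else 0

theorem contV_nonneg (h n r : ℕ) : 0 ≤ contV h n r := by
  induction n generalizing r with
  | zero => rw [contV]; split_ifs <;> norm_num
  | succ J ih =>
    rw [contV]
    split_ifs
    · exact Finset.sum_nonneg fun p _ => mul_nonneg (by positivity) (ih _)
    · exact le_rfl

theorem ballotT_nonneg {J m : ℕ} (h : m ≤ J + 1) : 0 ≤ ballotT J m := by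
  rw [← pathWt_one_eq (x := fun _ => 1) h (fun _ _ => rfl)]
  exact pathWt_nonneg (by simp) _ _

theorem ballotT_mul_contV_le (j h n r : ℕ) (hj : h ≤ j) (hr : r ≤ h + n) :
    ballotT j (j - h) * contV h n r ≤ ballotT (j + n) (j - h + r) := by
  induction n generalizing r with
  | zero =>
    rw [contV]
    split_ifs with h0
    · subst h0; simp
    · simpa using ballotT_nonneg (by omega)
  | succ n ih =>
    rw [contV, if_pos (by omega), Finset.mul_sum]
    rw [show j + (n + 1) = (j + n) + 1 by ring, ← ballotT_conv]
    have : ∑ p ∈ Finset.HasAntidiagonal.antidiagonal r, 1 / (p.1.factorial : ℝ) * ballotT (j + n) (j - h + p.2) ≤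
        ∑ p ∈ Finset.HasAntidiagonal.antidiagonal (j - h + r), 1 / (p.1.factorial : ℝ) * ballotT (j + n) p.2 := by
      rw [← Finset.sum_image (s := Finset.HasAntidiagonal.antidiagonal r) (g := fun p : ℕ × ℕ => (p.1, j - h + p.2))
        (f := fun p => 1 / (p.1.factorial : ℝ) * ballotT (j + n) p.2)]
      · refine Finset.sum_le_sum_of_subset_of_nonneg ?_ ?_
        · intro p hp
          simp only [Finset.mem_image, Finset.HasAntidiagonal.mem_antidiagonal] at hp ⊢
          obtain ⟨q, hq, rfl⟩ := hp
          simp; omega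
        · intro p hp _
          have := Finset.HasAntidiagonal.mem_antidiagonal.1 hp
          exact mul_nonneg (by positivity) (ballotT_nonneg (by omega))
      · intro p _ q _ hpq
        simp only [Prod.mk.injEq] at hpq
        ext <;> omega
    refine (Finset.sum_le_sum fun p hp => ?_).trans this
    have hp' := Finset.HasAntidiagonal.mem_antidiagonal.1 hp
    rw [mul_left_comm]
    refine mul_le_mul_of_nonneg_left ?_ (by positivity)
    by_cases h1 : p.2 ≤ h + n
    · exact ih p.2 h1
    · have : contV h n p.2 = 0 := by
        cases n with
        | zero => rw [contV, if_neg (by omega)]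
        | succ n => rw [contV, if_neg (by omega)]
      rw [this, mul_zero]
      exact ballotT_nonneg (by omega)

theorem pathWt_append (x : ℕ → ℝ) (j n m : ℕ) (hx : ∀ l, j ≤ l → x l = 1) :
    pathWt x (j + n) m = ∑ p ∈ Finset.HasAntidiagonal.antidiagonal m, pathWt x j p.1 * contV (j - p.1) n p.2 := by
  induction n generalizing m with
  | zero =>
    rw [Finset.sum_eq_single (m, 0)]
    · simp [contV]
    · intro p hp hne
      have hp' := Finset.HasAntidiagonal.mem_antidiagonal.1 hp
      rw [contV, if_neg, mul_zero]
      rintro h0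
      exact hne (Prod.ext (by simp; omega) h0)
    · simp
  | succ n ih =>
    rw [← add_assoc, pathWt]
    split_ifs with hm
    · rw [hx _ (by omega)]
      simp only [ih, one_pow]
      have key : ∀ p ∈ Finset.HasAntidiagonal.antidiagonal m, pathWt x j p.1 * contV (j - p.1) (n + 1) p.2 =
          ∑ q ∈ Finset.HasAntidiagonal.antidiagonal p.2, pathWt x j p.1 * (1 / (q.1.factorial : ℝ) * contV (j - p.1) n q.2) := by
        intro p hp
        have hp' := Finset.HasAntidiagonal.mem_antidiagonal.1 hp
        rw [contV]
        split_ifs with h1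
        · rw [Finset.mul_sum]
        · rw [mul_zero, pathWt_eq_zero (by omega)]
          simp
      rw [Finset.sum_congr rfl key]
      simp only [Finset.mul_sum]
      rw [Finset.sum_sigma', Finset.sum_sigma']
      refine Finset.sum_nbij' (fun s => ⟨(s.2.1, s.1.1 + s.2.2), (s.1.1, s.2.2)⟩)
        (fun s => ⟨(s.2.1, s.1.1 + s.2.2), (s.1.1, s.2.2)⟩) ?_ ?_ ?_ ?_ ?_
      all_goals
        rintro ⟨⟨a, b⟩, ⟨c, d⟩⟩ hs
        simp only [Finset.mem_sigma, Finset.HasAntidiagonal.mem_antidiagonal] at hs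
      · simp only [Finset.mem_sigma, Finset.HasAntidiagonal.mem_antidiagonal, and_true]; omega
      · simp only [Finset.mem_sigma, Finset.HasAntidiagonal.mem_antidiagonal, and_true]; omega
      · obtain ⟨h1, h2⟩ := hs; subst h2; simp
      · obtain ⟨h1, h2⟩ := hs; subst h2; simp
      · simp only; ring
    · symm
      refine Finset.sum_eq_zero fun p hp => ?_
      have hp' := Finset.HasAntidiagonal.mem_antidiagonal.1 hp
      by_cases h1 : j < p.1
      · rw [pathWt_eq_zero h1, zero_mul]
      · rw [contV, if_neg (by omega), mul_zero]

/-- The decay factor `(N+1)^(-3/2)`. -/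
noncomputable def decay (N : ℕ) : ℝ := ((N : ℝ) + 1) ^ (-(3 / 2) : ℝ)

theorem decay_pos (N : ℕ) : 0 < decay N := Real.rpow_pos_of_pos (by positivity) _

theorem decay_eq (N : ℕ) : decay N = (((N : ℝ) + 1) * √((N : ℝ) + 1))⁻¹ := by
  have h : (0 : ℝ) < (N : ℝ) + 1 := by positivity
  rw [decay, Real.rpow_neg h.le, Real.sqrt_eq_rpow]
  congr 1
  nth_rewrite 2 [← Real.rpow_one ((N : ℝ) + 1)]
  rw [← Real.rpow_add h]; norm_num

theorem summable_decay : Summable decay := by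
  have h : Summable fun n : ℕ => 1 / ((n : ℝ)) ^ (3 / 2 : ℝ) :=
    Real.summable_one_div_nat_rpow.2 (by norm_num)
  have := (summable_nat_add_iff 1).2 h
  refine this.congr fun n => ?_
  rw [decay, Real.rpow_neg (by positivity)]
  push_cast
  rw [one_div]

theorem ballotT_add (k h : ℕ) : ballotT (k + h) k =
    (h + 1) * ((k : ℝ) + h + 1) ^ k / (((k : ℝ) + h + 1) * (k.factorial : ℝ)) := by
  have h0 : (k : ℝ) + h + 1 ≠ 0 := by positivity
  cases k with
  | zero =>
    rw [ballotT_zero]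
    have : (h : ℝ) + 1 ≠ 0 := by positivity
    simp [this]
  | succ k =>
    have := Nat.factorial_ne_zero (k + 1)
    rw [ballotT, Nat.add_sub_cancel]
    push_cast at h0 ⊢
    field_simp
    ring

theorem ballotT_self (N : ℕ) : ballotT N N = ((N : ℝ) + 1) ^ N / ((N + 1).factorial : ℝ) := by
  have := ballotT_add N 0
  rw [Nat.add_zero] at this
  rw [this, Nat.factorial_succ]
  push_cast
  ring

theorem ballotT_self_eq_stirling (N : ℕ) : ballotT N N =
    Real.exp 1 / (√2 * Stirling.stirlingSeq (N + 1)) * (Real.exp N * decay N) := by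
  have h : (0 : ℝ) < (N : ℝ) + 1 := by positivity
  have hs : (0 : ℝ) < √((N : ℝ) + 1) := Real.sqrt_pos.2 h
  have hf : (0 : ℝ) < ((N + 1).factorial : ℝ) := by positivity
  have h2 : (0 : ℝ) < √2 := by positivity
  rw [ballotT_self, decay_eq, Stirling.stirlingSeq]
  push_cast
  rw [Real.sqrt_mul (by norm_num), div_pow, ← Real.exp_nat_mul]
  push_cast
  rw [mul_one, Real.exp_add]
  have he := Real.exp_pos 1
  have heN := Real.exp_pos (N : ℝ)
  have hs2 : √((N : ℝ) + 1) ^ 2 = (N : ℝ) + 1 := Real.sq_sqrt h.le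
  have h22 : √2 ^ 2 = (2 : ℝ) := Real.sq_sqrt (by norm_num)
  field_simp
  ring

theorem le_ballotT_self (N : ℕ) : Real.exp N * decay N ≤ ballotT N N := by
  rw [ballotT_self_eq_stirling]
  have hp : 0 < Real.exp N * decay N := mul_pos (Real.exp_pos _) (decay_pos N)
  have h0 := Stirling.stirlingSeq'_pos N
  have h1 : Stirling.stirlingSeq (N + 1) ≤ Real.exp 1 / √2 := by
    have := Stirling.stirlingSeq'_antitone (Nat.zero_le N)
    simpa [Stirling.stirlingSeq_one] using this
  have h2 : (0 : ℝ) < √2 := by positivity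
  refine le_mul_of_one_le_left hp.le ?_
  rw [le_div_iff₀ (by positivity), one_mul]
  rw [le_div_iff₀ h2] at h1
  linarith

theorem ballotT_self_le (N : ℕ) : ballotT N N ≤ 2 * (Real.exp N * decay N) := by
  rw [ballotT_self_eq_stirling]
  have hp : 0 < Real.exp N * decay N := mul_pos (Real.exp_pos _) (decay_pos N)
  have h1 := Stirling.sqrt_pi_le_stirlingSeq (n := N + 1) (by omega)
  have h0 := Stirling.stirlingSeq'_pos N
  refine mul_le_mul_of_nonneg_right ?_ hp.le
  rw [div_le_iff₀ (by positivity)]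
  have h3 : √2 * √π ≤ √2 * Stirling.stirlingSeq (N + 1) :=
    mul_le_mul_of_nonneg_left h1 (by positivity)
  have h4 : (2 : ℝ) ≤ √2 * √π := by
    rw [← Real.sqrt_mul (by norm_num)]
    apply Real.le_sqrt_of_sq_le
    have := Real.pi_gt_three
    linarith
  have := Real.exp_one_lt_d9
  linarith

theorem ballotT_add_le (k h : ℕ) : ballotT (k + h) k ≤ (h + 1) * ballotT (k + h) (k + h) := by
  have e := Nat.factorial_mul_ascFactorial k h
  have e' : ((k + h).factorial : ℝ) = (k.factorial : ℝ) * ((k + 1).ascFactorial h : ℝ) := by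
    exact_mod_cast e.symm
  have h1 : ((k + 1).ascFactorial h : ℝ) ≤ ((k : ℝ) + h + 1) ^ h := by
    have : (k + 1).ascFactorial h ≤ (k + h + 1) ^ h :=
      (Nat.ascFactorial_le_pow_add k h).trans (Nat.pow_le_pow_left (by omega) _)
    exact_mod_cast this
  have hk : (0 : ℝ) < k.factorial := by positivity
  have ha : (0 : ℝ) < (k + 1).ascFactorial h := by exact_mod_cast Nat.ascFactorial_pos k h
  rw [ballotT_add, ballotT_self, Nat.factorial_succ]
  push_cast
  rw [e', pow_add, mul_div_assoc]
  refine mul_le_mul_of_nonneg_left ?_ (by positivity)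
  rw [div_le_div_iff₀ (by positivity) (by positivity)]
  have : 0 ≤ ((k : ℝ) + h + 1) ^ k * ((k : ℝ) + h + 1) * k.factorial := by positivity
  nlinarith [mul_le_mul_of_nonneg_left h1 this]

theorem ballotT_add_ge (k h : ℕ) (hk : 2 * h ^ 2 ≤ k + h + 1) :
    ballotT (k + h) (k + h) ≤ 2 * ballotT (k + h) k := by
  have e := Nat.factorial_mul_ascFactorial k h
  have e' : ((k + h).factorial : ℝ) = (k.factorial : ℝ) * ((k + 1).ascFactorial h : ℝ) := by
    exact_mod_cast e.symm
  have ha0 : (0 : ℝ) < (k : ℝ) + h + 1 := by positivity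
  have h1 : ((k : ℝ) + h + 1) ^ h ≤ 2 * ((k + 1).ascFactorial h : ℝ) := by
    have h2 : ((k : ℝ) + 1) ^ h ≤ ((k + 1).ascFactorial h : ℝ) := by
      exact_mod_cast Nat.pow_succ_le_ascFactorial (k + 1) h
    have h3 : (1 : ℝ) + h * (-(h / ((k : ℝ) + h + 1))) ≤ (1 + (-(h / ((k : ℝ) + h + 1)))) ^ h := by
      apply one_add_mul_le_pow
      rw [neg_le_neg_iff, div_le_iff₀ ha0]
      have : (0:ℝ) ≤ k := by positivity
      have : (0:ℝ) ≤ h := by positivity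
      linarith
    have h4 : (1 : ℝ) / 2 ≤ 1 + h * (-(h / ((k : ℝ) + h + 1))) := by
      have : (h : ℝ) * (h / ((k : ℝ) + h + 1)) ≤ 1 / 2 := by
        rw [← mul_div_assoc, div_le_iff₀ ha0]
        have : (2 * h ^ 2 : ℝ) ≤ k + h + 1 := by exact_mod_cast hk
        linarith
      linarith
    have h5 : (1 + (-(h / ((k : ℝ) + h + 1)))) = ((k : ℝ) + 1) / ((k : ℝ) + h + 1) := by
      field_simp; ring
    rw [h5, div_pow] at h3
    have h6 := h4.trans h3
    rw [le_div_iff₀ (by positivity)] at h6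
    linarith
  have hk : (0 : ℝ) < k.factorial := by positivity
  have ha : (0 : ℝ) < (k + 1).ascFactorial h := by exact_mod_cast Nat.ascFactorial_pos k h
  rw [ballotT_add, ballotT_self, Nat.factorial_succ]
  push_cast
  rw [e', pow_add, ← mul_div_assoc, div_le_div_iff₀ (by positivity) (by positivity)]
  have h2 : (0 : ℝ) ≤ ((k : ℝ) + h + 1) ^ k * ((k : ℝ) + h + 1) * k.factorial := by positivity
  have h3 := mul_le_mul_of_nonneg_left h1 h2
  have h4 : 0 ≤ (h : ℝ) * (((k : ℝ) + h + 1) ^ k * ((k : ℝ) + h + 1) * k.factorial *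
    (k + 1).ascFactorial h) := by positivity
  nlinarith

theorem decay_add_div_le (N n : ℕ) : decay (N + n) ≤ decay n * ((N + 1 : ℝ) ^ (3 / 2 : ℝ)) * decay N := by
  have : (N + 1 : ℝ) ^ (3 / 2 : ℝ) * decay N = 1 := by
    rw [decay, ← Real.rpow_add (by positivity)]; norm_num
  rw [mul_assoc, this, mul_one]
  refine Real.rpow_le_rpow_of_nonpos (by positivity) ?_ (by norm_num)
  push_cast
  have : (0:ℝ) ≤ N := by positivity
  linarith

theorem contV_le (h n r : ℕ) (hr : r + 1 = h + n) :
    contV h n r ≤ 128 * ((h : ℝ) + 1) ^ 3 * (Real.exp n * decay n) := by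
  have hb := ballotT_mul_contV_le (2 * h ^ 2 + h) h n r (by omega) (by omega)
  rw [Nat.add_sub_cancel] at hb
  have h1 := ballotT_add_ge (2 * h ^ 2) h (by omega)
  have h2 : ballotT (2 * h ^ 2 + h + n) (2 * h ^ 2 + r) ≤
      2 * ballotT (2 * h ^ 2 + h + n) (2 * h ^ 2 + h + n) := by
    have := ballotT_add_le (2 * h ^ 2 + r) 1
    rw [show 2 * h ^ 2 + r + 1 = 2 * h ^ 2 + h + n by omega] at this
    refine this.trans (le_of_eq ?_)
    norm_num
  have h3 := ballotT_self_le (2 * h ^ 2 + h + n)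
  have h4 := le_ballotT_self (2 * h ^ 2 + h)
  have h5 := decay_add_div_le (2 * h ^ 2 + h) n
  have h6 : ((2 * h ^ 2 + h : ℕ) + 1 : ℝ) ^ (3 / 2 : ℝ) ≤ 8 * ((h : ℝ) + 1) ^ 3 := by
    have : ((2 * h ^ 2 + h : ℕ) + 1 : ℝ) ≤ (2 * ((h : ℝ) + 1)) ^ (2 : ℝ) := by
      push_cast
      rw [Real.rpow_two]
      have : (0:ℝ) ≤ h := by positivity
      nlinarith
    refine (Real.rpow_le_rpow (by positivity) this (by norm_num)).trans (le_of_eq ?_)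
    rw [← Real.rpow_mul (by positivity)]
    rw [show (2 * (3 / 2) : ℝ) = (3 : ℕ) by norm_num, Real.rpow_natCast]
    ring
  set N := 2 * h ^ 2 + h
  have hd := decay_pos N
  have hdn := decay_pos n
  have hV := contV_nonneg h n r
  have hN := Real.exp_pos N
  have h7 : decay (N + n) ≤ decay n * (8 * ((h : ℝ) + 1) ^ 3) * decay N :=
    h5.trans (by gcongr)
  have h8 : Real.exp N * decay N * contV h n r ≤ 2 * (ballotT N (2 * h ^ 2) * contV h n r) := by
    nlinarith
  have h9 : Real.exp N * decay N * contV h n r ≤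
      8 * (Real.exp (N + n : ℕ) * (decay n * (8 * ((h : ℝ) + 1) ^ 3) * decay N)) := by
    have := mul_le_mul_of_nonneg_left h7 (Real.exp_pos (N + n : ℕ)).le
    linarith
  rw [Nat.cast_add N n, Real.exp_add] at h9
  refine le_of_mul_le_mul_left ?_ (mul_pos hN hd)
  refine h9.trans ?_
  have : 0 ≤ Real.exp N * decay N * ((h : ℝ) + 1) ^ 3 * (Real.exp n * decay n) := by positivity
  nlinarith

theorem exists_pathWt_two_le : ∃ C : ℝ, 0 < C ∧ ∀ J j : ℕ, 1 ≤ J → j ≤ J →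
    pathWt (fun l => if l < j then 2 else 1) J (J - 1) ≤
      C * 2 ^ j * Real.exp J * (decay j * decay (J - j)) := by
  have hs : Summable fun h : ℕ => 256 * ((h : ℝ) + 1) ^ 4 * (1 / 2) ^ h := by
    have := summable_pow_mul_geometric_of_norm_lt_one (R := ℝ) 4 (r := 1 / 2) (by norm_num)
    have := ((summable_nat_add_iff 1).2 this).mul_left 512
    refine this.congr fun n => ?_
    push_cast
    ring
  refine ⟨∑' h : ℕ, 256 * ((h : ℝ) + 1) ^ 4 * (1 / 2) ^ h,
    hs.tsum_pos (fun i => by positivity) 0 (by norm_num), fun J j hJ hj => ?_⟩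
  obtain ⟨n, rfl⟩ := Nat.exists_eq_add_of_le hj
  rw [pathWt_append _ _ _ _ (fun l hl => by simp [not_lt.2 hl]), Nat.add_sub_cancel_left]
  have hterm : ∀ p ∈ Finset.HasAntidiagonal.antidiagonal (j + n - 1),
      pathWt (fun l => if l < j then 2 else 1) j p.1 * contV (j - p.1) n p.2 ≤
      if p.1 ≤ j then (256 * (((j - p.1 : ℕ) : ℝ) + 1) ^ 4 * (1 / 2) ^ (j - p.1)) *
        (2 ^ j * Real.exp (j + n : ℕ) * (decay j * decay n)) else 0 := by
    intro p hp
    have hp' := Finset.HasAntidiagonal.mem_antidiagonal.1 hp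
    split_ifs with hle
    · obtain ⟨i, l⟩ := p
      simp only at hle hp' ⊢
      obtain ⟨h, rfl⟩ := Nat.exists_eq_add_of_le hle
      rw [Nat.add_sub_cancel_left]
      have e1 : pathWt (fun l => if l < i + h then 2 else 1) (i + h) i =
          2 ^ i * ballotT (i + h) i := by
        rw [pathWt_congr (x' := fun l => 2 * (fun _ => (1 : ℝ)) l), pathWt_smul,
          pathWt_one_eq (by omega) (fun _ _ => rfl)]
        intro l hl
        simp [hl]
      have hV := contV_le h n l (by omega)
      have h2 := ballotT_add_le i h
      have h3 := ballotT_self_le (i + h)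
      have h0 := contV_nonneg h n l
      have h4 : ballotT (i + h) i ≤ (h + 1) * (2 * (Real.exp (i + h : ℕ) * decay (i + h))) :=
        h2.trans (mul_le_mul_of_nonneg_left h3 (by positivity))
      have hd := decay_pos (i + h)
      rw [e1]
      calc (2 : ℝ) ^ i * ballotT (i + h) i * contV h n l
          ≤ 2 ^ i * ((h + 1) * (2 * (Real.exp (i + h : ℕ) * decay (i + h)))) *
            (128 * ((h : ℝ) + 1) ^ 3 * (Real.exp n * decay n)) := by
            refine mul_le_mul (mul_le_mul_of_nonneg_left h4 (by positivity)) hV h0 (by positivity)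
        _ = _ := by
            rw [Nat.cast_add (i + h) n, Real.exp_add, pow_add, one_div, inv_pow]
            field_simp
            ring
    · rw [pathWt_eq_zero (by omega), zero_mul]
  refine (Finset.sum_le_sum hterm).trans ?_
  rw [← Finset.sum_filter, ← Finset.sum_mul]
  refine (mul_le_mul_of_nonneg_right (c := ∑' h : ℕ, 256 * ((h : ℝ) + 1) ^ 4 * (1 / 2) ^ h) ?_
    (by have := decay_pos j; have := decay_pos n; positivity)).trans (le_of_eq (by ring))
  rw [← Finset.sum_image (g := fun p : ℕ × ℕ => j - p.1)
    (f := fun h : ℕ => 256 * ((h : ℝ) + 1) ^ 4 * (1 / 2) ^ h)]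
  · exact hs.sum_le_tsum _ fun i _ => by positivity
  · intro p hp q hq hpq
    simp only [Finset.coe_filter, Set.mem_ofPred_eq, Finset.HasAntidiagonal.mem_antidiagonal] at hp hq hpq
    ext <;> omega

theorem decay_mul_decay_le (a b : ℕ) : decay a * decay b ≤ 3 * decay (a + b) * (decay a + decay b) := by
  have key : ∀ a b : ℕ, b ≤ a → decay a ≤ 3 * decay (a + b) := by
    intro a b hab
    have : decay a ≤ (((a + b : ℕ) + 1 : ℝ) / 2) ^ (-(3 / 2) : ℝ) := by
      refine Real.rpow_le_rpow_of_nonpos (by positivity) ?_ (by norm_num)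
      push_cast
      have : (b : ℝ) ≤ a := by exact_mod_cast hab
      linarith
    refine this.trans ?_
    rw [Real.div_rpow (by positivity) (by norm_num), div_eq_mul_inv, mul_comm, decay]
    refine mul_le_mul_of_nonneg_right ?_ (Real.rpow_nonneg (by positivity) _)
    rw [← Real.rpow_neg (by norm_num), neg_neg, show (3 / 2 : ℝ) = 1 + 1 / 2 by norm_num,
      Real.rpow_add (by norm_num), ← Real.sqrt_eq_rpow, Real.rpow_one]
    have : √2 ≤ 3 / 2 := by
      rw [Real.sqrt_le_left (by norm_num)]; norm_num
    linarith
  have ha := decay_pos a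
  have hb := decay_pos b
  have hab := decay_pos (a + b)
  rcases le_total b a with h | h
  · nlinarith [key a b h, mul_pos hab ha]
  · have := key b a h
    rw [add_comm b a] at this
    nlinarith [mul_pos hab hb]

theorem exists_sum_pathWt_two_le : ∃ C : ℝ, 0 < C ∧ ∀ J : ℕ, 1 ≤ J →
    ∑ j ∈ Finset.range J, (1 / 2 : ℝ) ^ (j + 1) *
      pathWt (fun l => if l < j + 1 then 2 else 1) J (J - 1) ≤ C * ballotT J J := by
  obtain ⟨C, hC, h⟩ := exists_pathWt_two_le
  refine ⟨C * 6 * ∑' n, decay n, by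
    have := summable_decay.tsum_pos (fun i => (decay_pos i).le) 0 (decay_pos 0)
    positivity, fun J hJ => ?_⟩
  have h1 : ∀ j ∈ Finset.range J, (1 / 2 : ℝ) ^ (j + 1) *
      pathWt (fun l => if l < j + 1 then 2 else 1) J (J - 1) ≤
      C * 3 * (Real.exp J * decay J) * (decay (j + 1) + decay (J - (j + 1))) := by
    intro j hj
    have hj' := Finset.mem_range.1 hj
    have h2 := h J (j + 1) hJ hj'
    have h3 := decay_mul_decay_le (j + 1) (J - (j + 1))
    rw [Nat.add_sub_cancel' (by omega : j + 1 ≤ J)] at h3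
    calc _ ≤ (1 / 2 : ℝ) ^ (j + 1) * (C * 2 ^ (j + 1) * Real.exp J *
          (3 * decay J * (decay (j + 1) + decay (J - (j + 1))))) := by
          refine mul_le_mul_of_nonneg_left (h2.trans ?_) (by positivity)
          gcongr
      _ = _ := by
          rw [one_div, inv_pow]
          field_simp
  refine (Finset.sum_le_sum h1).trans ?_
  rw [← Finset.mul_sum, Finset.sum_add_distrib]
  have h4 : ∑ j ∈ Finset.range J, decay (j + 1) ≤ ∑' n, decay n := by
    rw [← Finset.sum_image (g := fun j : ℕ => j + 1) (f := decay) (by intro a _ b _; simp)]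
    exact summable_decay.sum_le_tsum _ fun i _ => (decay_pos i).le
  have h5 : ∑ j ∈ Finset.range J, decay (J - (j + 1)) ≤ ∑' n, decay n := by
    rw [← Finset.sum_image (g := fun j : ℕ => J - (j + 1)) (f := decay)]
    · exact summable_decay.sum_le_tsum _ fun i _ => (decay_pos i).le
    · intro a ha b hb hab
      have := Finset.mem_range.1 ha
      have := Finset.mem_range.1 hb
      simp only at hab
      omega
  have h6 := le_ballotT_self J
  have h7 : 0 < Real.exp J * decay J := mul_pos (Real.exp_pos _) (decay_pos J)
  have h8 : 0 ≤ ∑' n, decay n := tsum_nonneg fun i => (decay_pos i).le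
  calc _ ≤ C * 3 * (Real.exp J * decay J) * (∑' n, decay n + ∑' n, decay n) := by gcongr
    _ = C * 6 * (∑' n, decay n) * (Real.exp J * decay J) := by ring
    _ ≤ _ := by gcongr

section Lattice

variable {R : Type*} [CommRing R] {ι : Type*} [Fintype ι] (b : Module.Basis ι ℤ R)

/-- Sup norm of the coordinates with respect to an integral basis. -/
noncomputable def coordNorm (a : R) : ℝ := ‖(fun i => ((b.equivFun a i : ℤ) : ℝ) : ι → ℝ)‖

theorem coordNorm_nonneg (a : R) : 0 ≤ coordNorm b a := norm_nonneg _

theorem coordNorm_zero : coordNorm b 0 = 0 := by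
  rw [coordNorm, norm_eq_zero]; ext; simp

theorem coordNorm_add_le (a c : R) : coordNorm b (a + c) ≤ coordNorm b a + coordNorm b c := by
  have := norm_add_le (fun i => ((b.equivFun a i : ℤ) : ℝ) : ι → ℝ)
    (fun i => ((b.equivFun c i : ℤ) : ℝ))
  refine le_trans (le_of_eq ?_) this
  rw [coordNorm]; congr 1; ext; simp

theorem coordNorm_neg (a : R) : coordNorm b (-a) = coordNorm b a := by
  rw [coordNorm, coordNorm, ← norm_neg]; congr 1; ext; simp

theorem coordNorm_sub_le (a c : R) : coordNorm b (a - c) ≤ coordNorm b a + coordNorm b c := by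
  rw [sub_eq_add_neg, ← coordNorm_neg b c]; exact coordNorm_add_le b _ _

theorem coordNorm_zsmul (n : ℤ) (a : R) : coordNorm b (n • a) = |(n : ℝ)| * coordNorm b a := by
  rw [coordNorm, coordNorm, ← Real.norm_eq_abs, ← norm_smul]; congr 1; ext i
  rw [map_smul]; simp

theorem coordNorm_sum_le {κ : Type*} (s : Finset κ) (f : κ → R) :
    coordNorm b (∑ k ∈ s, f k) ≤ ∑ k ∈ s, coordNorm b (f k) := by
  induction s using Finset.induction_on with
  | empty => simp [coordNorm_zero]
  | insert a s ha ih =>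
    rw [Finset.sum_insert ha, Finset.sum_insert ha]
    exact (coordNorm_add_le b _ _).trans (by linarith)

theorem abs_coord_le (a : R) (i : ι) : |((b.equivFun a i : ℤ) : ℝ)| ≤ coordNorm b a :=
  norm_le_pi_norm (fun i => ((b.equivFun a i : ℤ) : ℝ)) i

theorem coordNorm_le {a : R} {r : ℝ} (hr : 0 ≤ r) (h : ∀ i, |((b.equivFun a i : ℤ) : ℝ)| ≤ r) :
    coordNorm b a ≤ r := (pi_norm_le_iff_of_nonneg hr).2 h

theorem exists_coordNorm_mul_le : ∃ C : ℝ, 1 ≤ C ∧ ∀ a c : R,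
    coordNorm b (a * c) ≤ C * coordNorm b a * coordNorm b c := by
  refine ⟨1 + ∑ i, ∑ j, coordNorm b (b i * b j), ?_, fun a c => ?_⟩
  · have : 0 ≤ ∑ i, ∑ j, coordNorm b (b i * b j) :=
      Finset.sum_nonneg fun i _ => Finset.sum_nonneg fun j _ => coordNorm_nonneg _ _
    linarith
  have e : a * c = ∑ i, ∑ j, (b.equivFun a i * b.equivFun c j) • (b i * b j) := by
    conv_lhs => rw [← b.sum_equivFun a, ← b.sum_equivFun c]
    rw [Finset.sum_mul_sum]
    refine Finset.sum_congr rfl fun i _ => Finset.sum_congr rfl fun j _ => ?_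
    rw [smul_mul_smul_comm]
  have ha := coordNorm_nonneg b a
  have hc := coordNorm_nonneg b c
  calc coordNorm b (a * c) ≤ ∑ i, ∑ j, coordNorm b a * coordNorm b c * coordNorm b (b i * b j) := by
        rw [e]
        refine (coordNorm_sum_le b _ _).trans (Finset.sum_le_sum fun i _ => ?_)
        refine (coordNorm_sum_le b _ _).trans (Finset.sum_le_sum fun j _ => ?_)
        rw [coordNorm_zsmul]
        refine mul_le_mul_of_nonneg_right ?_ (coordNorm_nonneg _ _)
        push_cast
        rw [abs_mul]
        exact mul_le_mul (abs_coord_le b a i) (abs_coord_le b c j) (abs_nonneg _) ha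
    _ = (∑ i, ∑ j, coordNorm b (b i * b j)) * coordNorm b a * coordNorm b c := by
        simp only [Finset.sum_mul]
        refine Finset.sum_congr rfl fun i _ => Finset.sum_congr rfl fun j _ => by ring
    _ ≤ _ := by
        have : 0 ≤ coordNorm b a * coordNorm b c := mul_nonneg ha hc
        nlinarith

/-- The finite set of elements of coordinate norm at most `r`. -/
noncomputable def coordBall (r : ℝ) : Finset R :=
  (Fintype.piFinset fun _ : ι => Finset.Icc (-⌊r⌋) ⌊r⌋).map b.equivFun.symm.toEquiv.toEmbedding

theorem mem_coordBall {r : ℝ} (hr : 0 ≤ r) (a : R) : a ∈ coordBall b r ↔ coordNorm b a ≤ r := by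
  rw [coordBall, Finset.mem_map_equiv, Fintype.mem_piFinset, coordNorm, pi_norm_le_iff_of_nonneg hr]
  refine forall_congr' fun i => ?_
  rw [Finset.mem_Icc, ← abs_le, Real.norm_eq_abs, Int.le_floor]
  push_cast
  rfl

theorem card_coordBall {r : ℝ} (hr : 0 ≤ r) :
    ((coordBall b r).card : ℝ) = (2 * ⌊r⌋ + 1 : ℝ) ^ Fintype.card ι := by
  have h0 : 0 ≤ ⌊r⌋ := Int.floor_nonneg.2 hr
  rw [coordBall, Finset.card_map, Fintype.card_piFinset]
  simp only [Int.card_Icc, Finset.prod_const, Finset.card_univ]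
  push_cast
  congr 1
  have : (((⌊r⌋ + 1 - -⌊r⌋).toNat : ℤ) : ℝ) = ((⌊r⌋ + 1 - -⌊r⌋ : ℤ) : ℝ) := by
    rw [Int.toNat_of_nonneg (by omega)]
  rw [Int.cast_natCast] at this
  rw [this]; push_cast; ring

theorem card_coordBall_le {r : ℝ} (hr : 0 ≤ r) :
    ((coordBall b r).card : ℝ) ≤ (2 * r + 1 : ℝ) ^ Fintype.card ι := by
  rw [card_coordBall b hr]
  have h0 : (0:ℝ) ≤ ⌊r⌋ := by exact_mod_cast Int.floor_nonneg.2 hr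
  have := Int.floor_le r
  gcongr

theorem le_card_coordBall {r : ℝ} (hr : 0 ≤ r) :
    r ^ Fintype.card ι ≤ ((coordBall b r).card : ℝ) := by
  rw [card_coordBall b hr]
  have h0 : (0:ℝ) ≤ ⌊r⌋ := by exact_mod_cast Int.floor_nonneg.2 hr
  have := Int.lt_floor_add_one r
  gcongr
  linarith

variable [IsDedekindDomain R] [Module.Free ℤ R] [Module.Finite ℤ R]

theorem one_le_absNorm {I : Ideal R} (hI : I ≠ ⊥) : 1 ≤ Ideal.absNorm I :=
  Nat.one_le_iff_ne_zero.2 fun h => hI (Ideal.absNorm_eq_zero_iff.1 h)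

/-- The side length `N(I)^(1/g)` attached to an ideal. -/
noncomputable def idealSide (ι : Type*) [Fintype ι] (I : Ideal R) : ℝ :=
  (Ideal.absNorm I : ℝ) ^ (1 / (Fintype.card ι : ℝ))

theorem idealSide_pow [Nonempty ι] (I : Ideal R) :
    idealSide ι I ^ Fintype.card ι = Ideal.absNorm I := by
  rw [idealSide, one_div, Real.rpow_inv_natCast_pow (by positivity) Fintype.card_ne_zero]

theorem one_le_idealSide {I : Ideal R} (hI : I ≠ ⊥) : 1 ≤ idealSide ι I :=
  Real.one_le_rpow (by exact_mod_cast one_le_absNorm hI) (by positivity)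

theorem exists_mem_ideal_coordNorm_le [Nonempty ι] {I : Ideal R} (hI : I ≠ ⊥) :
    ∃ a ∈ I, a ≠ 0 ∧ coordNorm b a ≤ idealSide ι I := by
  set m := idealSide ι I with hm
  have hm1 : 1 ≤ m := one_le_idealSide hI
  have : Finite (R ⧸ I) := (Ideal.absNorm_ne_zero_iff I).1 (Nat.one_le_iff_ne_zero.1 (one_le_absNorm hI))
  have : Fintype (R ⧸ I) := Fintype.ofFinite _
  let T : Finset R :=
    (Fintype.piFinset fun _ : ι => Finset.Icc (0 : ℤ) ⌊m⌋).map b.equivFun.symm.toEquiv.toEmbedding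
  have hT : (T.card : ℝ) = (⌊m⌋ + 1 : ℝ) ^ Fintype.card ι := by
    have h0 : 0 ≤ ⌊m⌋ := Int.floor_nonneg.2 (by linarith)
    simp only [T, Finset.card_map, Fintype.card_piFinset, Int.card_Icc, Finset.prod_const,
      Finset.card_univ]
    push_cast
    congr 1
    have : (((⌊m⌋ + 1 - 0).toNat : ℤ) : ℝ) = ((⌊m⌋ + 1 - 0 : ℤ) : ℝ) := by
      rw [Int.toNat_of_nonneg (by omega)]
    rw [Int.cast_natCast] at this
    rw [this]; push_cast; ring
  have hlt : (Finset.univ : Finset (R ⧸ I)).card < T.card := by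
    have h1 : ((Finset.univ : Finset (R ⧸ I)).card : ℝ) = Ideal.absNorm I := by
      rw [Ideal.absNorm_apply, Submodule.cardQuot_apply, Nat.card_eq_fintype_card, Finset.card_univ]
    have h2 : ((Finset.univ : Finset (R ⧸ I)).card : ℝ) < T.card := by
      rw [h1, hT, ← idealSide_pow (ι := ι)]
      exact pow_lt_pow_left₀ (Int.lt_floor_add_one m) (by positivity) Fintype.card_ne_zero
    exact_mod_cast h2
  obtain ⟨x, hx, y, hy, hxy, he⟩ := Finset.exists_ne_map_eq_of_card_lt_of_maps_to hlt
    (f := fun a => Ideal.Quotient.mk I a) (fun _ _ => Finset.mem_univ _)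
  refine ⟨x - y, Ideal.Quotient.eq.1 he, sub_ne_zero.2 hxy, coordNorm_le b (by linarith) fun i => ?_⟩
  simp only [T, Finset.mem_map_equiv, Fintype.mem_piFinset, Finset.mem_Icc] at hx hy
  have hx' := hx i
  have hy' := hy i
  change 0 ≤ b.equivFun x i ∧ b.equivFun x i ≤ ⌊m⌋ at hx'
  change 0 ≤ b.equivFun y i ∧ b.equivFun y i ≤ ⌊m⌋ at hy'
  rw [map_sub, Pi.sub_apply]
  have h3 : |b.equivFun x i - b.equivFun y i| ≤ ⌊m⌋ := by rw [abs_le]; constructor <;> omega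
  have h4 : ((|b.equivFun x i - b.equivFun y i| : ℤ) : ℝ) ≤ ⌊m⌋ := by exact_mod_cast h3
  rw [Int.cast_abs] at h4
  exact h4.trans (Int.floor_le m)

/-- Every residue class modulo `I` has a representative of size `O(N(I)^(1/g))`. -/
theorem exists_small_representative [Nonempty ι] : ∃ C : ℝ, 1 ≤ C ∧ ∀ I : Ideal R, I ≠ ⊥ → ∀ a : R,
    ∃ c, a - c ∈ I ∧ coordNorm b c ≤ C * idealSide ι I := by
  obtain ⟨C, hC, hmul⟩ := exists_coordNorm_mul_le b
  refine ⟨C, hC, fun I hI a => ?_⟩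
  obtain ⟨a₀, h0I, h0, hle⟩ := exists_mem_ideal_coordNorm_le b hI
  have hspan : Ideal.span {a₀} ≠ ⊥ := by rwa [Ne, Ideal.span_singleton_eq_bot]
  set n : ℕ := Ideal.absNorm (Ideal.span {a₀}) with hn
  have hn1 : 1 ≤ n := one_le_absNorm hspan
  obtain ⟨d, hd⟩ := Ideal.mem_span_singleton.1 (Ideal.absNorm_mem (Ideal.span {a₀}))
  rw [← hn] at hd
  set e := b.equivFun (a * d)
  set q : R := ∑ i, (e i / (n : ℤ)) • b i
  set r : R := ∑ i, (e i % (n : ℤ)) • b i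
  have hqr : a * d = n * q + r := by
    rw [← b.sum_equivFun (a * d), Finset.mul_sum, ← Finset.sum_add_distrib]
    refine Finset.sum_congr rfl fun i _ => ?_
    conv_lhs => rw [show b.equivFun (a * d) i = e i from rfl, ← Int.mul_ediv_add_emod (e i) n]
    simp only [zsmul_eq_mul]
    push_cast
    ring
  refine ⟨a - a₀ * q, by rw [sub_sub_cancel]; exact I.mul_mem_right _ h0I, ?_⟩
  have hnc : (n : R) * (a - a₀ * q) = a₀ * r := by
    linear_combination a * hd + a₀ * hqr
  have hr : coordNorm b r ≤ n := by
    refine coordNorm_le b (by positivity) fun i => ?_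
    have hri : b.equivFun r i = e i % (n : ℤ) := by
      rw [show r = b.equivFun.symm (fun i => e i % (n : ℤ)) from
        (b.equivFun_symm_apply _).symm, LinearEquiv.apply_symm_apply]
    rw [hri]
    have h1 := Int.emod_nonneg (e i) (by omega : (n : ℤ) ≠ 0)
    have h2 := Int.emod_lt_of_pos (e i) (by omega : (0 : ℤ) < n)
    rw [abs_of_nonneg (by exact_mod_cast h1)]
    exact_mod_cast h2.le
  have h7 : 0 ≤ C * idealSide ι I := by
    have := one_le_idealSide (ι := ι) hI
    positivity
  have h3 : (n : ℝ) * coordNorm b (a - a₀ * q) ≤ n * (C * idealSide ι I) := by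
    have : coordNorm b ((n : R) * (a - a₀ * q)) = n * coordNorm b (a - a₀ * q) := by
      have := coordNorm_zsmul b n (a - a₀ * q)
      rw [zsmul_eq_mul] at this
      push_cast at this
      rw [this, abs_of_nonneg (by positivity)]
    rw [← this, hnc]
    refine (hmul _ _).trans ?_
    have h5 := coordNorm_nonneg b a₀
    have h6 := coordNorm_nonneg b r
    calc C * coordNorm b a₀ * coordNorm b r ≤ C * idealSide ι I * n := by gcongr
      _ = _ := by ring
  exact le_of_mul_le_mul_left h3 (by exact_mod_cast hn1)

end Lattice

section LatticeSums

variable {R : Type*} [CommRing R] {ι : Type*} [Fintype ι] [Nonempty ι] (b : Module.Basis ι ℤ R)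
  [IsDedekindDomain R] [Module.Free ℤ R] [Module.Finite ℤ R]

/-- The sum of `h` over the elements of `I` of coordinate norm at most `r`. -/
noncomputable def latticeSum (I : Ideal R) (r : ℝ) (h : R → ℝ) : ℝ :=
  ∑ a ∈ (coordBall b r).filter (· ∈ I), h a

theorem latticeSum_top (r : ℝ) (h : R → ℝ) :
    latticeSum b ⊤ r h = ∑ a ∈ coordBall b r, h a := by
  rw [latticeSum, Finset.filter_true_of_mem (fun _ _ => Submodule.mem_top)]

theorem latticeSum_eq_of_le {I : Ideal R} {r r' : ℝ} (h0 : 0 ≤ r) (hr : r ≤ r') {h : R → ℝ}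
    (hs : ∀ a, h a ≠ 0 → coordNorm b a ≤ r) : latticeSum b I r' h = latticeSum b I r h := by
  symm
  refine Finset.sum_subset (fun a ha => ?_) fun a ha hn => ?_
  · rw [Finset.mem_filter, mem_coordBall b h0] at ha
    rw [Finset.mem_filter, mem_coordBall b (h0.trans hr)]
    exact ⟨ha.1.trans hr, ha.2⟩
  · by_contra hne
    rw [Finset.mem_filter] at ha
    exact hn (Finset.mem_filter.2 ⟨(mem_coordBall b h0 _).2 (hs a hne), ha.2⟩)

/-- Counting lattice points of an ideal, and comparing sums of a Lipschitz function over the ideal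
with sums over the full lattice. -/
theorem exists_latticeSum_bounds : ∃ C : ℝ, 1 ≤ C ∧ ∀ I : Ideal R, I ≠ ⊥ → ∀ r : ℝ,
    idealSide ι I ≤ r →
    (Ideal.absNorm I : ℝ) * ((coordBall b r).filter (· ∈ I)).card ≤ C * r ^ Fintype.card ι ∧
    ∀ (h : R → ℝ) (L : ℝ), 0 ≤ L → (∀ a, h a ≠ 0 → coordNorm b a ≤ r) →
      (∀ a c, |h (a + c) - h a| ≤ L * coordNorm b c) →
      |latticeSum b ⊤ r h - Ideal.absNorm I * latticeSum b I r h| ≤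
        C * r ^ Fintype.card ι * L * idealSide ι I := by
  obtain ⟨C, hC, hrep⟩ := exists_small_representative b
  refine ⟨(3 + 4 * C) ^ Fintype.card ι * C, ?_, fun I hI r hr => ?_⟩
  · have : 1 ≤ (3 + 4 * C) ^ Fintype.card ι := one_le_pow₀ (by linarith)
    nlinarith
  have : Finite (R ⧸ I) :=
    (Ideal.absNorm_ne_zero_iff I).1 (Nat.one_le_iff_ne_zero.1 (one_le_absNorm hI))
  have : Fintype (R ⧸ I) := Fintype.ofFinite _
  have hcardq : (Fintype.card (R ⧸ I) : ℝ) = Ideal.absNorm I := by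
    rw [Ideal.absNorm_apply, Submodule.cardQuot_apply, Nat.card_eq_fintype_card]
  set m := idealSide ι I with hm
  have hm1 : 1 ≤ m := one_le_idealSide hI
  have hex : ∀ q : R ⧸ I, ∃ c : R, Ideal.Quotient.mk I c = q ∧ coordNorm b c ≤ C * m := by
    intro q
    obtain ⟨a, rfl⟩ := Ideal.Quotient.mk_surjective q
    obtain ⟨c, hc, hc'⟩ := hrep I hI a
    exact ⟨c, (Ideal.Quotient.eq.2 hc).symm, hc'⟩
  choose rep hrep1 hrep2 using hex
  have hCm : 0 ≤ C * m := by positivity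
  have hr0 : 0 ≤ r := by linarith
  have hcount : ∀ r' : ℝ, 0 ≤ r' → r' ≤ r + C * m →
      (Ideal.absNorm I : ℝ) * ((coordBall b r').filter (· ∈ I)).card ≤
        (3 + 4 * C) ^ Fintype.card ι * r ^ Fintype.card ι := by
    intro r' hr'0 hr'
    have h1 : (((coordBall b r').filter (· ∈ I)) ×ˢ (Finset.univ : Finset (R ⧸ I))).card ≤
        (coordBall b (r' + C * m)).card := by
      refine Finset.card_le_card_of_injOn (fun p => p.1 + rep p.2) (fun p hp => ?_) ?_
      · rw [Finset.mem_coe, Finset.mem_product, Finset.mem_filter, mem_coordBall b hr'0] at hp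
        rw [Finset.mem_coe, mem_coordBall b (by linarith)]
        exact (coordNorm_add_le b _ _).trans (add_le_add hp.1.1 (hrep2 _))
      · rintro ⟨a, q⟩ hp ⟨a', q'⟩ hp' he
        simp only [Finset.coe_product, Set.mem_prod, Finset.mem_coe, Finset.mem_filter] at hp hp' he
        have hq : q = q' := by
          rw [← hrep1 q, ← hrep1 q']
          have := congrArg (Ideal.Quotient.mk I) he
          rwa [map_add, map_add, Ideal.Quotient.eq_zero_iff_mem.2 hp.1.2,
            Ideal.Quotient.eq_zero_iff_mem.2 hp'.1.2, zero_add, zero_add] at this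
        subst hq
        simpa using he
    rw [Finset.card_product, Finset.card_univ] at h1
    have h2 : ((((coordBall b r').filter (· ∈ I)).card * Fintype.card (R ⧸ I) : ℕ) : ℝ) ≤
        (coordBall b (r' + C * m)).card := by exact_mod_cast h1
    rw [Nat.cast_mul, hcardq] at h2
    calc _ = (((coordBall b r').filter (· ∈ I)).card : ℝ) * Ideal.absNorm I := mul_comm _ _
      _ ≤ (2 * (r' + C * m) + 1) ^ Fintype.card ι :=
        h2.trans (card_coordBall_le b (by linarith))
      _ ≤ ((3 + 4 * C) * r) ^ Fintype.card ι := by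
        refine pow_le_pow_left₀ (by linarith) ?_ _
        nlinarith
      _ = _ := mul_pow _ _ _
  refine ⟨(hcount r hr0 (by linarith)).trans ?_, fun h L hL hs hlip => ?_⟩
  · have : 0 ≤ (3 + 4 * C) ^ Fintype.card ι * r ^ Fintype.card ι := by positivity
    nlinarith
  set B := (coordBall b (r + C * m)).filter (· ∈ I)
  have e1 : latticeSum b ⊤ r h = ∑ a ∈ B, ∑ q : R ⧸ I, h (a + rep q) := by
    rw [latticeSum_top, ← Finset.sum_product']
    refine Finset.sum_bij_ne_zero (fun x _ _ =>
      (x - rep (Ideal.Quotient.mk I x), Ideal.Quotient.mk I x)) ?_ ?_ ?_ ?_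
    · intro x hx _
      rw [mem_coordBall b hr0] at hx
      refine Finset.mem_product.2 ⟨Finset.mem_filter.2 ⟨?_, ?_⟩, Finset.mem_univ _⟩
      · rw [mem_coordBall b (by linarith)]
        exact (coordNorm_sub_le b _ _).trans (add_le_add hx (hrep2 _))
      · exact Ideal.Quotient.eq.1 (hrep1 _).symm
    · intro x _ _ y _ _ he
      rw [Prod.mk.injEq] at he
      have := he.1
      rw [he.2] at this
      simpa using this
    · rintro ⟨a, q⟩ hp hne
      refine ⟨a + rep q, (mem_coordBall b hr0 _).2 (hs _ hne), hne, ?_⟩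
      have hp' := (Finset.mem_filter.1 (Finset.mem_product.1 hp).1).2
      have hq : Ideal.Quotient.mk I (a + rep q) = q := by
        rw [map_add, Ideal.Quotient.eq_zero_iff_mem.2 hp', zero_add, hrep1]
      rw [hq, add_sub_cancel_right]
    · intro x _ _
      rw [sub_add_cancel]
  have e2 : (Ideal.absNorm I : ℝ) * latticeSum b I r h = ∑ a ∈ B, ∑ q : R ⧸ I, h a := by
    rw [← latticeSum_eq_of_le b hr0 (by linarith : r ≤ r + C * m) hs, latticeSum]
    simp only [Finset.sum_const, Finset.card_univ, nsmul_eq_mul, hcardq]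
    rw [← Finset.mul_sum]
  rw [e1, e2, ← Finset.sum_sub_distrib]
  calc |∑ a ∈ B, (∑ q : R ⧸ I, h (a + rep q) - ∑ q : R ⧸ I, h a)|
      ≤ ∑ a ∈ B, (Ideal.absNorm I : ℝ) * (L * (C * m)) := by
        refine (Finset.abs_sum_le_sum_abs _ _).trans (Finset.sum_le_sum fun a _ => ?_)
        rw [← Finset.sum_sub_distrib]
        refine (Finset.abs_sum_le_sum_abs _ _).trans ?_
        calc _ ≤ ∑ q : R ⧸ I, L * (C * m) := Finset.sum_le_sum fun q _ =>
              (hlip _ _).trans (mul_le_mul_of_nonneg_left (hrep2 _) hL)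
          _ = _ := by simp [hcardq]
    _ = ((Ideal.absNorm I : ℝ) * B.card) * (L * (C * m)) := by
        rw [Finset.sum_const, nsmul_eq_mul]; ring
    _ ≤ ((3 + 4 * C) ^ Fintype.card ι * r ^ Fintype.card ι) * (L * (C * m)) :=
        mul_le_mul_of_nonneg_right (hcount _ (by linarith) le_rfl) (by positivity)
    _ = _ := by ring

end LatticeSums

section NormNear

variable {R : Type*} [CommRing R] {ι : Type*} [Fintype ι] [Nonempty ι] (b : Module.Basis ι ℤ R)
  [IsDedekindDomain R] [Module.Free ℤ R] [Module.Finite ℤ R]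

/-- Elements close to the integer `t` have norm close to `t ^ g`. -/
theorem exists_absNorm_near : ∃ ε : ℝ, 0 < ε ∧ ∀ t : ℕ, 1 ≤ t → ∀ a : R,
    coordNorm b (a - t) ≤ ε * t →
    (t : ℝ) ^ Fintype.card ι / 2 ≤ Ideal.absNorm (Ideal.span {a}) ∧
    (Ideal.absNorm (Ideal.span {a}) : ℝ) ≤ 3 / 2 * (t : ℝ) ^ Fintype.card ι := by
  let M : (ι → ℝ) → Matrix ι ι ℝ := fun v =>
    ∑ i, v i • (Algebra.leftMulMatrix b (b i)).map (Int.cast : ℤ → ℝ)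
  have hM : ∀ a : R, M (fun i => ((b.equivFun a i : ℤ) : ℝ)) =
      (Algebra.leftMulMatrix b a).map (Int.cast : ℤ → ℝ) := by
    intro a
    conv_rhs => rw [← b.sum_equivFun a, map_sum]
    ext j k
    simp only [M, map_smul, Matrix.sum_apply, Matrix.map_apply, Matrix.smul_apply, smul_eq_mul,
      Int.cast_sum, Int.cast_mul]
  have hdet : ∀ a : R, (M (fun i => ((b.equivFun a i : ℤ) : ℝ))).det = (Algebra.norm ℤ a : ℝ) := by
    intro a
    rw [hM, Algebra.norm_eq_matrix_det b, ← eq_intCast (Int.castRingHom ℝ), RingHom.map_det]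
    rfl
  have hcont : Continuous fun v => (M v).det := by
    refine Continuous.matrix_det ?_
    refine continuous_finsetSum _ fun i _ => ?_
    exact (continuous_apply i).smul continuous_const
  set v₁ : ι → ℝ := fun i => ((b.equivFun 1 i : ℤ) : ℝ)
  have h1 : (M v₁).det = 1 := by rw [hdet]; simp
  obtain ⟨ε, hε, hball⟩ := Metric.continuousAt_iff.1 (hcont.continuousAt (x := v₁)) (1 / 2) (by norm_num)
  refine ⟨ε / 2, by positivity, fun t ht a ha => ?_⟩
  have ht0 : (0 : ℝ) < t := by exact_mod_cast ht
  set v : ι → ℝ := fun i => ((b.equivFun a i : ℤ) : ℝ) with hv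
  have hsub : coordNorm b (a - t) = t * dist ((t : ℝ)⁻¹ • v) v₁ := by
    rw [dist_eq_norm, ← abs_of_pos ht0, ← Real.norm_eq_abs, ← norm_smul, coordNorm]
    congr 1
    ext i
    have : (t : R) = (t : ℤ) • (1 : R) := by simp
    rw [this, map_sub, map_smul]
    have h3 : ‖(t:ℝ)‖ = t := by simp
    simp only [Pi.sub_apply, Pi.smul_apply, smul_eq_mul, v, v₁, h3]
    push_cast
    field_simp
  have hlt : dist ((t : ℝ)⁻¹ • v) v₁ < ε := by
    rw [hsub, mul_comm] at ha
    have := le_of_mul_le_mul_right ha ht0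
    linarith
  have h2 := hball hlt
  have hsm : M ((t : ℝ)⁻¹ • v) = (t : ℝ)⁻¹ • M v := by
    simp only [M, Finset.smul_sum, Pi.smul_apply, smul_eq_mul, mul_smul]
  rw [hsm, Matrix.det_smul, h1, hdet a, Real.dist_eq, abs_lt] at h2
  have hN : (Ideal.absNorm (Ideal.span {a}) : ℝ) = |(Algebra.norm ℤ a : ℝ)| := by
    rw [Ideal.absNorm_span_singleton, Nat.cast_natAbs, Int.cast_abs]
  have hT : (0 : ℝ) < (t : ℝ) ^ Fintype.card ι := by positivity
  rw [inv_pow] at h2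
  set T := (t : ℝ) ^ Fintype.card ι
  set n := (Algebra.norm ℤ a : ℝ)
  have e : n = T * (T⁻¹ * n) := by field_simp
  have hpos : 0 < n := by rw [e]; exact mul_pos hT (by linarith)
  rw [hN, abs_of_pos hpos]
  constructor
  · rw [e]; nlinarith
  · rw [e]; nlinarith

end NormNear

section PrimeIdeals

variable (R : Type*) [CommRing R] [IsDedekindDomain R] [Module.Free ℤ R] [Module.Finite ℤ R]
  [CharZero R]

/-- The nonzero prime ideals of norm at most `n`. -/
noncomputable def primeIdeals (n : ℕ) : Finset (Ideal R) :=
  (Set.Finite.subset (Ideal.finite_setOfPred_absNorm_le (S := R) n) (fun _ h => h.2.2 :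
    {P : Ideal R | P.IsPrime ∧ P ≠ ⊥ ∧ Ideal.absNorm P ≤ n} ⊆ _)).toFinset

variable {R}

theorem mem_primeIdeals {n : ℕ} {P : Ideal R} :
    P ∈ primeIdeals R n ↔ P.IsPrime ∧ P ≠ ⊥ ∧ Ideal.absNorm P ≤ n := by
  simp [primeIdeals]

/-- The residue characteristic of a prime ideal. -/
noncomputable def residueChar (P : Ideal R) : ℕ := sInf {p | p.Prime ∧ (p : R) ∈ P}

theorem residueChar_spec {P : Ideal R} (hP : P.IsPrime) (h0 : P ≠ ⊥) :
    (residueChar P).Prime ∧ (residueChar P : R) ∈ P ∧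
      ∃ n, 0 < n ∧ Ideal.absNorm P = residueChar P ^ n := by
  have := hP.isMaximal h0
  obtain ⟨p, n, hn, hpP, hp, hN⟩ := Ideal.exists_prime_and_absNorm_eq_pow P
  have hmem : residueChar P ∈ {p : ℕ | p.Prime ∧ (p : R) ∈ P} := Nat.sInf_mem ⟨p, hp, hpP⟩
  have heq : residueChar P = p := by
    by_contra hne
    have hc : IsCoprime (residueChar P : ℤ) (p : ℤ) :=
      Nat.isCoprime_iff_coprime.2 ((Nat.coprime_primes hmem.1 hp).2 hne)
    obtain ⟨u, v, huv⟩ := hc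
    have h1 : (u : R) * (residueChar P : R) + (v : R) * (p : R) = 1 := by
      have := congrArg (Int.cast : ℤ → R) huv
      push_cast at this
      exact this
    refine hP.ne_top ((Ideal.eq_top_iff_one _).2 ?_)
    rw [← h1]
    exact P.add_mem (P.mul_mem_left _ hmem.2) (P.mul_mem_left _ hpP)
  exact ⟨hmem.1, hmem.2, n, hn, heq ▸ hN⟩

theorem residueChar_le_absNorm {P : Ideal R} (hP : P.IsPrime) (h0 : P ≠ ⊥) :
    residueChar P ≤ Ideal.absNorm P := by
  obtain ⟨hp, -, n, hn, h⟩ := residueChar_spec hP h0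
  rw [h]
  exact Nat.le_self_pow hn.ne' _

theorem card_filter_residueChar_le (n p : ℕ) (hp : p.Prime) :
    ((primeIdeals R n).filter (residueChar · = p)).card ≤ Module.finrank ℤ R := by
  set T := (primeIdeals R n).filter (residueChar · = p)
  have hT : ∀ P ∈ T, P.IsPrime ∧ P ≠ ⊥ ∧ (p : R) ∈ P ∧ p ≤ Ideal.absNorm P := by
    intro P hP
    obtain ⟨h1, h2⟩ := Finset.mem_filter.1 hP
    rw [mem_primeIdeals] at h1
    have h3 := residueChar_spec h1.1 h1.2.1
    have h4 := residueChar_le_absNorm h1.1 h1.2.1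
    rw [h2] at h3 h4
    exact ⟨h1.1, h1.2.1, h3.2.1, h4⟩
  have hdvd : ∏ P ∈ T, P ∣ Ideal.span {(p : R)} := by
    refine Finset.prod_primes_dvd _ (fun P hP => Ideal.prime_of_isPrime (hT P hP).2.1 (hT P hP).1)
      fun P hP => ?_
    rw [Ideal.dvd_span_singleton]
    exact (hT P hP).2.2.1
  have h1 := map_dvd Ideal.absNorm hdvd
  rw [map_prod, Ideal.absNorm_span_natCast] at h1
  have h2 : p ^ T.card ≤ ∏ P ∈ T, Ideal.absNorm P := by
    rw [← Finset.prod_const]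
    exact Finset.prod_le_prod' fun P hP => (hT P hP).2.2.2
  exact (Nat.pow_le_pow_iff_right hp.one_lt).1
    (h2.trans (Nat.le_of_dvd (pow_pos hp.pos _) h1))

theorem sum_residueChar_le (n : ℕ) {ψ : ℕ → ℝ} (hψ : ∀ p, 0 ≤ ψ p) :
    ∑ P ∈ primeIdeals R n, ψ (residueChar P) ≤
      Module.finrank ℤ R * ∑ p ∈ (Finset.range (n + 1)).filter Nat.Prime, ψ p := by
  have hmaps : ∀ P ∈ primeIdeals R n, residueChar P ∈ (Finset.range (n + 1)).filter Nat.Prime := by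
    intro P hP
    rw [mem_primeIdeals] at hP
    have := residueChar_le_absNorm hP.1 hP.2.1
    exact Finset.mem_filter.2 ⟨Finset.mem_range.2 (by omega), (residueChar_spec hP.1 hP.2.1).1⟩
  rw [← Finset.sum_fiberwise_of_maps_to hmaps, Finset.mul_sum]
  refine Finset.sum_le_sum fun p hp => ?_
  rw [Finset.sum_congr rfl (fun P hP => by rw [(Finset.mem_filter.1 hP).2] :
    ∀ P ∈ (primeIdeals R n).filter (residueChar · = p), ψ (residueChar P) = ψ p),
    Finset.sum_const, nsmul_eq_mul]
  exact mul_le_mul_of_nonneg_right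
    (by exact_mod_cast card_filter_residueChar_le n p (Finset.mem_filter.1 hp).2) (hψ p)

/-- The logarithm of the norm of an ideal as a sum over prime powers containing it. -/
theorem log_absNorm_eq {I : Ideal R} (hI : I ≠ ⊥) {n : ℕ} (hn : Ideal.absNorm I ≤ n) :
    Real.log (Ideal.absNorm I) = ∑ P ∈ primeIdeals R n, Real.log (Ideal.absNorm P) *
      ∑ k ∈ Finset.Icc 1 n, if I ≤ P ^ k then 1 else 0 := by
  have hcount : ∀ P ∈ primeIdeals R n, (∑ k ∈ Finset.Icc 1 n, if I ≤ P ^ k then (1:ℝ) else 0) =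
      (UniqueFactorizationMonoid.normalizedFactors I).count P := by
    intro P hP
    rw [mem_primeIdeals] at hP
    have hirr : Irreducible P := (Ideal.prime_of_isPrime hP.2.1 hP.1).irreducible
    have hiff : ∀ k, I ≤ P ^ k ↔ k ≤ (UniqueFactorizationMonoid.normalizedFactors I).count P := by
      intro k
      rw [← Ideal.dvd_iff_le, pow_dvd_iff_le_emultiplicity,
        UniqueFactorizationMonoid.emultiplicity_eq_count_normalizedFactors hirr hI, normalize_eq]
      exact_mod_cast Iff.rfl
    have h2 : 2 ≤ Ideal.absNorm P := by
      obtain ⟨h3, -⟩ := residueChar_spec hP.1 hP.2.1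
      exact h3.two_le.trans (residueChar_le_absNorm hP.1 hP.2.1)
    have hle : (UniqueFactorizationMonoid.normalizedFactors I).count P ≤ n := by
      have h3 := map_dvd Ideal.absNorm (Ideal.dvd_iff_le.2 ((hiff _).2 le_rfl))
      rw [map_pow] at h3
      have h4 := Nat.le_of_dvd (one_le_absNorm hI) h3
      exact ((Nat.lt_pow_self (by omega)).le.trans h4).trans hn
    rw [Finset.sum_boole]
    congr 1
    rw [show (Finset.Icc 1 n).filter (fun k => I ≤ P ^ k) =
      Finset.Icc 1 ((UniqueFactorizationMonoid.normalizedFactors I).count P) from ?_]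
    · simp
    · ext k
      simp only [Finset.mem_filter, Finset.mem_Icc, hiff]
      omega
  rw [Finset.sum_congr rfl fun P hP => by rw [hcount P hP]]
  have hsub : (UniqueFactorizationMonoid.normalizedFactors I).toFinset ⊆ primeIdeals R n := by
    intro P hP
    rw [Multiset.mem_toFinset] at hP
    have hp := UniqueFactorizationMonoid.prime_of_normalized_factor P hP
    have hd := UniqueFactorizationMonoid.dvd_of_mem_normalizedFactors hP
    exact mem_primeIdeals.2 ⟨Ideal.isPrime_of_prime hp, hp.ne_zero,
      (Nat.le_of_dvd (one_le_absNorm hI) (map_dvd Ideal.absNorm hd)).trans hn⟩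
  conv_lhs => rw [← Ideal.prod_normalizedFactors_eq_self hI, Finset.prod_multiset_count_of_subset _ _ hsub,
    map_prod]
  rw [Nat.cast_prod, Real.log_prod]
  · refine Finset.sum_congr rfl fun P _ => ?_
    rw [map_pow, Nat.cast_pow, Real.log_pow, mul_comm]
  · intro P hP
    rw [map_pow]
    have := one_le_absNorm (mem_primeIdeals.1 hP).2.1
    positivity

end PrimeIdeals

theorem sum_log_prime_le (n : ℕ) :
    ∑ p ∈ (Finset.range (n + 1)).filter Nat.Prime, Real.log p ≤ Real.log 4 * n := by
  have h := Chebyshev.theta_le_log4_mul_x (x := (n : ℝ)) (by positivity)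
  refine le_trans (le_of_eq ?_) h
  rw [Chebyshev.theta, Nat.floor_natCast]
  refine Finset.sum_congr ?_ fun _ _ => rfl
  ext p
  simp only [Finset.mem_filter, Finset.mem_range, Finset.mem_Ioc]
  constructor
  · rintro ⟨h1, h2⟩; exact ⟨⟨h2.pos, by omega⟩, h2⟩
  · rintro ⟨h1, h2⟩; exact ⟨by omega, h2⟩

theorem exists_sum_log_prime_rpow_le {a : ℝ} (ha : 0 < a) (ha1 : a ≤ 1) : ∃ C : ℝ, 0 ≤ C ∧ ∀ n : ℕ,
    ∑ p ∈ (Finset.range (n + 1)).filter Nat.Prime, Real.log p * (p : ℝ) ^ (a - 1) ≤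
      C * (n : ℝ) ^ a := by
  have h2a : (2 : ℝ) ^ (-a) < 1 := Real.rpow_lt_one_of_one_lt_of_neg (by norm_num) (by linarith)
  have hd : 0 < 1 - (2 : ℝ) ^ (-a) := by linarith
  set B := Real.log 4 * (2 : ℝ) ^ (1 - a) with hB
  have hB0 : 0 ≤ B := mul_nonneg (Real.log_nonneg (by norm_num)) (by positivity)
  refine ⟨B / (1 - 2 ^ (-a)), by positivity, fun n => ?_⟩
  set A := B / (1 - 2 ^ (-a)) with hA
  have hAB : A * 2 ^ (-a) + B = A := by rw [hA]; field_simp; ring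
  have hA0 : 0 ≤ A := by positivity
  induction n using Nat.strong_induction_on with
  | _ n ih =>
    rcases Nat.eq_zero_or_pos n with rfl | hn
    · have : (Finset.range (0 + 1)).filter Nat.Prime = ∅ := by decide
      rw [this, Finset.sum_empty]
      positivity
    have hn0 : (0 : ℝ) < n := by exact_mod_cast hn
    have hsplit : (Finset.range (n + 1)).filter Nat.Prime =
        (Finset.range (n / 2 + 1)).filter Nat.Prime ∪
          (Finset.Ico (n / 2 + 1) (n + 1)).filter Nat.Prime := by
      ext p
      simp only [Finset.mem_filter, Finset.mem_range, Finset.mem_union, Finset.mem_Ico]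
      constructor
      · rintro ⟨h1, h2⟩
        by_cases h : p < n / 2 + 1
        · exact Or.inl ⟨h, h2⟩
        · exact Or.inr ⟨⟨by omega, h1⟩, h2⟩
      · rintro (⟨h1, h2⟩ | ⟨h1, h2⟩)
        · exact ⟨by omega, h2⟩
        · exact ⟨h1.2, h2⟩
    have hdisj : Disjoint ((Finset.range (n / 2 + 1)).filter Nat.Prime)
        ((Finset.Ico (n / 2 + 1) (n + 1)).filter Nat.Prime) := by
      rw [Finset.disjoint_left]
      intro p h1 h2
      simp only [Finset.mem_filter, Finset.mem_range, Finset.mem_Ico] at h1 h2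
      omega
    rw [hsplit, Finset.sum_union hdisj]
    have h1 := ih (n / 2) (by omega)
    have h2 : ∑ p ∈ (Finset.Ico (n / 2 + 1) (n + 1)).filter Nat.Prime,
        Real.log p * (p : ℝ) ^ (a - 1) ≤ B * (n : ℝ) ^ a := by
      calc _ ≤ ∑ p ∈ (Finset.Ico (n / 2 + 1) (n + 1)).filter Nat.Prime,
            Real.log p * ((n : ℝ) / 2) ^ (a - 1) := by
            refine Finset.sum_le_sum fun p hp => ?_
            simp only [Finset.mem_filter, Finset.mem_Ico] at hp
            refine mul_le_mul_of_nonneg_left ?_ (Real.log_natCast_nonneg p)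
            refine Real.rpow_le_rpow_of_nonpos (by positivity) ?_ (by linarith)
            have : n ≤ 2 * p := by omega
            have : (n : ℝ) ≤ 2 * p := by exact_mod_cast this
            linarith
        _ ≤ ∑ p ∈ (Finset.range (n + 1)).filter Nat.Prime,
            Real.log p * ((n : ℝ) / 2) ^ (a - 1) := by
            refine Finset.sum_le_sum_of_subset_of_nonneg ?_ fun p _ _ =>
              mul_nonneg (Real.log_natCast_nonneg p) (by positivity)
            rw [hsplit]
            exact Finset.subset_union_right
        _ ≤ (Real.log 4 * n) * ((n : ℝ) / 2) ^ (a - 1) := by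
            rw [← Finset.sum_mul]
            exact mul_le_mul_of_nonneg_right (sum_log_prime_le n) (by positivity)
        _ = B * (n : ℝ) ^ a := by
            have e1 : (n : ℝ) ^ a = n * (n : ℝ) ^ (a - 1) := by
              rw [Real.rpow_sub_one hn0.ne']; field_simp
            have e2 : (2 : ℝ) ^ (1 - a) = ((2 : ℝ) ^ (a - 1))⁻¹ := by
              rw [← Real.rpow_neg (by norm_num)]; ring_nf
            rw [hB, Real.div_rpow hn0.le (by norm_num), e1, e2]
            ring
    have h3 : ((n / 2 : ℕ) : ℝ) ^ a ≤ 2 ^ (-a) * (n : ℝ) ^ a := by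
      calc ((n / 2 : ℕ) : ℝ) ^ a ≤ ((n : ℝ) / 2) ^ a := by
            refine Real.rpow_le_rpow (by positivity) Nat.cast_div_le ha.le
        _ = _ := by rw [Real.div_rpow hn0.le (by norm_num), Real.rpow_neg (by norm_num)]; ring
    calc _ ≤ A * (2 ^ (-a) * (n : ℝ) ^ a) + B * (n : ℝ) ^ a :=
          add_le_add (h1.trans (mul_le_mul_of_nonneg_left h3 hA0)) h2
      _ = (A * 2 ^ (-a) + B) * (n : ℝ) ^ a := by ring
      _ = _ := by rw [hAB]

section

variable (R : Type*) [CommRing R] [IsDedekindDomain R] [Module.Free ℤ R] [Module.Finite ℤ R]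
  [CharZero R]

theorem exists_sum_residueChar_rpow_le : ∃ C : ℝ, 0 ≤ C ∧ ∀ n : ℕ,
    ∑ P ∈ primeIdeals R n, 4 * (residueChar P : ℝ) ^ (-(3 / 2) : ℝ) ≤ C := by
  have hs : Summable fun p : ℕ => 4 * (p : ℝ) ^ (-(3 / 2) : ℝ) :=
    (Real.summable_nat_rpow.2 (by norm_num)).mul_left 4
  refine ⟨Module.finrank ℤ R * ∑' p : ℕ, 4 * (p : ℝ) ^ (-(3 / 2) : ℝ),
    mul_nonneg (by positivity) (tsum_nonneg fun _ => by positivity), fun n => ?_⟩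
  refine (sum_residueChar_le n (ψ := fun p => 4 * (p : ℝ) ^ (-(3 / 2) : ℝ))
    fun p => by positivity).trans ?_
  exact mul_le_mul_of_nonneg_left (hs.sum_le_tsum _ fun _ _ => by positivity) (by positivity)

variable {R} in
theorem log_div_sq_absNorm_le {P : Ideal R} (hP : P.IsPrime) (h0 : P ≠ ⊥) :
    Real.log (Ideal.absNorm P) / (Ideal.absNorm P : ℝ) ^ 2 ≤
      4 * (residueChar P : ℝ) ^ (-(3 / 2) : ℝ) := by
  have h1 : (1 : ℝ) ≤ residueChar P := by exact_mod_cast (residueChar_spec hP h0).1.one_lt.le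
  have h2 : (residueChar P : ℝ) ≤ Ideal.absNorm P := by
    exact_mod_cast residueChar_le_absNorm hP h0
  set N := (Ideal.absNorm P : ℝ)
  set p := (residueChar P : ℝ)
  have hN : 0 < N := by linarith
  have h3 := Real.log_le_rpow_div hN.le (by norm_num : (0:ℝ) < 1 / 4)
  calc Real.log N / N ^ 2 ≤ (N ^ (1 / 4 : ℝ) / (1 / 4)) / N ^ 2 := by gcongr
    _ = 4 * N ^ (-(7 / 4) : ℝ) := by
      rw [show (-(7/4) : ℝ) = 1 / 4 - 2 by norm_num, Real.rpow_sub hN, Real.rpow_two]; ring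
    _ ≤ 4 * p ^ (-(7 / 4) : ℝ) := by
      refine mul_le_mul_of_nonneg_left ?_ (by norm_num)
      exact Real.rpow_le_rpow_of_nonpos (by linarith) h2 (by norm_num)
    _ ≤ _ := by
      refine mul_le_mul_of_nonneg_left ?_ (by norm_num)
      exact Real.rpow_le_rpow_of_exponent_le h1 (by norm_num)

variable {R} in
theorem log_div_absNorm_le {P : Ideal R} (hP : P.IsPrime) (h0 : P ≠ ⊥)
    (hne : Ideal.absNorm P ≠ residueChar P) :
    Real.log (Ideal.absNorm P) / (Ideal.absNorm P : ℝ) ≤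
      4 * (residueChar P : ℝ) ^ (-(3 / 2) : ℝ) := by
  obtain ⟨hp, -, n, hn, hPn⟩ := residueChar_spec hP h0
  have h1 : (1 : ℝ) ≤ residueChar P := by exact_mod_cast hp.one_lt.le
  have h2 : (residueChar P : ℝ) ^ 2 ≤ Ideal.absNorm P := by
    have : n ≠ 1 := by rintro rfl; simp at hPn; exact hne hPn
    rw [hPn]
    push_cast
    exact pow_le_pow_right₀ h1 (by omega)
  set N := (Ideal.absNorm P : ℝ)
  set p := (residueChar P : ℝ)
  have hN : 0 < N := lt_of_lt_of_le (by positivity) h2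
  have h3 := Real.log_le_rpow_div hN.le (by norm_num : (0:ℝ) < 1 / 4)
  calc Real.log N / N ≤ (N ^ (1 / 4 : ℝ) / (1 / 4)) / N := by gcongr
    _ = 4 * N ^ (-(3 / 4) : ℝ) := by
      rw [show (-(3/4) : ℝ) = 1 / 4 - 1 by norm_num, Real.rpow_sub hN, Real.rpow_one]; ring
    _ ≤ 4 * (p ^ 2) ^ (-(3 / 4) : ℝ) := by
      refine mul_le_mul_of_nonneg_left ?_ (by norm_num)
      exact Real.rpow_le_rpow_of_nonpos (by positivity) h2 (by norm_num)
    _ = _ := by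
      rw [← Real.rpow_natCast, ← Real.rpow_mul (by linarith)]; norm_num

theorem exists_sum_log_absNorm_rpow_le {a : ℝ} (ha : 0 < a) (ha1 : a ≤ 1) :
    ∃ C : ℝ, 0 ≤ C ∧ ∀ n : ℕ, ∑ P ∈ primeIdeals R n,
      Real.log (Ideal.absNorm P) * (Ideal.absNorm P : ℝ) ^ (a - 1) ≤ C * (n : ℝ) ^ a := by
  obtain ⟨C₁, hC₁, h1⟩ := exists_sum_log_prime_rpow_le ha ha1
  obtain ⟨C₂, hC₂, h2⟩ := exists_sum_residueChar_rpow_le R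
  refine ⟨Module.finrank ℤ R * C₁ + C₂, by positivity, fun n => ?_⟩
  have hna : (0 : ℝ) ≤ (n : ℝ) ^ a := by positivity
  calc _ ≤ ∑ P ∈ primeIdeals R n, (Real.log (residueChar P) * (residueChar P : ℝ) ^ (a - 1) +
        (4 * (residueChar P : ℝ) ^ (-(3 / 2) : ℝ)) * (n : ℝ) ^ a) := by
        refine Finset.sum_le_sum fun P hP => ?_
        rw [mem_primeIdeals] at hP
        by_cases he : Ideal.absNorm P = residueChar P
        · rw [he]
          have : 0 ≤ (4 * (residueChar P : ℝ) ^ (-(3 / 2) : ℝ)) * (n : ℝ) ^ a := by positivity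
          linarith
        · have h3 := log_div_absNorm_le hP.1 hP.2.1 he
          have h4 : 0 ≤ Real.log (residueChar P) * (residueChar P : ℝ) ^ (a - 1) :=
            mul_nonneg (Real.log_natCast_nonneg _) (by positivity)
          have h5 : (0 : ℝ) < Ideal.absNorm P := by exact_mod_cast one_le_absNorm hP.2.1
          have h6 : (Ideal.absNorm P : ℝ) ^ a ≤ (n : ℝ) ^ a :=
            Real.rpow_le_rpow h5.le (by exact_mod_cast hP.2.2) ha.le
          have h7 : Real.log (Ideal.absNorm P) * (Ideal.absNorm P : ℝ) ^ (a - 1) =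
              Real.log (Ideal.absNorm P) / (Ideal.absNorm P : ℝ) * (Ideal.absNorm P : ℝ) ^ a := by
            rw [Real.rpow_sub_one h5.ne']; ring
          rw [h7]
          have := mul_le_mul h3 h6 (by positivity) (by positivity)
          linarith
    _ ≤ Module.finrank ℤ R * (C₁ * (n : ℝ) ^ a) + C₂ * (n : ℝ) ^ a := by
        rw [Finset.sum_add_distrib, ← Finset.sum_mul]
        refine add_le_add ?_ (mul_le_mul_of_nonneg_right (h2 n) hna)
        refine (sum_residueChar_le n (ψ := fun p => Real.log p * (p : ℝ) ^ (a - 1))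
          fun p => mul_nonneg (Real.log_natCast_nonneg p) (by positivity)).trans ?_
        exact mul_le_mul_of_nonneg_left (h1 n) (by positivity)
    _ = _ := by ring

end

section Bump

variable {R : Type*} [CommRing R] {ι : Type*} [Fintype ι] (b : Module.Basis ι ℤ R)

/-- A tent function centred at the integer `t`, of radius `ε t`. -/
noncomputable def tent (ε : ℝ) (t : ℕ) (a : R) : ℝ := max 0 (1 - coordNorm b (a - t) / (ε * t))

variable {b} {ε : ℝ} {t : ℕ}

theorem tent_nonneg (a : R) : 0 ≤ tent b ε t a := le_max_left _ _

theorem tent_le_one (hε : 0 < ε) (a : R) : tent b ε t a ≤ 1 := by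
  have := coordNorm_nonneg b (a - t)
  have : 0 ≤ coordNorm b (a - t) / (ε * t) := by positivity
  exact max_le (by norm_num) (by linarith)

theorem coordNorm_sub_le_of_tent_ne_zero (hε : 0 < ε) (ht : 1 ≤ t) {a : R}
    (h : tent b ε t a ≠ 0) : coordNorm b (a - t) ≤ ε * t := by
  by_contra hlt
  push Not at hlt
  have ht0 : (0 : ℝ) < t := by exact_mod_cast ht
  refine h (max_eq_left ?_)
  have : 1 ≤ coordNorm b (a - t) / (ε * t) := (one_le_div (by positivity)).2 hlt.le
  linarith

theorem coordNorm_le_of_tent_ne_zero (hε : 0 < ε) (ht : 1 ≤ t) {a : R}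
    (h : tent b ε t a ≠ 0) : coordNorm b a ≤ (coordNorm b 1 + ε) * t := by
  have h1 := coordNorm_sub_le_of_tent_ne_zero hε ht h
  have h2 := coordNorm_add_le b (a - t) t
  have h3 : coordNorm b (t : R) = t * coordNorm b 1 := by
    have := coordNorm_zsmul b t (1 : R)
    simpa using this
  rw [sub_add_cancel, h3] at h2
  linarith

theorem abs_tent_sub_le (hε : 0 < ε) (a c : R) :
    |tent b ε t (a + c) - tent b ε t a| ≤ 1 / (ε * t) * coordNorm b c := by
  refine (abs_max_sub_max_le_max 0 (1 - coordNorm b (a + c - t) / (ε * t)) 0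
    (1 - coordNorm b (a - t) / (ε * t))).trans ?_
  have h1 := coordNorm_add_le b (a - t) c
  have h2 := coordNorm_sub_le b (a + c - t) c
  rw [show a - t + c = a + c - t by ring] at h1
  rw [show a + c - t - c = a - t by ring] at h2
  have h3 : |coordNorm b (a - t) - coordNorm b (a + c - t)| ≤ coordNorm b c :=
    abs_le.2 ⟨by linarith, by linarith⟩
  refine max_le (by simpa using mul_nonneg (by positivity) (coordNorm_nonneg b c)) ?_
  rw [show 1 - coordNorm b (a + c - t) / (ε * t) - (1 - coordNorm b (a - t) / (ε * t)) =
    1 / (ε * t) * (coordNorm b (a - t) - coordNorm b (a + c - t)) by ring, abs_mul,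
    abs_of_nonneg (by positivity : 0 ≤ 1 / (ε * t))]
  exact mul_le_mul_of_nonneg_left h3 (by positivity)

theorem le_sum_tent (hε : 0 < ε) (ht : 1 ≤ t) {r : ℝ} (hr : (coordNorm b 1 + ε) * t ≤ r) :
    1 / 2 * (ε / 2) ^ Fintype.card ι * (t : ℝ) ^ Fintype.card ι ≤
      ∑ a ∈ coordBall b r, tent b ε t a := by
  have ht0 : (0 : ℝ) < t := by exact_mod_cast ht
  have hN1 := coordNorm_nonneg b 1
  have hr0 : 0 ≤ r := le_trans (by positivity) hr
  have hval : ∀ c ∈ coordBall b (ε / 2 * t), 1 / 2 ≤ tent b ε t (t + c) := by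
    intro c hc
    rw [mem_coordBall b (by positivity)] at hc
    refine le_max_of_le_right ?_
    rw [add_sub_cancel_left]
    have : coordNorm b c / (ε * t) ≤ 1 / 2 := by
      rw [div_le_iff₀ (by positivity)]; linarith
    linarith
  calc _ = (ε / 2 * t) ^ Fintype.card ι * (1 / 2) := by rw [mul_pow]; ring
    _ ≤ (coordBall b (ε / 2 * t)).card * (1 / 2) :=
      mul_le_mul_of_nonneg_right (le_card_coordBall b (by positivity)) (by norm_num)
    _ ≤ ∑ c ∈ coordBall b (ε / 2 * t), tent b ε t (t + c) := by
      rw [← nsmul_eq_mul]; exact Finset.card_nsmul_le_sum _ _ _ hval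
    _ = ∑ a ∈ (coordBall b (ε / 2 * t)).map (addLeftEmbedding (t : R)), tent b ε t a := by
      rw [Finset.sum_map]; rfl
    _ ≤ _ := by
      refine Finset.sum_le_sum_of_subset_of_nonneg (fun a ha => ?_) fun a _ _ => tent_nonneg a
      obtain ⟨c, hc, rfl⟩ := Finset.mem_map.1 ha
      rw [mem_coordBall b hr0]
      have := hval c hc
      exact (coordNorm_le_of_tent_ne_zero hε ht (by
        change tent b ε t (t + c) ≠ 0
        linarith)).trans hr

end Bump

section MertensIdeals

variable {R : Type*} [CommRing R] {ι : Type*} [Fintype ι] [Nonempty ι] (b : Module.Basis ι ℤ R)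
  [IsDedekindDomain R] [Module.Free ℤ R] [Module.Finite ℤ R] [CharZero R]

theorem sum_mul_log_absNorm_eq {n : ℕ} {r : ℝ} {h : R → ℝ}
    (hn : ∀ a, h a ≠ 0 → a ≠ 0 ∧ Ideal.absNorm (Ideal.span {a}) ≤ n) :
    ∑ a ∈ coordBall b r, h a * Real.log (Ideal.absNorm (Ideal.span {a})) =
      ∑ P ∈ primeIdeals R n, Real.log (Ideal.absNorm P) *
        ∑ k ∈ Finset.Icc 1 n, latticeSum b (P ^ k) r h := by
  have e : ∀ a, h a * Real.log (Ideal.absNorm (Ideal.span {a})) =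
      ∑ P ∈ primeIdeals R n, ∑ k ∈ Finset.Icc 1 n,
        Real.log (Ideal.absNorm P) * if a ∈ P ^ k then h a else 0 := by
    intro a
    by_cases ha : h a = 0
    · simp [ha]
    · obtain ⟨h0, hN⟩ := hn a ha
      rw [log_absNorm_eq (by simpa using h0) hN, Finset.mul_sum]
      refine Finset.sum_congr rfl fun P _ => ?_
      rw [Finset.mul_sum, Finset.mul_sum]
      refine Finset.sum_congr rfl fun k _ => ?_
      rw [Ideal.span_singleton_le_iff_mem]
      split_ifs <;> ring
  rw [Finset.sum_congr rfl fun a _ => e a, Finset.sum_comm]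
  refine Finset.sum_congr rfl fun P _ => ?_
  rw [Finset.sum_comm, Finset.mul_sum]
  refine Finset.sum_congr rfl fun k _ => ?_
  rw [← Finset.mul_sum, latticeSum, Finset.sum_filter]

theorem sum_Icc_two_inv_pow_le {N : ℝ} (hN : 2 ≤ N) (n : ℕ) :
    ∑ k ∈ Finset.Icc 2 n, (N ^ k)⁻¹ ≤ 2 / N ^ 2 := by
  have hsub : Finset.Icc 2 n ⊆ (Finset.range n).map (addRightEmbedding 2) := fun k hk => by
    rw [Finset.mem_Icc] at hk
    exact Finset.mem_map.2 ⟨k - 2, Finset.mem_range.2 (by omega), by simp; omega⟩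
  calc _ ≤ ∑ k ∈ Finset.range n, (N ^ (k + 2))⁻¹ := by
        have := Finset.sum_le_sum_of_subset_of_nonneg (f := fun k => (N ^ k)⁻¹) hsub
          fun _ _ _ => by positivity
        rwa [Finset.sum_map] at this
    _ ≤ ∑ k ∈ Finset.range n, (1 / 2 : ℝ) ^ k * (1 / N ^ 2) := by
        refine Finset.sum_le_sum fun k _ => ?_
        rw [pow_add, mul_inv, one_div (N ^ 2), one_div, inv_pow]
        gcongr
    _ ≤ 2 * (1 / N ^ 2) := by
        rw [← Finset.sum_mul]
        exact mul_le_mul_of_nonneg_right (sum_geometric_two_le n) (by positivity)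
    _ = _ := by ring

end MertensIdeals

theorem exists_mertens_primeIdeals_pow {R : Type*} [CommRing R] {ι : Type*} [Fintype ι] [Nonempty ι]
    (b : Module.Basis ι ℤ R) [IsDedekindDomain R] [Module.Free ℤ R] [Module.Finite ℤ R]
    [CharZero R] : ∃ C : ℝ, ∀ t : ℕ, 1 ≤ t →
    |∑ P ∈ primeIdeals R (2 * t ^ Fintype.card ι),
      Real.log (Ideal.absNorm P) / (Ideal.absNorm P : ℝ) - Fintype.card ι * Real.log t| ≤ C := by
  obtain ⟨ε, hε, hnear⟩ := exists_absNorm_near b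
  obtain ⟨C₁, hC₁, hlat⟩ := exists_latticeSum_bounds b
  set g := Fintype.card ι with hg
  have hg0 : 0 < g := Fintype.card_pos
  have hg1 : (1 : ℝ) ≤ g := by exact_mod_cast hg0
  obtain ⟨C₂, hC₂, hrp⟩ := exists_sum_log_absNorm_rpow_le R (a := 1 / (g : ℝ)) (by positivity)
    ((div_le_one (by positivity)).2 hg1)
  obtain ⟨C₃, hC₃, hsq⟩ := exists_sum_residueChar_rpow_le R
  set K := coordNorm b 1 + ε + 2 with hK
  have hN1 := coordNorm_nonneg b 1
  have hK0 : 0 < K := by positivity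
  set c := 1 / 2 * (ε / 2) ^ g with hc
  have hc0 : 0 < c := by positivity
  set E := C₁ * K ^ g / ε * C₂ * 2 + 2 * (C₁ * K ^ g) * C₃ with hE
  refine ⟨Real.log 2 + E / c, fun t ht => ?_⟩
  have ht0 : (0 : ℝ) < t := by exact_mod_cast ht
  have ht1 : (1 : ℝ) ≤ t := by exact_mod_cast ht
  set T := (t : ℝ) ^ g with hT
  have hT0 : 0 < T := by positivity
  set n := 2 * t ^ g with hn
  have hnT : (n : ℝ) = 2 * T := by rw [hn]; push_cast; rfl
  set r := K * t with hr
  have hr0 : 0 < r := by positivity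
  have hrg : r ^ g = K ^ g * T := mul_pow _ _ _
  set h : R → ℝ := tent b ε t with hh
  have hsupp : ∀ a, h a ≠ 0 → coordNorm b a ≤ r := fun a ha =>
    (coordNorm_le_of_tent_ne_zero hε ht ha).trans (by rw [hr]; gcongr; linarith)
  have hnorm : ∀ a, h a ≠ 0 → T / 2 ≤ Ideal.absNorm (Ideal.span {a}) ∧
      (Ideal.absNorm (Ideal.span {a}) : ℝ) ≤ 3 / 2 * T := fun a ha =>
    hnear t ht a (coordNorm_sub_le_of_tent_ne_zero hε ht ha)
  have hne : ∀ a, h a ≠ 0 → a ≠ 0 := by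
    rintro a ha rfl
    have := (hnorm 0 ha).1
    rw [Ideal.span_singleton_zero, Ideal.absNorm_bot] at this
    push_cast at this
    linarith
  set S := latticeSum b ⊤ r h with hS
  have hSc : c * T ≤ S := by
    rw [hS, latticeSum_top]
    exact le_sum_tent hε ht (by rw [hr]; gcongr; linarith)
  have hS0 : 0 < S := lt_of_lt_of_le (by positivity) hSc
  -- the logarithms of the norms
  have e1 : |∑ a ∈ coordBall b r, h a * Real.log (Ideal.absNorm (Ideal.span {a})) -
      S * (g * Real.log t)| ≤ S * Real.log 2 := by
    rw [hS, latticeSum_top, Finset.sum_mul, Finset.sum_mul, ← Finset.sum_sub_distrib]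
    refine (Finset.abs_sum_le_sum_abs _ _).trans (Finset.sum_le_sum fun a _ => ?_)
    rw [← mul_sub, abs_mul, abs_of_nonneg (tent_nonneg a)]
    by_cases ha : h a = 0
    · change h a * _ ≤ h a * _
      rw [ha, zero_mul, zero_mul]
    refine mul_le_mul_of_nonneg_left ?_ (tent_nonneg a)
    obtain ⟨h1, h2⟩ := hnorm a ha
    have hlogT : Real.log T = g * Real.log t := Real.log_pow _ _
    rw [← hlogT, abs_le]
    have h3 := Real.log_le_log (by positivity) h1
    have h4 := Real.log_le_log (by linarith) (h2.trans (by linarith : 3 / 2 * T ≤ 2 * T))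
    rw [Real.log_div hT0.ne' (by norm_num)] at h3
    rw [Real.log_mul (by norm_num) hT0.ne'] at h4
    constructor <;> linarith
  rw [sum_mul_log_absNorm_eq b (n := n) fun a ha => ⟨hne a ha, by
    have := (hnorm a ha).2
    have h2 : (Ideal.absNorm (Ideal.span {a}) : ℝ) ≤ n := by rw [hnT]; linarith
    exact_mod_cast h2⟩] at e1
  have hn1 : 1 ≤ n := by rw [hn]; have := Nat.one_le_pow g t ht; omega
  have hside : ∀ I : Ideal R, I ≠ ⊥ → Ideal.absNorm I ≤ n → idealSide ι I ≤ r := by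
    intro I hI hIn
    have h1 : idealSide ι I ^ g ≤ (2 * t) ^ g := by
      rw [idealSide_pow, mul_pow]
      have h2 : (Ideal.absNorm I : ℝ) ≤ n := by exact_mod_cast hIn
      refine h2.trans ?_
      rw [hnT]
      exact mul_le_mul_of_nonneg_right (le_self_pow₀ (by norm_num) hg0.ne') hT0.le
    have h2 := le_of_pow_le_pow_left₀ hg0.ne' (by positivity) h1
    exact h2.trans (by rw [hr]; gcongr; linarith)
  have hlog0 : ∀ P : Ideal R, 0 ≤ Real.log (Ideal.absNorm P) := fun P => Real.log_natCast_nonneg _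
  -- the prime ideals
  have e2 : ∀ P ∈ primeIdeals R n, |Real.log (Ideal.absNorm P) * latticeSum b (P ^ 1) r h -
      S * (Real.log (Ideal.absNorm P) / (Ideal.absNorm P : ℝ))| ≤
      C₁ * K ^ g / ε * (T / t) *
        (Real.log (Ideal.absNorm P) * (Ideal.absNorm P : ℝ) ^ (1 / (g : ℝ) - 1)) := by
    intro P hP
    rw [mem_primeIdeals] at hP
    have h1 := (hlat P hP.2.1 r (hside P hP.2.1 hP.2.2)).2 h (1 / (ε * t)) (by positivity) hsupp
      (abs_tent_sub_le hε)
    have hNP : (0 : ℝ) < Ideal.absNorm P := by exact_mod_cast one_le_absNorm hP.2.1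
    have hl := hlog0 P
    have hsd : idealSide ι P = (Ideal.absNorm P : ℝ) * (Ideal.absNorm P : ℝ) ^ (1 / (g : ℝ) - 1) := by
      rw [Real.rpow_sub_one hNP.ne', idealSide]; field_simp; rfl
    rw [pow_one, show Real.log (Ideal.absNorm P) * latticeSum b P r h -
      S * (Real.log (Ideal.absNorm P) / (Ideal.absNorm P : ℝ)) =
      -(Real.log (Ideal.absNorm P) / (Ideal.absNorm P : ℝ) *
        (S - Ideal.absNorm P * latticeSum b P r h)) by field_simp; ring, abs_neg, abs_mul,
      abs_of_nonneg (by positivity)]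
    refine (mul_le_mul_of_nonneg_left h1 (by positivity)).trans (le_of_eq ?_)
    rw [hrg, hsd]
    field_simp
  have e3 : ∀ P ∈ primeIdeals R n, |Real.log (Ideal.absNorm P) *
      ∑ k ∈ Finset.Icc 2 n, latticeSum b (P ^ k) r h| ≤
      2 * (C₁ * K ^ g) * T * (4 * (residueChar P : ℝ) ^ (-(3 / 2) : ℝ)) := by
    intro P hP
    rw [mem_primeIdeals] at hP
    have h2 : 2 ≤ Ideal.absNorm P :=
      (residueChar_spec hP.1 hP.2.1).1.two_le.trans (residueChar_le_absNorm hP.1 hP.2.1)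
    have h2' : (2 : ℝ) ≤ Ideal.absNorm P := by exact_mod_cast h2
    have hterm : ∀ k, 0 ≤ latticeSum b (P ^ k) r h ∧
        latticeSum b (P ^ k) r h ≤ C₁ * K ^ g * T * ((Ideal.absNorm P : ℝ) ^ k)⁻¹ := by
      intro k
      refine ⟨Finset.sum_nonneg fun a _ => tent_nonneg a, ?_⟩
      have hPk : P ^ k ≠ ⊥ := pow_ne_zero k hP.2.1
      by_cases hk : Ideal.absNorm (P ^ k) ≤ n
      · have h3 := (hlat _ hPk r (hside _ hPk hk)).1
        rw [map_pow, Nat.cast_pow, hrg, ← mul_assoc] at h3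
        rw [← div_eq_mul_inv, le_div_iff₀ (by positivity)]
        refine le_trans ?_ h3
        rw [mul_comm]
        refine mul_le_mul_of_nonneg_left ?_ (by positivity)
        rw [latticeSum, ← mul_one (((coordBall b r).filter (· ∈ P ^ k)).card : ℝ), ← nsmul_eq_mul]
        exact Finset.sum_le_card_nsmul _ _ _ fun a _ => tent_le_one hε a
      · rw [latticeSum, Finset.sum_eq_zero]
        · positivity
        intro a ha
        by_contra hane
        have hd := map_dvd Ideal.absNorm
          ((Ideal.dvd_span_singleton).2 (Finset.mem_filter.1 ha).2)
        have h4 := Nat.le_of_dvd (one_le_absNorm (by simpa using hne a hane)) hd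
        have h5 := (hnorm a hane).2
        have h6 : (n : ℝ) < Ideal.absNorm (P ^ k) := by exact_mod_cast not_le.1 hk
        have h7 : (Ideal.absNorm (P ^ k) : ℝ) ≤ Ideal.absNorm (Ideal.span {a}) := by
          exact_mod_cast h4
        linarith
    have hl := hlog0 P
    rw [abs_of_nonneg (mul_nonneg hl (Finset.sum_nonneg fun k _ => (hterm k).1))]
    calc _ ≤ Real.log (Ideal.absNorm P) *
          ∑ k ∈ Finset.Icc 2 n, C₁ * K ^ g * T * ((Ideal.absNorm P : ℝ) ^ k)⁻¹ :=
          mul_le_mul_of_nonneg_left (Finset.sum_le_sum fun k _ => (hterm k).2) hl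
      _ ≤ Real.log (Ideal.absNorm P) * (C₁ * K ^ g * T * (2 / (Ideal.absNorm P : ℝ) ^ 2)) := by
          rw [← Finset.mul_sum]
          refine mul_le_mul_of_nonneg_left ?_ hl
          exact mul_le_mul_of_nonneg_left (sum_Icc_two_inv_pow_le h2' n) (by positivity)
      _ = 2 * (C₁ * K ^ g) * T * (Real.log (Ideal.absNorm P) / (Ideal.absNorm P : ℝ) ^ 2) := by ring
      _ ≤ _ := mul_le_mul_of_nonneg_left (log_div_sq_absNorm_le hP.1 hP.2.1) (by positivity)
  set M := ∑ P ∈ primeIdeals R n, Real.log (Ideal.absNorm P) / (Ideal.absNorm P : ℝ) with hM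
  have e4 : |∑ P ∈ primeIdeals R n, Real.log (Ideal.absNorm P) *
      ∑ k ∈ Finset.Icc 1 n, latticeSum b (P ^ k) r h - S * M| ≤ E * T := by
    have hIcc : Finset.Icc 1 n = insert 1 (Finset.Icc 2 n) := by
      ext k; simp only [Finset.mem_Icc, Finset.mem_insert]; omega
    rw [hM, Finset.mul_sum, ← Finset.sum_sub_distrib]
    refine (Finset.abs_sum_le_sum_abs _ _).trans ?_
    calc _ ≤ ∑ P ∈ primeIdeals R n, (C₁ * K ^ g / ε * (T / t) *
          (Real.log (Ideal.absNorm P) * (Ideal.absNorm P : ℝ) ^ (1 / (g : ℝ) - 1)) +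
          2 * (C₁ * K ^ g) * T * (4 * (residueChar P : ℝ) ^ (-(3 / 2) : ℝ))) := by
          refine Finset.sum_le_sum fun P hP => ?_
          rw [hIcc, Finset.sum_insert (by simp), mul_add, add_sub_right_comm]
          exact (abs_add_le _ _).trans (add_le_add (e2 P hP) (e3 P hP))
      _ ≤ C₁ * K ^ g / ε * (T / t) * (C₂ * (n : ℝ) ^ (1 / (g : ℝ))) +
          2 * (C₁ * K ^ g) * T * C₃ := by
          rw [Finset.sum_add_distrib, ← Finset.mul_sum, ← Finset.mul_sum]
          exact add_le_add (mul_le_mul_of_nonneg_left (hrp n) (by positivity))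
            (mul_le_mul_of_nonneg_left (hsq n) (by positivity))
      _ ≤ C₁ * K ^ g / ε * (T / t) * (C₂ * (2 * t)) + 2 * (C₁ * K ^ g) * T * C₃ := by
          gcongr
          have h1 : (n : ℝ) ≤ (2 * t) ^ g := by
            rw [hnT, mul_pow]
            exact mul_le_mul_of_nonneg_right (le_self_pow₀ (by norm_num) hg0.ne') hT0.le
          have h2 := Real.rpow_le_rpow (by positivity) h1 (by positivity : 0 ≤ 1 / (g : ℝ))
          rwa [one_div, Real.pow_rpow_inv_natCast (by positivity) hg0.ne', ← one_div] at h2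
      _ = E * T := by rw [hE]; field_simp
  have e5 : |S * M - S * (g * Real.log t)| ≤ S * (Real.log 2 + E / c) := by
    have h1 : E * T ≤ S * (E / c) := by
      have hE0 : 0 ≤ E := by positivity
      calc E * T = (c * T) * (E / c) := by field_simp
        _ ≤ _ := mul_le_mul_of_nonneg_right hSc (by positivity)
    rw [abs_le] at e1 e4 ⊢
    constructor <;> linarith [e1.1, e1.2, e4.1, e4.2]
  rw [← mul_sub, abs_mul, abs_of_pos hS0] at e5
  exact le_of_mul_le_mul_left e5 hS0

section

variable {R : Type*} [CommRing R] [IsDedekindDomain R] [Module.Free ℤ R] [Module.Finite ℤ R]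
  [CharZero R]

theorem primeIdeals_mono {m n : ℕ} (h : m ≤ n) : primeIdeals R m ⊆ primeIdeals R n := by
  intro P hP
  rw [mem_primeIdeals] at hP ⊢
  exact ⟨hP.1, hP.2.1, hP.2.2.trans h⟩

theorem exists_mertens_primeIdeals {ι : Type*} [Fintype ι] [Nonempty ι]
    (b : Module.Basis ι ℤ R) : ∃ C : ℝ, ∀ n : ℕ, 1 ≤ n →
    |∑ P ∈ primeIdeals R n, Real.log (Ideal.absNorm P) / (Ideal.absNorm P : ℝ) - Real.log n| ≤ C := by
  obtain ⟨C, hC⟩ := exists_mertens_primeIdeals_pow b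
  set g := Fintype.card ι with hg
  have hg0 : 0 < g := Fintype.card_pos
  have hC0 : 0 ≤ C := (abs_nonneg _).trans (hC 1 le_rfl)
  have hl2 : 0 < Real.log 2 := Real.log_pos (by norm_num)
  refine ⟨C + (g + 1) * Real.log 2, fun n hn => ?_⟩
  have hmono : ∀ m n : ℕ, m ≤ n →
      ∑ P ∈ primeIdeals R m, Real.log (Ideal.absNorm P) / (Ideal.absNorm P : ℝ) ≤
      ∑ P ∈ primeIdeals R n, Real.log (Ideal.absNorm P) / (Ideal.absNorm P : ℝ) := fun m n h =>
    Finset.sum_le_sum_of_subset_of_nonneg (primeIdeals_mono h) fun P _ _ =>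
      div_nonneg (Real.log_natCast_nonneg _) (by positivity)
  by_cases hn2 : n < 2
  · obtain rfl : n = 1 := by omega
    have : primeIdeals R 1 = ∅ := by
      rw [Finset.eq_empty_iff_forall_notMem]
      intro P hP
      rw [mem_primeIdeals] at hP
      have := (residueChar_spec hP.1 hP.2.1).1.two_le.trans (residueChar_le_absNorm hP.1 hP.2.1)
      omega
    rw [this]
    simp only [Finset.sum_empty, Nat.cast_one, Real.log_one, sub_zero, abs_zero]
    positivity
  push Not at hn2
  -- the largest `t` with `2 * t ^ g ≤ n`
  let t := Nat.findGreatest (fun t => 2 * t ^ g ≤ n) n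
  have ht1 : 1 ≤ t := Nat.le_findGreatest hn (by simpa using hn2)
  have ht : 2 * t ^ g ≤ n := Nat.findGreatest_spec (P := fun t => 2 * t ^ g ≤ n) hn (by simpa using hn2)
  have ht' : n < 2 * (t + 1) ^ g := by
    by_contra hlt
    push Not at hlt
    have h1 : t + 1 ≤ n := by
      have : t + 1 ≤ (t + 1) ^ g := Nat.le_self_pow hg0.ne' _
      omega
    have : t + 1 ≤ t := Nat.le_findGreatest h1 hlt
    omega
  have ht0 : (0 : ℝ) < t := by exact_mod_cast ht1
  have h1 := abs_le.1 (hC t ht1)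
  have h2 := abs_le.1 (hC (t + 1) (by omega))
  have h3 := hmono _ _ ht
  have h4 := hmono _ _ ht'.le
  have h5 : Real.log 2 + g * Real.log t ≤ Real.log n := by
    rw [← Real.log_pow, ← Real.log_mul (by norm_num) (by positivity)]
    exact Real.log_le_log (by positivity) (by exact_mod_cast ht)
  have h6 : Real.log n ≤ Real.log 2 + g * Real.log ((t + 1 : ℕ) : ℝ) := by
    rw [← Real.log_pow, ← Real.log_mul (by norm_num) (by positivity)]
    refine Real.log_le_log (by exact_mod_cast hn) (by exact_mod_cast ht'.le)
  have h7 : Real.log ((t + 1 : ℕ) : ℝ) ≤ Real.log 2 + Real.log t := by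
    rw [← Real.log_mul (by norm_num) (by positivity)]
    refine Real.log_le_log (by positivity) ?_
    push_cast
    have : (1 : ℝ) ≤ t := by exact_mod_cast ht1
    linarith
  have h8 : (g : ℝ) * Real.log ((t + 1 : ℕ) : ℝ) ≤ g * (Real.log 2 + Real.log t) :=
    mul_le_mul_of_nonneg_left h7 (by positivity)
  rw [abs_le]
  constructor <;> nlinarith [h1.1, h2.2]

/-- Number of prime ideals of norm `p`. -/
noncomputable def degreeOneCount (R : Type*) [CommRing R] [IsDedekindDomain R] [Module.Free ℤ R]
    [Module.Finite ℤ R] [CharZero R] (p : ℕ) : ℕ :=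
  ((primeIdeals R p).filter fun P => Ideal.absNorm P = p).card

theorem exists_mertens_degreeOne {ι : Type*} [Fintype ι] [Nonempty ι]
    (b : Module.Basis ι ℤ R) : ∃ C : ℝ, ∀ n : ℕ, 1 ≤ n →
    |∑ p ∈ (Finset.range (n + 1)).filter Nat.Prime, (degreeOneCount R p : ℝ) * (Real.log p / p) -
      Real.log n| ≤ C := by
  obtain ⟨C₁, h1⟩ := exists_mertens_primeIdeals b
  obtain ⟨C₂, hC₂, h2⟩ := exists_sum_residueChar_rpow_le R
  refine ⟨C₁ + C₂, fun n hn => ?_⟩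
  have e : ∑ p ∈ (Finset.range (n + 1)).filter Nat.Prime,
      (degreeOneCount R p : ℝ) * (Real.log p / p) =
      ∑ P ∈ (primeIdeals R n).filter (fun P => (Ideal.absNorm P).Prime),
        Real.log (Ideal.absNorm P) / (Ideal.absNorm P : ℝ) := by
    have hmaps : ∀ P ∈ (primeIdeals R n).filter (fun P => (Ideal.absNorm P).Prime),
        Ideal.absNorm P ∈ (Finset.range (n + 1)).filter Nat.Prime := by
      intro P hP
      rw [Finset.mem_filter, mem_primeIdeals] at hP
      exact Finset.mem_filter.2 ⟨Finset.mem_range.2 (by omega), hP.2⟩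
    rw [← Finset.sum_fiberwise_of_maps_to hmaps]
    refine Finset.sum_congr rfl fun p hp => ?_
    rw [Finset.mem_filter, Finset.mem_range] at hp
    rw [Finset.sum_congr rfl (fun P hP => by rw [(Finset.mem_filter.1 hP).2] :
      ∀ P ∈ ((primeIdeals R n).filter (fun P => (Ideal.absNorm P).Prime)).filter
        (Ideal.absNorm · = p), Real.log (Ideal.absNorm P) / (Ideal.absNorm P : ℝ) =
          Real.log p / p), Finset.sum_const, nsmul_eq_mul, degreeOneCount]
    congr 3
    ext P
    simp only [Finset.mem_filter, mem_primeIdeals]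
    constructor
    · rintro ⟨⟨a, b, c⟩, rfl⟩; exact ⟨⟨⟨a, b, by omega⟩, hp.2⟩, rfl⟩
    · rintro ⟨⟨⟨a, b, c⟩, d⟩, rfl⟩; exact ⟨⟨a, b, le_rfl⟩, rfl⟩
  have hnn : ∀ P : Ideal R, 0 ≤ Real.log (Ideal.absNorm P) / (Ideal.absNorm P : ℝ) := fun P =>
    div_nonneg (Real.log_natCast_nonneg _) (by positivity)
  have h3 : ∑ P ∈ (primeIdeals R n).filter (fun P => ¬ (Ideal.absNorm P).Prime),
        Real.log (Ideal.absNorm P) / (Ideal.absNorm P : ℝ) ≤ C₂ := by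
    refine le_trans ?_ (h2 n)
    refine (Finset.sum_le_sum (g := fun P => 4 * (residueChar P : ℝ) ^ (-(3 / 2) : ℝ))
      fun P hP => ?_).trans
      (Finset.sum_le_sum_of_subset_of_nonneg (Finset.filter_subset _ _) fun _ _ _ => by positivity)
    rw [Finset.mem_filter, mem_primeIdeals] at hP
    refine log_div_absNorm_le hP.1.1 hP.1.2.1 fun he => hP.2 ?_
    rw [he]
    exact (residueChar_spec hP.1.1 hP.1.2.1).1
  have h4 := Finset.sum_filter_add_sum_filter_not (primeIdeals R n)
    (fun P => (Ideal.absNorm P).Prime)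
    (fun P => Real.log (Ideal.absNorm P) / (Ideal.absNorm P : ℝ))
  have h5 : 0 ≤ ∑ P ∈ (primeIdeals R n).filter (fun P => ¬ (Ideal.absNorm P).Prime),
        Real.log (Ideal.absNorm P) / (Ideal.absNorm P : ℝ) := Finset.sum_nonneg fun P _ => hnn P
  have h6 := abs_le.1 (h1 n hn)
  rw [e, abs_le]
  constructor <;> linarith [h6.1, h6.2]

end

section

open Polynomial NumberField RingOfIntegers UniqueFactorizationMonoid

theorem exponent_ne_zero_of_adjoin {K : Type*} [Field K] [NumberField K] (θ : 𝓞 K)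
    (h : ∀ x : K, ∃ P : ℚ[X], aeval (θ : K) P = x) : exponent θ ≠ 0 := by
  have key : ∀ x : 𝓞 K, ∃ d : ℕ, 0 < d ∧ (d : 𝓞 K) * x ∈ Algebra.adjoin ℤ {θ} := by
    intro x
    obtain ⟨P, hP⟩ := h x
    obtain ⟨b, hb, hbP⟩ := IsLocalization.integerNormalization_spec (nonZeroDivisors ℤ) P
    have hb0 : b ≠ 0 := nonZeroDivisors.ne_zero hb
    set Q := IsLocalization.integerNormalization (nonZeroDivisors ℤ) P
    have h1 : (b : 𝓞 K) * x = aeval θ Q := by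
      apply RingOfIntegers.coe_injective
      rw [← Polynomial.aeval_algebraMap_apply K θ Q, ← Polynomial.aeval_map_algebraMap ℚ (θ : K) Q, hbP, map_zsmul, hP]
      simp
    refine ⟨b.natAbs, Int.natAbs_pos.2 hb0, ?_⟩
    have h3 : (b : 𝓞 K) * x ∈ Algebra.adjoin ℤ {θ} := by
      rw [h1]
      exact Polynomial.aeval_mem_adjoin_singleton ℤ θ
    have h4 : ((b.natAbs : ℕ) : 𝓞 K) = ((b.sign : ℤ) : 𝓞 K) * (b : 𝓞 K) := by
      rw [← Int.cast_mul, Int.sign_mul_self, Int.cast_natCast]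
    rw [h4, mul_assoc, ← zsmul_eq_mul]
    exact Subalgebra.smul_mem _ h3 b.sign
  choose d hd0 hd using key
  let B := RingOfIntegers.basis K
  let D := ∏ i, d (B i)
  have hD : 0 < D := Finset.prod_pos fun i _ => hd0 _
  have hmem : (D : 𝓞 K) ∈ conductor ℤ θ := by
    intro x
    rw [← B.sum_repr x, Finset.mul_sum]
    refine Subalgebra.sum_mem _ fun i _ => ?_
    obtain ⟨e, he⟩ : d (B i) ∣ D := Finset.dvd_prod_of_mem _ (Finset.mem_univ i)
    have : (D : 𝓞 K) * (B.repr x i • B i) = ((e : ℤ) * B.repr x i) • ((d (B i) : 𝓞 K) * B i) := by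
      rw [he, zsmul_eq_mul, zsmul_eq_mul]
      push_cast
      ring
    rw [this]
    exact Subalgebra.smul_mem _ (hd _) _
  rw [exponent_eq_sInf]
  exact (Nat.sInf_mem (s := {d : ℕ | 0 < d ∧ (d : 𝓞 K) ∈ conductor ℤ θ}) ⟨D, hD, hmem⟩).1.ne'

theorem degreeOneCount_eq_card_roots {K : Type*} [Field K] [NumberField K] (θ : 𝓞 K) (p : ℕ)
    [hp : Fact p.Prime] (hpe : ¬ p ∣ exponent θ) :
    degreeOneCount (𝓞 K) p = (Finset.univ.filter fun r : ZMod p =>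
      ((minpoly ℤ θ).map (Int.castRingHom (ZMod p))).IsRoot r).card := by
  have hm : ((minpoly ℤ θ).map (Int.castRingHom (ZMod p))) ≠ 0 :=
    ((minpoly.monic θ.isIntegral).map _).ne_zero
  have hmem : ∀ r : ZMod p, ((minpoly ℤ θ).map (Int.castRingHom (ZMod p))).IsRoot r →
      X - C r ∈ monicFactorsMod θ p := by
    intro r hr
    rw [Multiset.mem_toFinset, Polynomial.mem_normalizedFactors_iff hm]
    exact ⟨irreducible_X_sub_C r, monic_X_sub_C r, dvd_iff_isRoot.2 hr⟩
  symm
  have hnorm : ∀ P : Ideal (𝓞 K), P.IsPrime → P.LiesOver (Ideal.span {(p : ℤ)}) →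
      Ideal.absNorm P = p ^ P.inertiaDeg ℤ := by
    intro P h1 h2
    rw [← Ideal.absNorm_pow_inertiaDeg (Ideal.span {(p : ℤ)}) P, Ideal.absNorm_span_singleton]
    simp
  have hlies : ∀ P ∈ (primeIdeals (𝓞 K) p).filter fun P => Ideal.absNorm P = p,
      P ∈ Ideal.primesOver (Ideal.span {(p : ℤ)}) (𝓞 K) := by
    intro P hP
    rw [Finset.mem_filter, mem_primeIdeals] at hP
    obtain ⟨⟨h1, h0, -⟩, h2⟩ := hP
    refine ⟨h1, ⟨?_⟩⟩
    have hmax : (Ideal.span {(p : ℤ)}).IsMaximal := Int.ideal_span_isMaximal_of_prime p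
    refine hmax.eq_of_le (Ideal.IsPrime.under ℤ P).ne_top ?_
    rw [Ideal.span_singleton_le_iff_mem, Ideal.mem_under]
    have := Ideal.absNorm_mem P
    rw [h2] at this
    simpa using this
  refine Finset.card_bij (fun r hr => (((NumberField.Ideal.primesOverSpanEquivMonicFactorsMod
    hpe).symm ⟨X - C r, hmem r (Finset.mem_filter.1 hr).2⟩ : _) : Ideal (𝓞 K))) ?_ ?_ ?_
  · intro r hr
    set e := (NumberField.Ideal.primesOverSpanEquivMonicFactorsMod hpe).symm
      ⟨X - C r, hmem r (Finset.mem_filter.1 hr).2⟩ with he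
    have hdeg := NumberField.Ideal.inertiaDeg_primesOverSpanEquivMonicFactorsMod_symm_apply' hpe
      (hmem r (Finset.mem_filter.1 hr).2)
    rw [← he, natDegree_X_sub_C] at hdeg
    have h1 := hnorm e.1 e.2.1 e.2.2
    rw [hdeg, pow_one] at h1
    rw [Finset.mem_filter, mem_primeIdeals]
    refine ⟨⟨e.2.1, ?_, h1.le⟩, h1⟩
    intro h0
    rw [h0, Ideal.absNorm_bot] at h1
    exact hp.out.ne_zero h1.symm
  · intro r hr s hs h
    have := congrArg Subtype.val ((Equiv.injective _) (Subtype.ext h))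
    simpa using this
  · intro P hP
    have h1 := hlies P hP
    set Q := NumberField.Ideal.primesOverSpanEquivMonicFactorsMod hpe ⟨P, h1⟩ with hQ
    have hPQ : (NumberField.Ideal.primesOverSpanEquivMonicFactorsMod hpe).symm Q = ⟨P, h1⟩ := by
      rw [hQ, Equiv.symm_apply_apply]
    have hdeg := NumberField.Ideal.inertiaDeg_primesOverSpanEquivMonicFactorsMod_symm_apply' hpe Q.2
    have h2 := hnorm P h1.1 h1.2
    rw [(Finset.mem_filter.1 hP).2] at h2
    have h3 : P.inertiaDeg ℤ = 1 := by
      have : p ^ 1 = p ^ P.inertiaDeg ℤ := by rw [pow_one]; exact h2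
      exact (Nat.pow_right_injective hp.out.two_le this).symm
    have h4 : natDegree Q.1 = 1 := by
      rw [← hdeg, Subtype.coe_eta, hPQ]
      exact h3
    have h5 := (Polynomial.mem_normalizedFactors_iff hm).1 (Multiset.mem_toFinset.1 Q.2)
    have h6 : Q.1 = X - C (-(Q.1.coeff 0)) := by
      conv_lhs => rw [Polynomial.eq_X_add_C_of_natDegree_le_one h4.le]
      have : Q.1.coeff 1 = 1 := by
        have := h5.2.1.coeff_natDegree
        rwa [h4] at this
      rw [this]
      simp
    have h7 : ((minpoly ℤ θ).map (Int.castRingHom (ZMod p))).IsRoot (-(Q.1.coeff 0)) := by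
      rw [← dvd_iff_isRoot, ← h6]
      exact h5.2.2
    refine ⟨-(Q.1.coeff 0), Finset.mem_filter.2 ⟨Finset.mem_univ _, h7⟩, ?_⟩
    have h8 : (⟨X - C (-(Q.1.coeff 0)), hmem _ h7⟩ : monicFactorsMod θ p) = Q :=
      Subtype.ext h6.symm
    rw [h8, hPQ]

end

section

open Polynomial NumberField RingOfIntegers

theorem exists_ringOfIntegers_minpoly (F : ℤ[X]) (hF : Irreducible F) (hdeg : 1 ≤ F.natDegree) :
    ∃ (K : Type) (_ : Field K) (_ : NumberField K) (θ : 𝓞 K),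
      minpoly ℤ θ = F.integralNormalization ∧ exponent θ ≠ 0 := by
  have hprim : F.IsPrimitive := hF.isPrimitive (by omega)
  set f := F.map (Int.castRingHom ℚ) with hf
  have hirr : Irreducible f := (IsPrimitive.Int.irreducible_iff_irreducible_map_cast hprim).1 hF
  have : Fact (Irreducible f) := ⟨hirr⟩
  have hF0 : F ≠ 0 := hF.ne_zero
  set a := F.leadingCoeff with ha
  have ha0 : a ≠ 0 := leadingCoeff_ne_zero.2 hF0
  let K := AdjoinRoot f
  let α : K := AdjoinRoot.root f
  have hα : aeval α F = 0 := by
    rw [← Polynomial.aeval_map_algebraMap ℚ α F]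
    exact (AdjoinRoot.aeval_eq f).trans AdjoinRoot.mk_self
  have hG : aeval (algebraMap ℤ K a * α) F.integralNormalization = 0 :=
    integralNormalization_aeval_eq_zero hα fun x hx => by simpa using hx
  have hmon : F.integralNormalization.Monic := monic_integralNormalization hF0
  let θ : 𝓞 K := ⟨algebraMap ℤ K a * α, F.integralNormalization, hmon, hG⟩
  have hGθ : aeval θ F.integralNormalization = 0 := by
    apply RingOfIntegers.coe_injective
    rw [← Polynomial.aeval_algebraMap_apply K θ, map_zero]
    exact hG
  have haK : (algebraMap ℚ K) a ≠ 0 := by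
    rw [Ne, map_eq_zero]
    exact_mod_cast ha0
  refine ⟨K, inferInstance, inferInstance, θ, ?_, ?_⟩
  · refine (eq_of_monic_of_dvd_of_natDegree_le (minpoly.monic θ.isIntegral) hmon
      (minpoly.isIntegrallyClosed_dvd θ.isIntegral hGθ) ?_).symm
    rw [natDegree_integralNormalization]
    have h1 : aeval α (((minpoly ℤ θ).map (Int.castRingHom ℚ)).comp (C (a : ℚ) * X)) = 0 := by
      rw [aeval_comp]
      have : aeval α (C (a : ℚ) * X) = algebraMap ℤ K a * α := by simp
      rw [this]
      have h2 := minpoly.aeval ℤ θ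
      apply_fun (algebraMap (𝓞 K) K) at h2
      rw [← Polynomial.aeval_algebraMap_apply K θ, map_zero] at h2
      have := Polynomial.aeval_map_algebraMap ℚ (algebraMap ℤ K a * α) (minpoly ℤ θ)
      rw [show (algebraMap ℤ ℚ) = Int.castRingHom ℚ from rfl] at this
      rw [this]
      exact h2
    have h3 : f ∣ ((minpoly ℤ θ).map (Int.castRingHom ℚ)).comp (C (a : ℚ) * X) := by
      exact AdjoinRoot.mk_eq_zero.1 ((AdjoinRoot.aeval_eq _).symm.trans h1)
    have h4 : ((minpoly ℤ θ).map (Int.castRingHom ℚ)).comp (C (a : ℚ) * X) ≠ 0 := by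
      intro h0
      have := congrArg (fun P => P.comp (C (a : ℚ)⁻¹ * X)) h0
      simp only [comp_assoc, zero_comp, mul_comp, C_comp, X_comp] at this
      rw [← mul_assoc, ← C_mul, mul_inv_cancel₀ (by exact_mod_cast ha0), C_1, one_mul, comp_X] at this
      exact ((minpoly.monic θ.isIntegral).map _).ne_zero this
    have h5 := natDegree_le_of_dvd h3 h4
    rw [natDegree_comp, natDegree_C_mul_X _ (by exact_mod_cast ha0), mul_one,
      natDegree_map_eq_of_injective (RingHom.injective_int _)] at h5
    rwa [natDegree_map_eq_of_injective (RingHom.injective_int _)] at h5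
  · apply exponent_ne_zero_of_adjoin
    intro x
    obtain ⟨Q, rfl⟩ := AdjoinRoot.mk_surjective x
    refine ⟨Q.comp (C (a : ℚ)⁻¹ * X), ?_⟩
    rw [aeval_comp, ← AdjoinRoot.aeval_eq]
    congr 2
    have : ((θ : 𝓞 K) : K) = algebraMap ℤ K a * α := rfl
    rw [map_mul, aeval_X, aeval_C, this, map_inv₀, ← mul_assoc]
    have h1 : algebraMap ℤ K a = algebraMap ℚ K a := by simp
    rw [h1, inv_mul_cancel₀ haK, one_mul]

theorem polyRho_eq_card_filter (F : ℤ[X]) (d : ℕ) : polyRho F d =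
    ((Finset.range d).filter fun n : ℕ => (d : ℤ) ∣ F.eval (n : ℤ)).card := by
  symm
  rw [polyRho]
  refine Finset.card_bij (fun n _ => (n : ℤ)) ?_ ?_ ?_
  · intro n hn
    rw [Finset.mem_filter] at hn ⊢
    refine ⟨?_, hn.2⟩
    simpa using hn.1
  · intro m _ n _ h
    exact_mod_cast h
  · intro m hm
    rw [Finset.mem_filter] at hm
    obtain ⟨h1, h2⟩ := hm
    simp only [Finset.bind_def, Finset.pure_def, Finset.mem_sup, Finset.mem_singleton] at h1
    obtain ⟨n, hn, rfl⟩ := h1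
    exact ⟨n, Finset.mem_filter.2 ⟨hn, h2⟩, rfl⟩

theorem polyRho_eq_card_isRoot (F : ℤ[X]) (p : ℕ) [NeZero p] :
    polyRho F p = (Finset.univ.filter fun r : ZMod p =>
      (F.map (Int.castRingHom (ZMod p))).IsRoot r).card := by
  have key : ∀ n : ℕ, (p : ℤ) ∣ F.eval (n : ℤ) ↔
      (F.map (Int.castRingHom (ZMod p))).IsRoot (n : ZMod p) := by
    intro n
    rw [IsRoot.def, eval_map, ← ZMod.intCast_zmod_eq_zero_iff_dvd]
    have : ((F.eval (n : ℤ) : ℤ) : ZMod p) = eval₂ (Int.castRingHom (ZMod p)) (n : ZMod p) F := by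
      simp
    rw [this]
  rw [polyRho_eq_card_filter]
  refine Finset.card_bij (fun n _ => (n : ZMod p)) ?_ ?_ ?_
  · intro n hn
    exact Finset.mem_filter.2 ⟨Finset.mem_univ _, (key n).1 (Finset.mem_filter.1 hn).2⟩
  · intro m hm n hn h
    have hm := Finset.mem_range.1 (Finset.mem_filter.1 hm).1
    have hn := Finset.mem_range.1 (Finset.mem_filter.1 hn).1
    rw [ZMod.natCast_eq_natCast_iff', Nat.mod_eq_of_lt hm, Nat.mod_eq_of_lt hn] at h
    exact h
  · intro r hr
    refine ⟨r.val, Finset.mem_filter.2 ⟨Finset.mem_range.2 (ZMod.val_lt r), ?_⟩, by simp⟩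
    rw [key, ZMod.natCast_zmod_val]
    exact (Finset.mem_filter.1 hr).2

theorem polyRho_eq_card_isRoot_integralNormalization (F : ℤ[X]) (hdeg : 1 ≤ F.natDegree) (p : ℕ)
    [hp : Fact p.Prime] (hpa : ¬ (p : ℤ) ∣ F.leadingCoeff) :
    polyRho F p = (Finset.univ.filter fun r : ZMod p =>
      (F.integralNormalization.map (Int.castRingHom (ZMod p))).IsRoot r).card := by
  have ha : Int.castRingHom (ZMod p) F.leadingCoeff ≠ 0 := by
    rw [eq_intCast, Ne, ZMod.intCast_zmod_eq_zero_iff_dvd]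
    exact hpa
  rw [polyRho_eq_card_isRoot]
  have key : ∀ r : ZMod p, (F.integralNormalization.map (Int.castRingHom (ZMod p))).IsRoot
      (Int.castRingHom (ZMod p) F.leadingCoeff * r) ↔
      (F.map (Int.castRingHom (ZMod p))).IsRoot r := by
    intro r
    rw [IsRoot.def, IsRoot.def, eval_map, eval_map,
      integralNormalization_eval₂_leadingCoeff_mul hdeg, mul_eq_zero]
    simp only [pow_eq_zero_iff', ha, false_and, false_or]
  refine Finset.card_bij (fun r _ => Int.castRingHom (ZMod p) F.leadingCoeff * r) ?_ ?_ ?_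
  · intro r hr
    exact Finset.mem_filter.2 ⟨Finset.mem_univ _, (key r).2 (Finset.mem_filter.1 hr).2⟩
  · intro r _ s _ h
    exact mul_left_cancel₀ ha h
  · intro s hs
    have h1 : s = Int.castRingHom (ZMod p) F.leadingCoeff *
        ((Int.castRingHom (ZMod p) F.leadingCoeff)⁻¹ * s) := by
      rw [← mul_assoc, mul_inv_cancel₀ ha, one_mul]
    refine ⟨(Int.castRingHom (ZMod p) F.leadingCoeff)⁻¹ * s,
      Finset.mem_filter.2 ⟨Finset.mem_univ _, ?_⟩, h1.symm⟩
    rw [← key, ← h1]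
    exact (Finset.mem_filter.1 hs).2

theorem polyRho_le_natDegree (F : ℤ[X]) (p : ℕ) [hp : Fact p.Prime]
    (hF : F.map (Int.castRingHom (ZMod p)) ≠ 0) : polyRho F p ≤ F.natDegree := by
  rw [polyRho_eq_card_isRoot]
  calc _ ≤ (F.map (Int.castRingHom (ZMod p))).roots.toFinset.card := by
        refine Finset.card_le_card fun r hr => ?_
        rw [Multiset.mem_toFinset, mem_roots hF]
        exact (Finset.mem_filter.1 hr).2
    _ ≤ _ := (Multiset.toFinset_card_le _).trans ((card_roots' _).trans natDegree_map_le)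

theorem map_castRingHom_ne_zero_of_isPrimitive {F : ℤ[X]} (hF : F.IsPrimitive) (p : ℕ)
    [hp : Fact p.Prime] : F.map (Int.castRingHom (ZMod p)) ≠ 0 := by
  intro h
  have h1 : C (p : ℤ) ∣ F := by
    rw [C_dvd_iff_dvd_coeff]
    intro i
    rw [← ZMod.intCast_zmod_eq_zero_iff_dvd]
    have := congrArg (fun P => P.coeff i) h
    simpa using this
  have h2 := hF _ h1
  rw [Int.isUnit_iff] at h2
  have := hp.out.two_le
  omega

theorem polyRho_le_self (F : ℤ[X]) (p : ℕ) : polyRho F p ≤ p := by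
  rw [polyRho_eq_card_filter]
  exact (Finset.card_filter_le _ _).trans (by simp)

/-- Mertens' theorem for the roots of an irreducible polynomial. -/
theorem exists_mertens_polyRho (F : ℤ[X]) (hF : Irreducible F) (hdeg : 1 ≤ F.natDegree) :
    ∃ C : ℝ, ∀ n : ℕ, 1 ≤ n →
      |∑ p ∈ (Finset.range (n + 1)).filter Nat.Prime, (polyRho F p : ℝ) * (Real.log p / p) -
        Real.log n| ≤ C := by
  obtain ⟨K, _, _, θ, hθ, he⟩ := exists_ringOfIntegers_minpoly F hF hdeg
  have : Nonempty (Module.Free.ChooseBasisIndex ℤ (𝓞 K)) :=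
    (RingOfIntegers.basis K).index_nonempty
  obtain ⟨C, hC⟩ := exists_mertens_degreeOne (RingOfIntegers.basis K)
  have ha0 : F.leadingCoeff ≠ 0 := leadingCoeff_ne_zero.2 hF.ne_zero
  set N := exponent θ * F.leadingCoeff.natAbs with hN
  have hN0 : N ≠ 0 := mul_ne_zero he (Int.natAbs_ne_zero.2 ha0)
  refine ⟨C + ∑ p ∈ N.primeFactors, |(polyRho F p : ℝ) * (Real.log p / p) -
    (degreeOneCount (𝓞 K) p : ℝ) * (Real.log p / p)|, fun n hn => ?_⟩
  have h1 : |∑ p ∈ (Finset.range (n + 1)).filter Nat.Prime, ((polyRho F p : ℝ) * (Real.log p / p) -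
      (degreeOneCount (𝓞 K) p : ℝ) * (Real.log p / p))| ≤
      ∑ p ∈ N.primeFactors, |(polyRho F p : ℝ) * (Real.log p / p) -
    (degreeOneCount (𝓞 K) p : ℝ) * (Real.log p / p)| := by
    refine (Finset.abs_sum_le_sum_abs _ _).trans ?_
    rw [← Finset.sum_filter_add_sum_filter_not _ (fun p => p ∈ N.primeFactors)]
    rw [Finset.sum_eq_zero (s := Finset.filter (fun p => ¬ p ∈ N.primeFactors) _), add_zero]
    · refine Finset.sum_le_sum_of_subset_of_nonneg ?_ fun _ _ _ => abs_nonneg _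
      intro p hp
      exact (Finset.mem_filter.1 hp).2
    · intro p hp
      obtain ⟨hp, hpN⟩ := Finset.mem_filter.1 hp
      have hpp : p.Prime := (Finset.mem_filter.1 hp).2
      have : Fact p.Prime := ⟨hpp⟩
      have hd : ¬ p ∣ N := fun h => hpN (Nat.mem_primeFactors.2 ⟨hpp, h, hN0⟩)
      have hd1 : ¬ p ∣ exponent θ := fun h => hd (h.mul_right _)
      have hd2 : ¬ (p : ℤ) ∣ F.leadingCoeff := fun h =>
        hd ((Int.natCast_dvd.1 h).mul_left _)
      rw [polyRho_eq_card_isRoot_integralNormalization F hdeg p hd2,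
        degreeOneCount_eq_card_roots θ p hd1, hθ, sub_self, abs_zero]
  rw [Finset.sum_sub_distrib] at h1
  have h2 := hC n hn
  rw [abs_le] at h1 h2 ⊢
  constructor <;> linarith

end

section

/-- A discrete measure whose distribution function stays close to that of Lebesgue measure
integrates `1 / t` almost like Lebesgue measure does. -/
theorem abs_sum_div_sub_log_le {ι : Type*} (T : Finset ι) (t c : ι → ℝ) {a b C : ℝ} (ha : 0 < a)
    (hab : a ≤ b) (ht : ∀ p ∈ T, a < t p ∧ t p ≤ b)
    (hS : ∀ s, a ≤ s → s ≤ b → |∑ p ∈ T.filter (fun p => t p ≤ s), c p - (s - a)| ≤ C) :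
    |∑ p ∈ T, c p / t p - Real.log (b / a)| ≤ C / a := by
  have hb : 0 < b := ha.trans_le hab
  have hcont : ContinuousOn (fun s : ℝ => (s ^ 2)⁻¹) (Set.Icc a b) := fun s hs =>
    ((continuous_pow 2).continuousAt.inv₀ (pow_pos (ha.trans_le hs.1) 2).ne').continuousWithinAt
  have hint : IntegrableOn (fun s : ℝ => (s ^ 2)⁻¹) (Set.Icc a b) := hcont.integrableOn_Icc
  have hev : ∀ u v : ℝ, 0 < u → u ≤ v → ∫ s in u..v, (s ^ 2)⁻¹ = 1 / u - 1 / v := by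
    intro u v hu huv
    have h := intervalIntegral.integral_eq_sub_of_hasDerivAt (a := u) (b := v)
      (f := fun s : ℝ => -s⁻¹) (f' := fun s : ℝ => (s ^ 2)⁻¹) (fun s hs => by
        rw [Set.uIcc_of_le huv] at hs
        exact (hasDerivAt_inv (hu.trans_le hs.1).ne').fun_neg.congr_deriv (neg_neg _))
      (ContinuousOn.intervalIntegrable fun s hs => by
        rw [Set.uIcc_of_le huv] at hs
        exact ((continuous_pow 2).continuousAt.inv₀
          (pow_pos (hu.trans_le hs.1) 2).ne').continuousWithinAt)
    rw [h]
    ring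
  have hind : ∀ p ∈ T, ∫ s in a..b, (s ^ 2)⁻¹ * (if t p ≤ s then c p else 0) =
      c p / t p - c p / b := by
    intro p hp
    obtain ⟨h1, h2⟩ := ht p hp
    have e1 : (fun s : ℝ => (s ^ 2)⁻¹ * (if t p ≤ s then c p else 0)) =
        (Set.Ici (t p)).indicator fun s => c p * (s ^ 2)⁻¹ := by
      ext s
      by_cases hs : t p ≤ s <;> simp [Set.indicator, hs, mul_comm]
    rw [e1, intervalIntegral.integral_of_le hab, ← integral_Icc_eq_integral_Ioc,
      setIntegral_indicator measurableSet_Ici]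
    have e2 : Set.Icc a b ∩ Set.Ici (t p) = Set.Icc (t p) b := by
      ext s
      simp only [Set.mem_inter_iff, Set.mem_Icc, Set.mem_Ici]
      constructor
      · rintro ⟨⟨_, h4⟩, h5⟩
        exact ⟨h5, h4⟩
      · rintro ⟨h4, h5⟩
        exact ⟨⟨h1.le.trans h4, h5⟩, h4⟩
    rw [e2, integral_Icc_eq_integral_Ioc, ← intervalIntegral.integral_of_le h2,
      intervalIntegral.integral_const_mul, hev _ _ (ha.trans h1) h2]
    ring
  have hintp : ∀ p ∈ T, IntervalIntegrable
      (fun s : ℝ => (s ^ 2)⁻¹ * (if t p ≤ s then c p else 0)) volume a b := by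
    intro p hp
    rw [intervalIntegrable_iff_integrableOn_Icc_of_le hab]
    have e1 : (fun s : ℝ => (s ^ 2)⁻¹ * (if t p ≤ s then c p else 0)) =
        (Set.Ici (t p)).indicator fun s => c p * (s ^ 2)⁻¹ := by
      ext s
      by_cases hs : t p ≤ s <;> simp [Set.indicator, hs, mul_comm]
    rw [e1]
    exact (hint.const_mul (c p)).indicator measurableSet_Ici
  have hsum : ∑ p ∈ T, (c p / t p - c p / b) =
      ∫ s in a..b, (s ^ 2)⁻¹ * ∑ p ∈ T.filter (fun p => t p ≤ s), c p := by
    rw [← Finset.sum_congr rfl hind, ← intervalIntegral.integral_finsetSum hintp]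
    refine intervalIntegral.integral_congr fun s _ => ?_
    simp only [Finset.mul_sum, Finset.sum_filter, mul_ite, mul_zero]
  have hintS : IntervalIntegrable
      (fun s : ℝ => (s ^ 2)⁻¹ * ∑ p ∈ T.filter (fun p => t p ≤ s), c p) volume a b := by
    have := IntervalIntegrable.sum T hintp
    refine this.congr fun s _ => ?_
    simp only [Finset.sum_apply, Finset.mul_sum, Finset.sum_filter, mul_ite, mul_zero]
  have hcmp : ∀ D : ℝ, IntervalIntegrable (fun s : ℝ => (s ^ 2)⁻¹ * (s - a + D)) volume a b ∧
      ∫ s in a..b, (s ^ 2)⁻¹ * (s - a + D) =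
        Real.log (b / a) + (D - a) * (1 / a - 1 / b) := by
    intro D
    have hci : IntervalIntegrable (fun s : ℝ => (s ^ 2)⁻¹ * (s - a + D)) volume a b := by
      refine ContinuousOn.intervalIntegrable ?_
      rw [Set.uIcc_of_le hab]
      exact hcont.mul (by fun_prop)
    refine ⟨hci, ?_⟩
    rw [intervalIntegral.integral_eq_sub_of_hasDerivAt
      (f := fun s : ℝ => Real.log s - (D - a) * s⁻¹) (fun s hs => ?_) hci]
    · rw [Real.log_div hb.ne' ha.ne']
      ring
    · rw [Set.uIcc_of_le hab] at hs
      have hs0 : s ≠ 0 := (ha.trans_le hs.1).ne'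
      refine ((Real.hasDerivAt_log hs0).fun_sub
        ((hasDerivAt_inv hs0).const_mul (D - a))).congr_deriv ?_
      field_simp
      ring
  have hup := intervalIntegral.integral_mono_on hab hintS (hcmp C).1 fun s hs =>
    mul_le_mul_of_nonneg_left (by have := (abs_le.1 (hS s hs.1 hs.2)).2; linarith)
      (by positivity)
  have hlo := intervalIntegral.integral_mono_on hab (hcmp (-C)).1 hintS fun s hs =>
    mul_le_mul_of_nonneg_left (by have := (abs_le.1 (hS s hs.1 hs.2)).1; linarith)
      (by positivity)
  rw [(hcmp _).2, ← hsum] at hup hlo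
  have hTb := abs_le.1 (hS b hab le_rfl)
  rw [Finset.filter_true_of_mem fun p hp => (ht p hp).2] at hTb
  rw [Finset.sum_sub_distrib, ← Finset.sum_div] at hup hlo
  have h1 : (∑ p ∈ T, c p) / b ≤ (b - a + C) / b := by
    have := hTb.2
    gcongr
    linarith
  have h2 : (b - a - C) / b ≤ (∑ p ∈ T, c p) / b := by
    have := hTb.1
    gcongr
    linarith
  have h3 : (C - a) * (1 / a - 1 / b) + (b - a + C) / b = C / a := by
    field_simp
    ring
  have h4 : (-C - a) * (1 / a - 1 / b) + (b - a - C) / b = - (C / a) := by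
    field_simp
    ring
  rw [abs_le]
  constructor <;> linarith

/-- The primes whose logarithm lies in `(a, b]`. -/
noncomputable def primesLog (a b : ℝ) : Finset ℕ :=
  (Finset.range (⌊Real.exp b⌋₊ + 1)).filter fun p => p.Prime ∧ a < Real.log p

theorem mem_primesLog {a b : ℝ} {p : ℕ} :
    p ∈ primesLog a b ↔ p.Prime ∧ a < Real.log p ∧ Real.log p ≤ b := by
  rw [primesLog, Finset.mem_filter, Finset.mem_range, Nat.lt_succ_iff,
    Nat.le_floor_iff (Real.exp_pos b).le]
  constructor
  · rintro ⟨h1, h2, h3⟩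
    exact ⟨h2, h3, (Real.log_le_iff_le_exp (by exact_mod_cast h2.pos)).2 h1⟩
  · rintro ⟨h2, h3, h1⟩
    exact ⟨(Real.log_le_iff_le_exp (by exact_mod_cast h2.pos)).1 h1, h2, h3⟩

/-- Mertens-type hypothesis on a weight supported on primes. -/
structure MertensWeight (w : ℕ → ℝ) (g C : ℝ) : Prop where
  nonneg : ∀ p, 0 ≤ w p
  le_div : ∀ p : ℕ, p.Prime → w p ≤ g / p
  one_le : 1 ≤ g
  le_one : ∀ p, w p ≤ 1
  C_pos : 0 < C
  mertens : ∀ a b : ℝ, 0 ≤ a → a ≤ b → |∑ p ∈ primesLog a b, w p * Real.log p - (b - a)| ≤ C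

theorem MertensWeight.abs_sum_sub_log_le {w : ℕ → ℝ} {g C : ℝ} (h : MertensWeight w g C) {a b : ℝ}
    (ha : 0 < a) (hab : a ≤ b) : |∑ p ∈ primesLog a b, w p - Real.log (b / a)| ≤ C / a := by
  have := abs_sum_div_sub_log_le (primesLog a b) (fun p => Real.log p)
    (fun p => w p * Real.log p) (C := C) ha hab (fun p hp => (mem_primesLog.1 hp).2) (fun s h1 h2 => by
      have e : (primesLog a b).filter (fun p : ℕ => Real.log p ≤ s) = primesLog a s := by
        ext p
        rw [Finset.mem_filter, mem_primesLog, mem_primesLog]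
        constructor
        · rintro ⟨⟨h3, h4, _⟩, h6⟩
          exact ⟨h3, h4, h6⟩
        · rintro ⟨h3, h4, h6⟩
          exact ⟨⟨h3, h4, h6.trans h2⟩, h6⟩
      rw [e]
      exact h.mertens a s ha.le h1)
  have e : ∑ p ∈ primesLog a b, w p = ∑ p ∈ primesLog a b, w p * Real.log p / Real.log p := by
    refine Finset.sum_congr rfl fun p hp => ?_
    rw [mul_div_cancel_right₀]
    exact (ha.trans (mem_primesLog.1 hp).2.1).ne'
  rwa [e]

theorem MertensWeight.sum_le {w : ℕ → ℝ} {g C : ℝ} (h : MertensWeight w g C) {a b : ℝ}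
    (ha : 0 < a) (hab : a ≤ b) : ∑ p ∈ primesLog a b, w p ≤ (b - a + C) / a := by
  rw [le_div_iff₀ ha, Finset.sum_mul]
  have h1 := (abs_le.1 (h.mertens a b ha.le hab)).2
  refine le_trans (Finset.sum_le_sum fun p hp => ?_) (by linarith)
  exact mul_le_mul_of_nonneg_left (mem_primesLog.1 hp).2.1.le (h.nonneg p)

theorem MertensWeight.le_sum {w : ℕ → ℝ} {g C : ℝ} (h : MertensWeight w g C) {a b : ℝ}
    (ha : 0 ≤ a) (hab : a ≤ b) (hb : 0 < b) : (b - a - C) / b ≤ ∑ p ∈ primesLog a b, w p := by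
  rw [div_le_iff₀ hb, Finset.sum_mul]
  have h1 := (abs_le.1 (h.mertens a b ha hab)).1
  refine le_trans (by linarith) (Finset.sum_le_sum fun p hp => ?_)
  exact mul_le_mul_of_nonneg_left (mem_primesLog.1 hp).2.2 (h.nonneg p)

theorem exists_mertensWeight_polyRho (F : Polynomial ℤ) (hF : Irreducible F)
    (hdeg : 1 ≤ F.natDegree) :
    ∃ C, MertensWeight (fun p => (polyRho F p : ℝ) / p) F.natDegree C := by
  obtain ⟨C, hC⟩ := exists_mertens_polyRho F hF hdeg
  have hl2 : 0 < Real.log 2 := Real.log_pos (by norm_num)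
  have hC0 : 0 ≤ C := (abs_nonneg _).trans (hC 1 le_rfl)
  have h0 : ∀ b : ℝ, 0 ≤ b →
      |∑ p ∈ primesLog 0 b, (polyRho F p : ℝ) / p * Real.log p - b| ≤ C + Real.log 2 := by
    intro b hb
    have h1 : 1 ≤ ⌊Real.exp b⌋₊ := by
      rw [Nat.one_le_floor_iff]
      exact Real.one_le_exp hb
    have h2 := hC _ h1
    have e : (Finset.range (⌊Real.exp b⌋₊ + 1)).filter Nat.Prime = primesLog 0 b := by
      rw [primesLog]
      refine Finset.filter_congr fun p _ => ?_
      constructor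
      · intro hp
        exact ⟨hp, Real.log_pos (by exact_mod_cast hp.one_lt)⟩
      · exact fun h => h.1
    rw [e] at h2
    have h3 : ∑ p ∈ primesLog 0 b, (polyRho F p : ℝ) / p * Real.log p =
        ∑ p ∈ primesLog 0 b, (polyRho F p : ℝ) * (Real.log p / p) :=
      Finset.sum_congr rfl fun p _ => by ring
    rw [h3]
    have hn : (0 : ℝ) < ⌊Real.exp b⌋₊ := by exact_mod_cast h1
    have h4 : Real.log ⌊Real.exp b⌋₊ ≤ b := by
      rw [Real.log_le_iff_le_exp hn]
      exact Nat.floor_le (Real.exp_pos b).le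
    have h5 : b ≤ Real.log 2 + Real.log ⌊Real.exp b⌋₊ := by
      rw [← Real.log_mul (by norm_num) hn.ne', Real.le_log_iff_exp_le (by positivity)]
      have h6 := Nat.lt_floor_add_one (Real.exp b)
      have h7 : (1 : ℝ) ≤ ⌊Real.exp b⌋₊ := by exact_mod_cast h1
      linarith
    rw [abs_le] at h2 ⊢
    constructor <;> linarith
  refine ⟨2 * (C + Real.log 2), fun p => by positivity, fun p hp => ?_, by exact_mod_cast hdeg,
    fun p => ?_, by positivity, fun a b ha hab => ?_⟩
  · have : Fact p.Prime := ⟨hp⟩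
    have := polyRho_le_natDegree F p
      (map_castRingHom_ne_zero_of_isPrimitive (hF.isPrimitive (by omega)) p)
    have : (polyRho F p : ℝ) ≤ F.natDegree := by exact_mod_cast this
    gcongr
  · have : (polyRho F p : ℝ) ≤ p := by exact_mod_cast polyRho_le_self F p
    exact div_le_one_of_le₀ this (by positivity)
  · have h1 := h0 a ha
    have h2 := h0 b (ha.trans hab)
    have e : ∑ p ∈ primesLog 0 b, (polyRho F p : ℝ) / p * Real.log p =
        ∑ p ∈ primesLog 0 a, (polyRho F p : ℝ) / p * Real.log p +
        ∑ p ∈ primesLog a b, (polyRho F p : ℝ) / p * Real.log p := by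
      rw [← Finset.sum_union]
      · congr 1
        ext p
        simp only [Finset.mem_union, mem_primesLog]
        constructor
        · rintro ⟨h3, h4, h5⟩
          rcases le_or_gt (Real.log p) a with h | h
          · exact Or.inl ⟨h3, h4, h⟩
          · exact Or.inr ⟨h3, h, h5⟩
        · rintro (⟨h3, h4, h5⟩ | ⟨h3, h4, h5⟩)
          · exact ⟨h3, h4, h5.trans hab⟩
          · exact ⟨h3, ha.trans_lt h4, h5⟩
      · rw [Finset.disjoint_left]
        intro p h3 h4
        exact absurd (mem_primesLog.1 h3).2.2 (not_le.2 (mem_primesLog.1 h4).2.1)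
    rw [abs_le] at h1 h2 ⊢
    constructor <;> linarith

end

section

theorem sum_powersetCard_succ_sum_erase (P : Finset ℕ) (r : ℕ) (f : Finset ℕ → ℕ → ℝ) :
    ∑ S ∈ P.powersetCard (r + 1), ∑ p ∈ S, f (S.erase p) p =
      ∑ T ∈ P.powersetCard r, ∑ p ∈ P \ T, f T p := by
  rw [Finset.sum_sigma', Finset.sum_sigma']
  refine Finset.sum_bij' (fun a _ => ⟨a.1.erase a.2, a.2⟩) (fun a _ => ⟨insert a.2 a.1, a.2⟩)
    ?_ ?_ ?_ ?_ ?_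
  · rintro ⟨S, p⟩ h
    simp only [Finset.mem_sigma, Finset.mem_powersetCard] at h ⊢
    refine ⟨⟨(Finset.erase_subset _ _).trans h.1.1, ?_⟩, ?_⟩
    · rw [Finset.card_erase_of_mem h.2, h.1.2]
      rfl
    · exact Finset.mem_sdiff.2 ⟨h.1.1 h.2, Finset.notMem_erase _ _⟩
  · rintro ⟨T, p⟩ h
    simp only [Finset.mem_sigma, Finset.mem_powersetCard, Finset.mem_sdiff] at h ⊢
    refine ⟨⟨Finset.insert_subset h.2.1 h.1.1, ?_⟩, Finset.mem_insert_self _ _⟩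
    rw [Finset.card_insert_of_notMem h.2.2, h.1.2]
  · rintro ⟨S, p⟩ h
    simp only [Finset.mem_sigma] at h
    simp only [Finset.insert_erase h.2]
  · rintro ⟨T, p⟩ h
    simp only [Finset.mem_sigma, Finset.mem_sdiff] at h
    simp only [Finset.erase_insert h.2.2]
  · rintro ⟨S, p⟩ _
    rfl

/-- Elementary symmetric functions of the values `x p`, `p ∈ D`. -/
noncomputable def esym (D : Finset ℕ) (x : ℕ → ℝ) (r : ℕ) : ℝ :=
  ∑ m ∈ D.powersetCard r, ∏ p ∈ m, x p

theorem esym_zero (D : Finset ℕ) (x : ℕ → ℝ) : esym D x 0 = 1 := by simp [esym]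

theorem esym_nonneg {D : Finset ℕ} {x : ℕ → ℝ} (hx : ∀ p, 0 ≤ x p) (r : ℕ) : 0 ≤ esym D x r :=
  Finset.sum_nonneg fun _ _ => Finset.prod_nonneg fun p _ => hx p

theorem esym_empty_succ (x : ℕ → ℝ) (r : ℕ) : esym ∅ x (r + 1) = 0 := by
  rw [esym, Finset.powersetCard_eq_empty.2 (by simp), Finset.sum_empty]

theorem esym_insert {D : Finset ℕ} {p : ℕ} (hp : p ∉ D) (x : ℕ → ℝ) (r : ℕ) :
    esym (insert p D) x (r + 1) = esym D x (r + 1) + x p * esym D x r := by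
  rw [esym, Finset.powersetCard_succ_insert hp, Finset.sum_union, Finset.sum_image, esym, esym,
    Finset.mul_sum]
  · congr 1
    refine Finset.sum_congr rfl fun m hm => ?_
    rw [Finset.prod_insert fun h => hp ((Finset.mem_powersetCard.1 hm).1 h)]
  · intro m hm m' hm' h
    have h1 : p ∉ m := fun h => hp ((Finset.mem_powersetCard.1 hm).1 h)
    have h2 : p ∉ m' := fun h => hp ((Finset.mem_powersetCard.1 hm').1 h)
    rw [← Finset.erase_insert h1, ← Finset.erase_insert h2, h]
  · rw [Finset.disjoint_left]
    intro m hm hm'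
    obtain ⟨m', -, rfl⟩ := Finset.mem_image.1 hm'
    exact hp ((Finset.mem_powersetCard.1 hm).1 (Finset.mem_insert_self _ _))

theorem succ_mul_esym_succ (D : Finset ℕ) (x : ℕ → ℝ) (r : ℕ) :
    (r + 1 : ℝ) * esym D x (r + 1) =
      ∑ T ∈ D.powersetCard r, (∑ p ∈ D \ T, x p) * ∏ p ∈ T, x p := by
  have h := sum_powersetCard_succ_sum_erase D r fun T p => x p * ∏ p ∈ T, x p
  simp only [← Finset.sum_mul] at h
  rw [← h, esym, Finset.mul_sum]
  refine Finset.sum_congr rfl fun S hS => ?_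
  rw [Finset.sum_congr rfl fun p hp => Finset.mul_prod_erase S x hp, Finset.sum_const,
    (Finset.mem_powersetCard.1 hS).2, nsmul_eq_mul]
  push_cast
  ring

theorem succ_mul_esym_succ_le {D : Finset ℕ} {x : ℕ → ℝ} (hx : ∀ p, 0 ≤ x p) (r : ℕ) :
    (r + 1 : ℝ) * esym D x (r + 1) ≤ (∑ p ∈ D, x p) * esym D x r := by
  rw [succ_mul_esym_succ, esym, Finset.mul_sum]
  refine Finset.sum_le_sum fun T _ => mul_le_mul_of_nonneg_right ?_
    (Finset.prod_nonneg fun p _ => hx p)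
  exact Finset.sum_le_sum_of_subset_of_nonneg Finset.sdiff_subset fun p _ _ => hx p

theorem le_succ_mul_esym_succ {D : Finset ℕ} {x : ℕ → ℝ} (hx : ∀ p, 0 ≤ x p) {M : ℝ}
    (hM : ∀ p ∈ D, x p ≤ M) (r : ℕ) :
    ((∑ p ∈ D, x p) - r * M) * esym D x r ≤ (r + 1 : ℝ) * esym D x (r + 1) := by
  rw [succ_mul_esym_succ, esym, Finset.mul_sum]
  refine Finset.sum_le_sum fun T hT => mul_le_mul_of_nonneg_right ?_
    (Finset.prod_nonneg fun p _ => hx p)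
  obtain ⟨h1, h2⟩ := Finset.mem_powersetCard.1 hT
  rw [← Finset.sum_sdiff h1]
  have : ∑ p ∈ T, x p ≤ r * M := by
    rw [← h2, ← nsmul_eq_mul]
    exact Finset.sum_le_card_nsmul _ _ _ fun p hp => hM p (h1 hp)
  linarith

theorem esym_le {D : Finset ℕ} {x : ℕ → ℝ} (hx : ∀ p, 0 ≤ x p) (r : ℕ) :
    esym D x r ≤ (∑ p ∈ D, x p) ^ r / r.factorial := by
  induction r with
  | zero => simp [esym_zero]
  | succ r ih =>
    have h1 := succ_mul_esym_succ_le (D := D) hx r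
    have hμ : 0 ≤ ∑ p ∈ D, x p := Finset.sum_nonneg fun p _ => hx p
    have h2 := h1.trans (mul_le_mul_of_nonneg_left ih hμ)
    rw [Nat.factorial_succ, Nat.cast_mul, le_div_iff₀ (by positivity)]
    rw [mul_div_assoc', le_div_iff₀ (by positivity)] at h2
    push_cast
    calc _ = (r + 1 : ℝ) * esym D x (r + 1) * r.factorial := by ring
      _ ≤ _ := h2
      _ = _ := by ring

/-- Truncations of the inclusion-exclusion expansion of `∏ (1 - x p)`. -/
noncomputable def altSum (D : Finset ℕ) (x : ℕ → ℝ) (r : ℕ) : ℝ :=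
  ∑ j ∈ Finset.range (r + 1), (-1) ^ j * esym D x j

theorem altSum_zero (D : Finset ℕ) (x : ℕ → ℝ) : altSum D x 0 = 1 := by simp [altSum, esym_zero]

theorem altSum_insert {D : Finset ℕ} {p : ℕ} (hp : p ∉ D) (x : ℕ → ℝ) (r : ℕ) :
    altSum (insert p D) x (r + 1) = altSum D x (r + 1) - x p * altSum D x r := by
  rw [altSum, altSum, Finset.sum_range_succ', Finset.sum_range_succ' _ (r + 1), altSum,
    Finset.mul_sum, esym_zero, esym_zero, add_sub_right_comm, ← Finset.sum_sub_distrib]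
  congr 1
  refine Finset.sum_congr rfl fun j _ => ?_
  rw [esym_insert hp]
  ring

/-- Bonferroni inequalities. -/
theorem altSum_bounds {x : ℕ → ℝ} (hx0 : ∀ p, 0 ≤ x p) (hx1 : ∀ p, x p ≤ 1) (D : Finset ℕ)
    (r : ℕ) : 0 ≤ (-1) ^ r * (altSum D x r - ∏ p ∈ D, (1 - x p)) ∧
      (-1) ^ r * (altSum D x r - ∏ p ∈ D, (1 - x p)) ≤ esym D x (r + 1) := by
  induction D using Finset.induction_on generalizing r with
  | empty =>
    have : altSum ∅ x r = 1 := by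
      rw [altSum, Finset.sum_range_succ', esym_zero, Finset.sum_eq_zero]
      · simp
      · intro j _
        rw [esym_empty_succ, mul_zero]
    simp [this, esym_empty_succ]
  | insert p D hp ih =>
    have hP0 : 0 ≤ ∏ p ∈ D, (1 - x p) :=
      Finset.prod_nonneg fun p _ => sub_nonneg.2 (hx1 p)
    have hP1 : ∏ p ∈ D, (1 - x p) ≤ 1 :=
      Finset.prod_le_one (fun p _ => sub_nonneg.2 (hx1 p)) fun p _ => by linarith [hx0 p]
    rw [esym_insert hp, Finset.prod_insert hp]
    cases r with
    | zero =>
      have h := ih 0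
      rw [altSum_zero, pow_zero, one_mul] at h ⊢
      rw [esym_zero]
      have := mul_nonneg (hx0 p) hP0
      have := mul_le_mul_of_nonneg_left hP1 (hx0 p)
      constructor <;> linarith
    | succ r =>
      rw [altSum_insert hp]
      have h1 := ih (r + 1)
      have h2 := ih r
      have e : (-1 : ℝ) ^ (r + 1) * (altSum D x (r + 1) - x p * altSum D x r -
          (1 - x p) * ∏ p ∈ D, (1 - x p)) =
          (-1) ^ (r + 1) * (altSum D x (r + 1) - ∏ p ∈ D, (1 - x p)) +
          x p * ((-1) ^ r * (altSum D x r - ∏ p ∈ D, (1 - x p))) := by ring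
      rw [e]
      have h3 := mul_nonneg (hx0 p) h2.1
      have h4 := mul_le_mul_of_nonneg_left h2.2 (hx0 p)
      constructor <;> linarith

end

section

/-- `Φ` is a multilinear polynomial in the variables indexed by `P`, and the sum of the absolute
values of its coefficients, with `g ^ d` attached to degree `d`, is at most `B`. -/
def IsMultilin (g : ℝ) (P : Finset ℕ) (Φ : (ℕ → ℝ) → ℝ) (B : ℝ) : Prop :=
  ∃ (ι : Type) (_ : Fintype ι) (c : ι → ℝ) (m : ι → Finset ℕ), (∀ i, m i ⊆ P) ∧
    (∀ x, Φ x = ∑ i, c i * ∏ p ∈ m i, x p) ∧ ∑ i, |c i| * g ^ (m i).card ≤ B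

theorem IsMultilin.mono {g : ℝ} {P Q : Finset ℕ} {Φ : (ℕ → ℝ) → ℝ} {B B' : ℝ}
    (h : IsMultilin g P Φ B) (hPQ : P ⊆ Q) (hB : B ≤ B') : IsMultilin g Q Φ B' := by
  obtain ⟨ι, _, c, m, h1, h2, h3⟩ := h
  exact ⟨ι, _, c, m, fun i => (h1 i).trans hPQ, h2, h3.trans hB⟩

theorem IsMultilin.add {g : ℝ} {P : Finset ℕ} {Φ Ψ : (ℕ → ℝ) → ℝ} {A B : ℝ}
    (h : IsMultilin g P Φ A) (h' : IsMultilin g P Ψ B) :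
    IsMultilin g P (fun x => Φ x + Ψ x) (A + B) := by
  obtain ⟨ι, _, c, m, h1, h2, h3⟩ := h
  obtain ⟨κ, _, d, l, h4, h5, h6⟩ := h'
  refine ⟨ι ⊕ κ, inferInstance, Sum.elim c d, Sum.elim m l, ?_, fun x => ?_, ?_⟩
  · rintro (i | i)
    exacts [h1 i, h4 i]
  · show Φ x + Ψ x = _
    rw [Fintype.sum_sum_type, h2, h5]
    rfl
  · rw [Fintype.sum_sum_type]
    exact add_le_add h3 h6

theorem IsMultilin.const_mul {g : ℝ} {P : Finset ℕ} {Φ : (ℕ → ℝ) → ℝ} {A : ℝ}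
    (h : IsMultilin g P Φ A) (a : ℝ) : IsMultilin g P (fun x => a * Φ x) (|a| * A) := by
  obtain ⟨ι, _, c, m, h1, h2, h3⟩ := h
  refine ⟨ι, inferInstance, fun i => a * c i, m, h1, fun x => ?_, ?_⟩
  · show a * Φ x = _
    rw [h2, Finset.mul_sum]
    exact Finset.sum_congr rfl fun i _ => (mul_assoc _ _ _).symm
  · refine le_trans (le_of_eq ?_) (mul_le_mul_of_nonneg_left h3 (abs_nonneg a))
    rw [Finset.mul_sum]
    refine Finset.sum_congr rfl fun i _ => ?_
    rw [abs_mul, mul_assoc]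

theorem IsMultilin.mul {g : ℝ} (hg : 0 ≤ g) {P Q : Finset ℕ} (hPQ : Disjoint P Q)
    {Φ Ψ : (ℕ → ℝ) → ℝ} {A B : ℝ} (h : IsMultilin g P Φ A) (h' : IsMultilin g Q Ψ B) :
    IsMultilin g (P ∪ Q) (fun x => Φ x * Ψ x) (A * B) := by
  obtain ⟨ι, _, c, m, h1, h2, h3⟩ := h
  obtain ⟨κ, _, d, l, h4, h5, h6⟩ := h'
  have hdis : ∀ i j, Disjoint (m i) (l j) := fun i j =>
    Finset.disjoint_of_subset_left (h1 i) (Finset.disjoint_of_subset_right (h4 j) hPQ)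
  refine ⟨ι × κ, inferInstance, fun a => c a.1 * d a.2, fun a => m a.1 ∪ l a.2, fun a =>
    Finset.union_subset_union (h1 _) (h4 _), fun x => ?_, ?_⟩
  · show Φ x * Ψ x = _
    rw [h2, h5, Finset.sum_mul_sum, Fintype.sum_prod_type]
    refine Finset.sum_congr rfl fun i _ => Finset.sum_congr rfl fun j _ => ?_
    rw [Finset.prod_union (hdis i j)]
    ring
  · rw [Fintype.sum_prod_type]
    calc _ = (∑ i, |c i| * g ^ (m i).card) * ∑ j, |d j| * g ^ (l j).card := by
          rw [Finset.sum_mul_sum]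
          refine Finset.sum_congr rfl fun i _ => Finset.sum_congr rfl fun j _ => ?_
          rw [Finset.card_union_of_disjoint (hdis i j), abs_mul, pow_add]
          ring
      _ ≤ A * B := mul_le_mul h3 h6 (Finset.sum_nonneg fun j _ => by positivity)
          ((Finset.sum_nonneg fun j _ => by positivity).trans h3)

theorem isMultilin_one (g : ℝ) (P : Finset ℕ) : IsMultilin g P (fun _ => 1) 1 :=
  ⟨Unit, inferInstance, fun _ => 1, fun _ => ∅, fun _ => Finset.empty_subset _, fun x => by simp,
    by simp⟩

theorem isMultilin_esym {g : ℝ} (hg : 0 ≤ g) (D : Finset ℕ) (r : ℕ) :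
    IsMultilin g D (fun x => esym D x r) ((g * D.card) ^ r) := by
  refine ⟨D.powersetCard r, inferInstance, fun _ => 1, fun m => m.1,
    fun m => (Finset.mem_powersetCard.1 m.2).1, fun x => ?_, ?_⟩
  · show esym D x r = _
    unfold esym
    rw [← Finset.sum_coe_sort]
    simp
  · simp only [abs_one, one_mul]
    rw [Finset.sum_congr rfl fun (m : D.powersetCard r) _ => by
      rw [(Finset.mem_powersetCard.1 m.2).2], Finset.sum_const, nsmul_eq_mul, mul_pow, mul_comm]
    refine mul_le_mul_of_nonneg_left ?_ (by positivity)
    rw [Finset.card_univ, Fintype.card_coe, Finset.card_powersetCard]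
    exact_mod_cast Nat.choose_le_pow _ _

theorem isMultilin_altSum {g : ℝ} (hg : 0 ≤ g) (D : Finset ℕ) (r : ℕ) :
    IsMultilin g D (fun x => altSum D x r) ((1 + g * D.card) ^ r) := by
  induction r with
  | zero =>
    simp only [altSum_zero, pow_zero]
    exact isMultilin_one g D
  | succ r ih =>
    have h := ih.add ((isMultilin_esym hg D (r + 1)).const_mul ((-1) ^ (r + 1)))
    have e : (fun x => altSum D x (r + 1)) =
        fun x => altSum D x r + (-1) ^ (r + 1) * esym D x (r + 1) := by
      ext x
      rw [altSum, Finset.sum_range_succ, altSum]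
    rw [e]
    refine h.mono subset_rfl ?_
    have ht : 0 ≤ g * D.card := by positivity
    have h1 : (g * D.card : ℝ) ^ r ≤ (1 + g * D.card) ^ r := pow_le_pow_left₀ ht (by linarith) r
    have h2 := mul_le_mul_of_nonneg_left h1 ht
    rw [abs_pow, abs_neg, abs_one, one_pow, one_mul, pow_succ, pow_succ]
    linarith

theorem IsMultilin.abs_sum_sub_le {g : ℝ} {P : Finset ℕ} {Φ : (ℕ → ℝ) → ℝ} {B : ℝ}
    (h : IsMultilin g P Φ B) (I : Finset ℕ) (bad : ℕ → ℕ → Prop) (w : ℕ → ℝ) {N E : ℝ}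
    (hE : 0 ≤ E)
    (hI : ∀ m ⊆ P, |((I.filter fun k => ∀ p ∈ m, bad p k).card : ℝ) - N * ∏ p ∈ m, w p| ≤
      E * g ^ m.card) :
    |∑ k ∈ I, Φ (fun p => if bad p k then 1 else 0) - N * Φ w| ≤ E * B := by
  obtain ⟨ι, _, c, m, h1, h2, h3⟩ := h
  have e : ∑ k ∈ I, Φ (fun p => if bad p k then 1 else 0) =
      ∑ i, c i * ((I.filter fun k => ∀ p ∈ m i, bad p k).card : ℝ) := by
    simp only [h2]
    rw [Finset.sum_comm]
    refine Finset.sum_congr rfl fun i _ => ?_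
    rw [← Finset.mul_sum, Finset.card_filter]
    push_cast
    congr 1
    refine Finset.sum_congr rfl fun k _ => ?_
    rw [Finset.prod_boole]
  rw [e, h2, Finset.mul_sum, ← Finset.sum_sub_distrib]
  refine (Finset.abs_sum_le_sum_abs _ _).trans ?_
  calc ∑ i, |c i * ((I.filter fun k => ∀ p ∈ m i, bad p k).card : ℝ) -
        N * (c i * ∏ p ∈ m i, w p)| ≤ ∑ i, E * (|c i| * g ^ (m i).card) := by
        refine Finset.sum_le_sum fun i _ => ?_
        rw [show c i * ((I.filter fun k => ∀ p ∈ m i, bad p k).card : ℝ) -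
          N * (c i * ∏ p ∈ m i, w p) = c i * (((I.filter fun k => ∀ p ∈ m i, bad p k).card : ℝ) -
          N * ∏ p ∈ m i, w p) by ring, abs_mul,
          show E * (|c i| * g ^ (m i).card) = |c i| * (E * g ^ (m i).card) by ring]
        exact mul_le_mul_of_nonneg_left (hI _ (h1 i)) (abs_nonneg _)
    _ = E * ∑ i, |c i| * g ^ (m i).card := (Finset.mul_sum _ _ _).symm
    _ ≤ E * B := mul_le_mul_of_nonneg_left h3 hE

/-- The product of upper truncations over the first `n` blocks. -/
noncomputable def sieveUp (B : ℕ → Finset ℕ) (k : ℕ → ℕ) (x : ℕ → ℝ) (n : ℕ) : ℝ :=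
  ∏ i ∈ Finset.range n, altSum (B i) x (2 * k i)

/-- A lower bound for the product of `1 - x p` over the first `n` blocks. -/
noncomputable def sieveLo (B : ℕ → Finset ℕ) (k : ℕ → ℕ) (x : ℕ → ℝ) : ℕ → ℝ
  | 0 => 1
  | n + 1 => sieveLo B k x n * altSum (B n) x (2 * k n) -
      esym (B n) x (2 * k n + 1) * sieveUp B k x n

theorem prod_one_sub_le_altSum {x : ℕ → ℝ} (hx0 : ∀ p, 0 ≤ x p) (hx1 : ∀ p, x p ≤ 1)
    (D : Finset ℕ) (k : ℕ) : ∏ p ∈ D, (1 - x p) ≤ altSum D x (2 * k) := by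
  have h := (altSum_bounds hx0 hx1 D (2 * k)).1
  rw [pow_mul, neg_one_sq, one_pow, one_mul] at h
  linarith

theorem altSum_le_prod_add {x : ℕ → ℝ} (hx0 : ∀ p, 0 ≤ x p) (hx1 : ∀ p, x p ≤ 1)
    (D : Finset ℕ) (k : ℕ) :
    altSum D x (2 * k) ≤ ∏ p ∈ D, (1 - x p) + esym D x (2 * k + 1) := by
  have h := (altSum_bounds hx0 hx1 D (2 * k)).2
  rw [pow_mul, neg_one_sq, one_pow, one_mul] at h
  linarith

theorem prod_le_sieveUp {x : ℕ → ℝ} (hx0 : ∀ p, 0 ≤ x p) (hx1 : ∀ p, x p ≤ 1)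
    (B : ℕ → Finset ℕ) (k : ℕ → ℕ) (n : ℕ) :
    ∏ i ∈ Finset.range n, ∏ p ∈ B i, (1 - x p) ≤ sieveUp B k x n :=
  Finset.prod_le_prod (fun i _ => Finset.prod_nonneg fun p _ => sub_nonneg.2 (hx1 p))
    fun i _ => prod_one_sub_le_altSum hx0 hx1 _ _

theorem sieveLo_le_prod {x : ℕ → ℝ} (hx0 : ∀ p, 0 ≤ x p) (hx1 : ∀ p, x p ≤ 1)
    (B : ℕ → Finset ℕ) (k : ℕ → ℕ) (n : ℕ) :
    sieveLo B k x n ≤ ∏ i ∈ Finset.range n, ∏ p ∈ B i, (1 - x p) := by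
  induction n with
  | zero => simp [sieveLo]
  | succ n ih =>
    rw [sieveLo, Finset.prod_range_succ]
    have hn (i : ℕ) : 0 ≤ ∏ p ∈ B i, (1 - x p) :=
      Finset.prod_nonneg fun p _ => sub_nonneg.2 (hx1 p)
    have hA := prod_one_sub_le_altSum hx0 hx1 (B n) (k n)
    have h1 := mul_le_mul_of_nonneg_right ih ((hn n).trans hA)
    have h2 := mul_le_mul_of_nonneg_left (altSum_le_prod_add hx0 hx1 (B n) (k n))
      (Finset.prod_nonneg fun i (_ : i ∈ Finset.range n) => hn i)
    have h3 := mul_le_mul_of_nonneg_left (prod_le_sieveUp hx0 hx1 B k n)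
      (esym_nonneg (D := B n) hx0 (2 * k n + 1))
    linarith

theorem le_sieveLo {x : ℕ → ℝ} (hx0 : ∀ p, 0 ≤ x p) (hx1 : ∀ p, x p ≤ 1)
    (B : ℕ → Finset ℕ) (k : ℕ → ℕ) (n : ℕ) (hV : ∀ i < n, 0 < ∏ p ∈ B i, (1 - x p)) :
    (1 - ∑ i ∈ Finset.range n, esym (B i) x (2 * k i + 1) / ∏ p ∈ B i, (1 - x p)) *
      sieveUp B k x n ≤ sieveLo B k x n := by
  induction n with
  | zero => simp [sieveLo, sieveUp]
  | succ n ih =>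
    have h1 := ih fun i hi => hV i (hi.trans n.lt_succ_self)
    have hVn := hV n n.lt_succ_self
    have hA := prod_one_sub_le_altSum hx0 hx1 (B n) (k n)
    have hU : 0 ≤ sieveUp B k x n := le_trans (Finset.prod_nonneg fun i _ =>
      Finset.prod_nonneg fun p _ => sub_nonneg.2 (hx1 p)) (prod_le_sieveUp hx0 hx1 B k n)
    have hE := esym_nonneg (D := B n) hx0 (2 * k n + 1)
    have h2 := mul_le_mul_of_nonneg_right h1 (hVn.le.trans hA)
    have h3 : esym (B n) x (2 * k n + 1) * sieveUp B k x n ≤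
        esym (B n) x (2 * k n + 1) / (∏ p ∈ B n, (1 - x p)) *
          (sieveUp B k x n * altSum (B n) x (2 * k n)) := by
      rw [div_mul_eq_mul_div, le_div_iff₀ hVn, mul_assoc]
      exact mul_le_mul_of_nonneg_left (mul_le_mul_of_nonneg_left hA hU) hE
    rw [sieveLo, Finset.sum_range_succ, sieveUp, Finset.prod_range_succ, ← sieveUp]
    linarith

theorem isMultilin_sieve {g : ℝ} (hg : 0 ≤ g) (B : ℕ → Finset ℕ) (k : ℕ → ℕ)
    (hB : ∀ i j, i < j → Disjoint (B i) (B j)) (n : ℕ) :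
    IsMultilin g ((Finset.range n).biUnion B) (fun x => sieveUp B k x n)
      (∏ i ∈ Finset.range n, (1 + g * (B i).card) ^ (2 * k i + 1)) ∧
    IsMultilin g ((Finset.range n).biUnion B) (fun x => sieveLo B k x n)
      (2 ^ n * ∏ i ∈ Finset.range n, (1 + g * (B i).card) ^ (2 * k i + 1)) := by
  induction n with
  | zero =>
    simp only [sieveUp, sieveLo, Finset.prod_range_zero, pow_zero, mul_one]
    exact ⟨isMultilin_one _ _, isMultilin_one _ _⟩
  | succ n ih =>
    have hb (i : ℕ) : (1 : ℝ) ≤ 1 + g * (B i).card := le_add_of_nonneg_right (by positivity)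
    have hA : IsMultilin g (B n) (fun x => altSum (B n) x (2 * k n))
        ((1 + g * (B n).card) ^ (2 * k n + 1)) :=
      (isMultilin_altSum hg (B n) (2 * k n)).mono subset_rfl
        (pow_le_pow_right₀ (hb n) (Nat.le_succ _))
    have hE : IsMultilin g (B n) (fun x => esym (B n) x (2 * k n + 1))
        ((1 + g * (B n).card) ^ (2 * k n + 1)) :=
      (isMultilin_esym hg (B n) (2 * k n + 1)).mono subset_rfl
        (pow_le_pow_left₀ (by positivity) (by linarith) _)
    have hd : Disjoint ((Finset.range n).biUnion B) (B n) := by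
      rw [Finset.disjoint_biUnion_left]
      exact fun i hi => hB i n (Finset.mem_range.1 hi)
    have hu : (Finset.range n).biUnion B ∪ B n ⊆ (Finset.range (n + 1)).biUnion B := by
      rw [Finset.range_add_one, Finset.biUnion_insert, Finset.union_comm]
    have h1 := (ih.1.mul hg hd hA).mono hu le_rfl
    have h2 := (ih.2.mul hg hd hA).mono hu le_rfl
    have h3 := ((ih.1.mul hg hd hE).mono hu le_rfl).const_mul (-1)
    simp only [sieveUp, sieveLo, Finset.prod_range_succ]
    refine ⟨h1, ?_⟩
    have h4 := h2.add h3
    have e : (fun x => sieveLo B k x n * altSum (B n) x (2 * k n) - esym (B n) x (2 * k n + 1) *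
        ∏ i ∈ Finset.range n, altSum (B i) x (2 * k i)) = fun x =>
        sieveLo B k x n * altSum (B n) x (2 * k n) +
          -1 * (sieveUp B k x n * esym (B n) x (2 * k n + 1)) := by
      ext x
      rw [sieveUp]
      ring
    rw [e]
    refine h4.mono subset_rfl ?_
    rw [abs_neg, abs_one, one_mul, pow_succ (2 : ℝ) n]
    have hp : 1 ≤ (2 : ℝ) ^ n := one_le_pow₀ one_le_two
    have hq : 0 ≤ (∏ i ∈ Finset.range n, (1 + g * ((B i).card : ℝ)) ^ (2 * k i + 1)) *
        (1 + g * ((B n).card : ℝ)) ^ (2 * k n + 1) := by positivity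
    have h5 := mul_le_mul_of_nonneg_right hp hq
    generalize (∏ i ∈ Finset.range n, (1 + g * ((B i).card : ℝ)) ^ (2 * k i + 1)) = Q at h5 ⊢
    generalize (1 + g * ((B n).card : ℝ)) ^ (2 * k n + 1) = R at h5 ⊢
    linarith

/-- A combinatorial lower-bound sieve. -/
theorem sieve_lower {g : ℝ} (hg : 0 ≤ g) (B : ℕ → Finset ℕ) (k : ℕ → ℕ)
    (hB : ∀ i j, i < j → Disjoint (B i) (B j)) (n : ℕ) (I : Finset ℕ) (bad : ℕ → ℕ → Prop)
    {w : ℕ → ℝ} (hw0 : ∀ p, 0 ≤ w p) (hw1 : ∀ p, w p ≤ 1) {N E : ℝ} (hN : 0 ≤ N) (hE : 0 ≤ E)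
    (hI : ∀ m ⊆ (Finset.range n).biUnion B,
      |((I.filter fun k => ∀ p ∈ m, bad p k).card : ℝ) - N * ∏ p ∈ m, w p| ≤ E * g ^ m.card)
    (hV : ∀ i < n, 0 < ∏ p ∈ B i, (1 - w p))
    (hs : ∑ i ∈ Finset.range n, esym (B i) w (2 * k i + 1) / ∏ p ∈ B i, (1 - w p) ≤ 1 / 2) :
    N / 2 * ∏ i ∈ Finset.range n, ∏ p ∈ B i, (1 - w p) -
      E * (2 ^ n * ∏ i ∈ Finset.range n, (1 + g * (B i).card) ^ (2 * k i + 1)) ≤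
      ((I.filter fun k => ∀ p ∈ (Finset.range n).biUnion B, ¬ bad p k).card : ℝ) := by
  have h1 := (isMultilin_sieve hg B k hB n).2.abs_sum_sub_le I bad w hE hI
  have h2 : ∑ a ∈ I, sieveLo B k (fun p => if bad p a then 1 else 0) n ≤
      ((I.filter fun k => ∀ p ∈ (Finset.range n).biUnion B, ¬ bad p k).card : ℝ) := by
    rw [Finset.card_filter]
    push_cast
    refine Finset.sum_le_sum fun a _ => ?_
    refine (sieveLo_le_prod (x := fun p => if bad p a then (1 : ℝ) else 0) ?_ ?_ B k n).trans ?_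
    · intro p
      split_ifs <;> norm_num
    · intro p
      split_ifs <;> norm_num
    · rw [← Finset.prod_biUnion]
      · by_cases h : ∀ p ∈ (Finset.range n).biUnion B, ¬ bad p a
        · rw [if_pos h, Finset.prod_congr rfl fun p hp => by rw [if_neg (h p hp), sub_zero]]
          simp
        · rw [if_neg h]
          push Not at h
          obtain ⟨p, hp, hb⟩ := h
          exact (Finset.prod_eq_zero hp (by rw [if_pos hb, sub_self])).le
      · intro i _ j _ hij
        rcases lt_or_gt_of_ne hij with h | h
        exacts [hB i j h, (hB j i h).symm]
  have h3 := le_sieveLo hw0 hw1 B k n hV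
  have h4 := prod_le_sieveUp hw0 hw1 B k n
  have h5 : 0 ≤ ∏ i ∈ Finset.range n, ∏ p ∈ B i, (1 - w p) :=
    Finset.prod_nonneg fun i _ => Finset.prod_nonneg fun p _ => sub_nonneg.2 (hw1 p)
  have h6 : 1 / 2 * ∏ i ∈ Finset.range n, ∏ p ∈ B i, (1 - w p) ≤ sieveLo B k w n :=
    (mul_le_mul (by linarith) h4 h5 (by linarith)).trans h3
  have h7 := mul_le_mul_of_nonneg_left h6 hN
  have h8 := (abs_le.1 h1).1
  linarith

end

section

theorem abs_card_Ioc_modEq_sub_le {x₁ x₂ : ℝ} (h0 : 0 ≤ x₁) (h : x₁ ≤ x₂) {A : ℕ} (hA : 0 < A)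
    (v : ℕ) : |(((Finset.Ioc ⌊x₁⌋₊ ⌊x₂⌋₊).filter fun n => n ≡ v [MOD A]).card : ℝ) -
      (x₂ - x₁) / A| ≤ 2 := by
  have h1 := Nat.Ioc_filter_modEq_card ⌊x₁⌋₊ ⌊x₂⌋₊ hA v
  have hA' : (1 : ℝ) ≤ A := by exact_mod_cast hA
  have hle := Nat.floor_mono h
  have hmono : ⌊((⌊x₁⌋₊ : ℚ) - v) / A⌋ ≤ ⌊((⌊x₂⌋₊ : ℚ) - v) / A⌋ := by
    refine Int.floor_mono ?_
    gcongr
  rw [max_eq_left (by linarith)] at h1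
  have h2 : (((Finset.Ioc ⌊x₁⌋₊ ⌊x₂⌋₊).filter fun n => n ≡ v [MOD A]).card : ℝ) =
      (⌊((⌊x₂⌋₊ : ℚ) - v) / A⌋ : ℝ) - (⌊((⌊x₁⌋₊ : ℚ) - v) / A⌋ : ℝ) := by
    exact_mod_cast h1
  have a1 : (⌊((⌊x₂⌋₊ : ℚ) - v) / A⌋ : ℝ) ≤ ((⌊x₂⌋₊ : ℝ) - v) / A := by
    exact_mod_cast Int.floor_le (((⌊x₂⌋₊ : ℚ) - v) / A)
  have a2 : ((⌊x₂⌋₊ : ℝ) - v) / A < (⌊((⌊x₂⌋₊ : ℚ) - v) / A⌋ : ℝ) + 1 := by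
    exact_mod_cast Int.lt_floor_add_one (((⌊x₂⌋₊ : ℚ) - v) / A)
  have a3 : (⌊((⌊x₁⌋₊ : ℚ) - v) / A⌋ : ℝ) ≤ ((⌊x₁⌋₊ : ℝ) - v) / A := by
    exact_mod_cast Int.floor_le (((⌊x₁⌋₊ : ℚ) - v) / A)
  have a4 : ((⌊x₁⌋₊ : ℝ) - v) / A < (⌊((⌊x₁⌋₊ : ℚ) - v) / A⌋ : ℝ) + 1 := by
    exact_mod_cast Int.lt_floor_add_one (((⌊x₁⌋₊ : ℚ) - v) / A)
  have b1 := Nat.floor_le h0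
  have b2 := Nat.floor_le (h0.trans h)
  have b3 := Nat.lt_floor_add_one x₁
  have b4 := Nat.lt_floor_add_one x₂
  have c1 : ((⌊x₂⌋₊ : ℝ) - v) / A - ((⌊x₁⌋₊ : ℝ) - v) / A - (x₂ - x₁) / A =
      ((⌊x₂⌋₊ - x₂) + (x₁ - ⌊x₁⌋₊)) / A := by ring
  have c2 : |((⌊x₂⌋₊ - x₂) + (x₁ - ⌊x₁⌋₊)) / (A : ℝ)| ≤ 1 := by
    rw [abs_div, abs_of_pos (by linarith : (0 : ℝ) < A), div_le_one (by linarith), abs_le]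
    constructor <;> linarith
  rw [h2, abs_le]
  rw [← c1, abs_le] at c2
  constructor <;> linarith [c2.1, c2.2]

theorem dvd_eval_iff_of_modEq (F : Polynomial ℤ) {p m n : ℕ} (h : m ≡ n [MOD p]) :
    (p : ℤ) ∣ F.eval (m : ℤ) ↔ (p : ℤ) ∣ F.eval (n : ℤ) := by
  have h1 : (p : ℤ) ∣ (m : ℤ) - n := (Int.modEq_iff_dvd.1 (Int.natCast_modEq_iff.2 h.symm))
  have h2 : (p : ℤ) ∣ F.eval (m : ℤ) - F.eval (n : ℤ) :=
    h1.trans (Polynomial.sub_dvd_eval_sub _ _ _)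
  exact (dvd_iff_dvd_of_dvd_sub h2)

theorem abs_card_modEq_dvd_sub_le (F : Polynomial ℤ) {x₁ x₂ : ℝ} (h0 : 0 ≤ x₁) (h : x₁ ≤ x₂)
    (T : Finset ℕ) (hT : ∀ p ∈ T, p.Prime) {A : ℕ} (hA : 0 < A) (hc : ∀ p ∈ T, A.Coprime p)
    (v : ℕ) : |(((Finset.Ioc ⌊x₁⌋₊ ⌊x₂⌋₊).filter fun n => n ≡ v [MOD A] ∧
      ∀ p ∈ T, (p : ℤ) ∣ F.eval (n : ℤ)).card : ℝ) -
      (x₂ - x₁) / A * ∏ p ∈ T, (polyRho F p : ℝ) / p| ≤ 2 * ∏ p ∈ T, (polyRho F p : ℝ) := by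
  induction T using Finset.induction_on generalizing A v with
  | empty => simpa using abs_card_Ioc_modEq_sub_le h0 h hA v
  | insert p T hp ih =>
    have hpp := hT p (Finset.mem_insert_self _ _)
    have hAp := hc p (Finset.mem_insert_self _ _)
    set R := (Finset.range p).filter fun n : ℕ => (p : ℤ) ∣ F.eval (n : ℤ) with hR
    have hRc : R.card = polyRho F p := (polyRho_eq_card_filter F p).symm
    set I := Finset.Ioc ⌊x₁⌋₊ ⌊x₂⌋₊
    set u : ℕ → ℕ := fun r => (Nat.chineseRemainder hAp v r : ℕ) with hu
    have hcard : (I.filter fun n => n ≡ v [MOD A] ∧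
        ∀ q ∈ insert p T, (q : ℤ) ∣ F.eval (n : ℤ)).card = ∑ r ∈ R, (I.filter fun n =>
          n ≡ u r [MOD A * p] ∧ ∀ q ∈ T, (q : ℤ) ∣ F.eval (n : ℤ)).card := by
      rw [Finset.card_eq_sum_card_fiberwise (f := fun n => n % p) (t := R)]
      · refine Finset.sum_congr rfl fun r hr => ?_
        rw [Finset.filter_filter]
        congr 1
        refine Finset.filter_congr fun n _ => ?_
        have hr' := Finset.mem_filter.1 hr
        have hrp : r < p := Finset.mem_range.1 hr'.1
        have hiff : n ≡ u r [MOD A * p] ↔ n ≡ v [MOD A] ∧ n % p = r := by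
          rw [← Nat.modEq_and_modEq_iff_modEq_mul hAp]
          have e1 : u r ≡ v [MOD A] := (Nat.chineseRemainder hAp v r).2.1
          have e2 : u r ≡ r [MOD p] := (Nat.chineseRemainder hAp v r).2.2
          refine and_congr ⟨fun k => k.trans e1, fun k => k.trans e1.symm⟩
            ⟨fun k => ?_, fun k => ?_⟩
          · have := k.trans e2
            rwa [Nat.ModEq, Nat.mod_eq_of_lt hrp] at this
          · refine Nat.ModEq.trans ?_ e2.symm
            rw [Nat.ModEq, k, Nat.mod_eq_of_lt hrp]
        rw [hiff]
        constructor
        · rintro ⟨⟨k1, k2⟩, k3⟩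
          exact ⟨⟨k1, k3⟩, fun q hq => k2 q (Finset.mem_insert_of_mem hq)⟩
        · rintro ⟨⟨k1, k3⟩, k2⟩
          refine ⟨⟨k1, fun q hq => ?_⟩, k3⟩
          rcases Finset.mem_insert.1 hq with rfl | hq
          · refine (dvd_eval_iff_of_modEq F (m := n) (n := r) ?_).2 hr'.2
            rw [Nat.ModEq, k3, Nat.mod_eq_of_lt hrp]
          · exact k2 q hq
      · intro n hn
        have hn' := (Finset.mem_filter.1 hn).2.2 p (Finset.mem_insert_self _ _)
        exact Finset.mem_coe.2 (Finset.mem_filter.2 ⟨Finset.mem_range.2 (Nat.mod_lt _ hpp.pos),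
          (dvd_eval_iff_of_modEq F (Nat.mod_modEq n p)).2 hn'⟩)
    have hb (r : ℕ) := ih (fun q hq => hT q (Finset.mem_insert_of_mem hq)) (Nat.mul_pos hA hpp.pos)
      (fun q hq => Nat.Coprime.mul_left (hc q (Finset.mem_insert_of_mem hq))
        ((Nat.coprime_primes hpp (hT q (Finset.mem_insert_of_mem hq))).2
          fun e => hp (e ▸ hq))) (u r)
    have hA0 : (A : ℝ) ≠ 0 := by exact_mod_cast hA.ne'
    have hp0 : (p : ℝ) ≠ 0 := by exact_mod_cast hpp.ne_zero
    rw [hcard, Finset.prod_insert hp, Finset.prod_insert hp, ← hRc]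
    push_cast
    rw [show (x₂ - x₁) / A * ((R.card : ℝ) / p * ∏ p ∈ T, (polyRho F p : ℝ) / p) =
      ∑ r ∈ R, (x₂ - x₁) / (A * p : ℕ) * ∏ p ∈ T, (polyRho F p : ℝ) / p by
        rw [Finset.sum_const, nsmul_eq_mul]
        push_cast
        field_simp, ← Finset.sum_sub_distrib]
    refine (Finset.abs_sum_le_sum_abs _ _).trans ((Finset.sum_le_sum fun r _ => hb r).trans ?_)
    rw [Finset.sum_const, nsmul_eq_mul]
    exact le_of_eq (by ring)

end

section

/-- The primes of the `i`-th dyadic block on the doubly logarithmic scale above `exp l`. -/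
noncomputable def block (l : ℝ) (i : ℕ) : Finset ℕ := primesLog (2 ^ i * l) (2 ^ (i + 1) * l)

theorem mem_block {l : ℝ} {i p : ℕ} :
    p ∈ block l i ↔ p.Prime ∧ 2 ^ i * l < Real.log p ∧ Real.log p ≤ 2 ^ (i + 1) * l := mem_primesLog

theorem disjoint_primesLog {a b c d : ℝ} (h : b ≤ c) :
    Disjoint (primesLog a b) (primesLog c d) := by
  rw [Finset.disjoint_left]
  intro p hp hq
  have h1 := (mem_primesLog.1 hp).2.2
  have h2 := (mem_primesLog.1 hq).2.1
  linarith

theorem primesLog_union {a b c : ℝ} (h : a ≤ b) (h' : b ≤ c) :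
    primesLog a b ∪ primesLog b c = primesLog a c := by
  ext p
  rw [Finset.mem_union, mem_primesLog, mem_primesLog, mem_primesLog]
  constructor
  · rintro (⟨h1, h2, h3⟩ | ⟨h1, h2, h3⟩)
    exacts [⟨h1, h2, h3.trans h'⟩, ⟨h1, h.trans_lt h2, h3⟩]
  · rintro ⟨h1, h2, h3⟩
    rcases le_or_gt (Real.log p) b with h4 | h4
    exacts [Or.inl ⟨h1, h2, h4⟩, Or.inr ⟨h1, h4, h3⟩]

theorem disjoint_block {l : ℝ} (hl : 0 ≤ l) {i j : ℕ} (hij : i < j) :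
    Disjoint (block l i) (block l j) :=
  disjoint_primesLog (mul_le_mul_of_nonneg_right (pow_le_pow_right₀ one_le_two hij) hl)

theorem biUnion_block {l : ℝ} (hl : 0 ≤ l) (n : ℕ) :
    (Finset.range n).biUnion (block l) = primesLog l (2 ^ n * l) := by
  induction n with
  | zero =>
    ext p
    simp only [Finset.range_zero, Finset.biUnion_empty, Finset.notMem_empty, pow_zero, one_mul,
      mem_primesLog, false_iff, not_and, not_le]
    exact fun _ h => h
  | succ n ih =>
    rw [Finset.range_add_one, Finset.biUnion_insert, ih, Finset.union_comm, block,
      primesLog_union]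
    · exact le_mul_of_one_le_left hl (one_le_pow₀ one_le_two)
    · exact mul_le_mul_of_nonneg_right (pow_le_pow_right₀ one_le_two n.le_succ) hl

theorem card_primesLog_le (a b : ℝ) : ((primesLog a b).card : ℝ) ≤ Real.exp b := by
  have h : primesLog a b ⊆ Finset.Icc 1 ⌊Real.exp b⌋₊ := by
    intro p hp
    obtain ⟨h1, _, h3⟩ := mem_primesLog.1 hp
    have hp0 : (0 : ℝ) < p := by exact_mod_cast h1.pos
    exact Finset.mem_Icc.2 ⟨h1.one_le, Nat.le_floor ((Real.log_le_iff_le_exp hp0).1 h3)⟩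
  have h1 := Finset.card_le_card h
  rw [Nat.card_Icc, Nat.add_sub_cancel] at h1
  exact (Nat.cast_le.2 h1).trans (Nat.floor_le (Real.exp_pos b).le)

theorem MertensWeight.le_exp {w : ℕ → ℝ} {g C : ℝ} (h : MertensWeight w g C) {a : ℝ} {p : ℕ}
    (hp : p.Prime) (ha : a ≤ Real.log p) : w p ≤ g * Real.exp (-a) := by
  have hp0 : (0 : ℝ) < p := by exact_mod_cast hp.pos
  have h1 := (Real.le_log_iff_exp_le hp0).1 ha
  refine (h.le_div p hp).trans ?_
  rw [Real.exp_neg, ← div_eq_mul_inv]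
  exact div_le_div_of_nonneg_left (by linarith [h.one_le]) (Real.exp_pos a) h1

theorem MertensWeight.abs_sum_block_sub_le {w : ℕ → ℝ} {g C : ℝ} (h : MertensWeight w g C)
    {l : ℝ} (hl : 0 < l) (i : ℕ) :
    |∑ p ∈ block l i, w p - Real.log 2| ≤ C / (2 ^ i * l) := by
  have h1 := h.abs_sum_sub_log_le (a := 2 ^ i * l) (b := 2 ^ (i + 1) * l) (by positivity)
    (mul_le_mul_of_nonneg_right (pow_le_pow_right₀ one_le_two i.le_succ) hl.le)
  rwa [show (2 : ℝ) ^ (i + 1) * l / (2 ^ i * l) = 2 by rw [pow_succ]; field_simp] at h1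

theorem MertensWeight.sum_block_le_one {w : ℕ → ℝ} {g C : ℝ} (h : MertensWeight w g C)
    {l : ℝ} (hl : 0 < l) (hC : 4 * C ≤ l) (i : ℕ) : ∑ p ∈ block l i, w p ≤ 1 := by
  have h1 := (abs_le.1 (h.abs_sum_block_sub_le hl i)).2
  have h2 : C / (2 ^ i * l) ≤ 1 / 4 := by
    have hp : (1 : ℝ) ≤ 2 ^ i := one_le_pow₀ one_le_two
    rw [div_le_iff₀ (by positivity)]
    nlinarith
  have := Real.log_two_lt_d9
  linarith

theorem exp_le_one_sub {t : ℝ} (h : t ≤ 1 / 2) : Real.exp (-t - 2 * t ^ 2) ≤ 1 - t := by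
  have h1 : 0 < 1 - t := by linarith
  rw [← Real.le_log_iff_exp_le h1]
  refine le_trans ?_ (Real.one_sub_inv_le_log_of_pos h1)
  have e : 1 - (1 - t)⁻¹ - (-t - 2 * t ^ 2) = t ^ 2 * (1 - 2 * t) / (1 - t) := by
    field_simp
    ring
  have : 0 ≤ t ^ 2 * (1 - 2 * t) / (1 - t) :=
    div_nonneg (mul_nonneg (sq_nonneg t) (by linarith)) h1.le
  linarith

theorem MertensWeight.le_prod_block {w : ℕ → ℝ} {g C : ℝ} (h : MertensWeight w g C)
    {l : ℝ} (hl : 1 ≤ l) (hC : 4 * C ≤ l) (hg : 2 * g ≤ l) (i : ℕ) :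
    1 / 2 * Real.exp (-((C + 2 * g) / (2 ^ i * l))) ≤ ∏ p ∈ block l i, (1 - w p) := by
  have hg1 := h.one_le
  have hp : (1 : ℝ) ≤ 2 ^ i := one_le_pow₀ one_le_two
  have hexp : Real.exp (-(2 ^ i * l)) ≤ 1 / (2 ^ i * l) := by
    rw [Real.exp_neg, ← one_div]
    exact one_div_le_one_div_of_le (by positivity) (by linarith [Real.add_one_le_exp (2 ^ i * l)])
  have hwp : ∀ p ∈ block l i, w p ≤ g / (2 ^ i * l) := fun p hp' => by
    refine (h.le_exp (mem_block.1 hp').1 (mem_block.1 hp').2.1.le).trans ?_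
    rw [div_eq_mul_one_div]
    exact mul_le_mul_of_nonneg_left hexp (by linarith)
  have hhalf : g / (2 ^ i * l) ≤ 1 / 2 := by
    rw [div_le_div_iff₀ (by positivity) (by norm_num)]
    nlinarith
  have hsum1 := h.sum_block_le_one (by linarith) hC i
  have hsum := (abs_le.1 (h.abs_sum_block_sub_le (l := l) (by linarith) i)).2
  have hsq : ∑ p ∈ block l i, w p ^ 2 ≤ g / (2 ^ i * l) := by
    calc ∑ p ∈ block l i, w p ^ 2 ≤ ∑ p ∈ block l i, g / (2 ^ i * l) * w p := by
          refine Finset.sum_le_sum fun p hp' => ?_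
          rw [sq]
          exact mul_le_mul_of_nonneg_right (hwp p hp') (h.nonneg p)
      _ = g / (2 ^ i * l) * ∑ p ∈ block l i, w p := (Finset.mul_sum _ _ _).symm
      _ ≤ g / (2 ^ i * l) * 1 := mul_le_mul_of_nonneg_left hsum1 (by positivity)
      _ = _ := mul_one _
  calc 1 / 2 * Real.exp (-((C + 2 * g) / (2 ^ i * l)))
      = Real.exp (-Real.log 2 + -((C + 2 * g) / (2 ^ i * l))) := by
        rw [Real.exp_add, Real.exp_neg (Real.log 2), Real.exp_log two_pos, one_div]
    _ ≤ Real.exp (∑ p ∈ block l i, (-w p - 2 * w p ^ 2)) := by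
        rw [Real.exp_le_exp, Finset.sum_sub_distrib, Finset.sum_neg_distrib, ← Finset.mul_sum]
        have e3 : (C + 2 * g) / (2 ^ i * l) = C / (2 ^ i * l) + 2 * (g / (2 ^ i * l)) := by ring
        linarith
    _ = ∏ p ∈ block l i, Real.exp (-w p - 2 * w p ^ 2) := Real.exp_sum _ _
    _ ≤ _ := Finset.prod_le_prod (fun p _ => (Real.exp_pos _).le) fun p hp' =>
        exp_le_one_sub ((hwp p hp').trans hhalf)

end

section

theorem eight_div_factorial_le {m : ℕ} (hm : 1 ≤ m) :
    8 / ((2 * m + 3).factorial : ℝ) ≤ (1 / 4) ^ m := by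
  have h : 8 * 4 ^ m ≤ (2 * m + 3).factorial := by
    induction m, hm using Nat.le_induction with
    | base => decide
    | succ m hm ih =>
      rw [show 2 * (m + 1) + 3 = (2 * m + 4) + 1 by ring, Nat.factorial_succ, Nat.factorial_succ,
        pow_succ]
      have : 4 * (2 * m + 3).factorial ≤ (2 * m + 4 + 1) * ((2 * m + 3 + 1) *
          (2 * m + 3).factorial) := by
        rw [← mul_assoc]
        exact Nat.mul_le_mul_right _ (by nlinarith)
      linarith
  have h' : (8 : ℝ) * 4 ^ m ≤ (2 * m + 3).factorial := by exact_mod_cast h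
  rw [one_div_pow, div_le_div_iff₀ (by positivity) (by positivity)]
  linarith

theorem sum_quarter_pow_le (n : ℕ) : ∑ i ∈ Finset.range n, (1 / 4 : ℝ) ^ (n - i) ≤ 1 / 3 := by
  induction n with
  | zero => norm_num
  | succ n ih =>
    have e : ∑ i ∈ Finset.range (n + 1), (1 / 4 : ℝ) ^ (n + 1 - i) =
        1 / 4 * (∑ i ∈ Finset.range n, (1 / 4 : ℝ) ^ (n - i) + 1) := by
      rw [Finset.sum_range_succ, mul_add, Finset.mul_sum]
      congr 1
      · refine Finset.sum_congr rfl fun i hi => ?_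
        rw [Nat.sub_add_comm (Finset.mem_range.1 hi).le, pow_succ']
      · simp
    rw [e]
    linarith

theorem sum_level_mul_two_pow_le (n : ℕ) :
    ∑ i ∈ Finset.range n, (2 * ((n - i : ℕ) : ℝ) + 3) * 2 ^ (i + 1) ≤ 14 * 2 ^ n := by
  suffices h : ∑ i ∈ Finset.range n, (2 * ((n - i : ℕ) : ℝ) + 3) * 2 ^ (i + 1) =
      14 * 2 ^ n - 4 * n - 14 by
    rw [h]
    have : (0 : ℝ) ≤ n := n.cast_nonneg
    linarith
  induction n with
  | zero => norm_num
  | succ n ih =>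
    rw [Finset.sum_range_succ']
    have e : ∑ i ∈ Finset.range n, (2 * ((n + 1 - (i + 1) : ℕ) : ℝ) + 3) * 2 ^ (i + 1 + 1) =
        2 * ∑ i ∈ Finset.range n, (2 * ((n - i : ℕ) : ℝ) + 3) * 2 ^ (i + 1) := by
      rw [Finset.mul_sum]
      refine Finset.sum_congr rfl fun i _ => ?_
      rw [Nat.add_sub_add_right, pow_succ (2 : ℝ) (i + 1)]
      ring
    rw [e, ih, Nat.sub_zero, pow_succ]
    push_cast
    ring

/-- Lower bound for the number of `k` in a progression for which `F k` is divisible by all of `T`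
and by none of the remaining primes of `n` dyadic blocks. -/
theorem exists_sifted_count_le {F : Polynomial ℤ} {g C : ℝ}
    (hW : MertensWeight (fun p => (polyRho F p : ℝ) / p) g C) :
    ∃ l₀ c K : ℝ, 0 < c ∧ 0 < K ∧ 1 ≤ l₀ ∧ ∀ l : ℝ, l₀ ≤ l → ∀ (n : ℕ) (T : Finset ℕ) (A v : ℕ)
      (x₁ x₂ : ℝ), 0 ≤ x₁ → x₁ ≤ x₂ → 0 < A → (∀ p ∈ T, p.Prime) → (∀ p ∈ T, A.Coprime p) →
      (∀ p ∈ primesLog l (2 ^ n * l), A.Coprime p) →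
      c * ((x₂ - x₁) / A * ∏ p ∈ T, (polyRho F p : ℝ) / p) / 2 ^ n -
        g ^ T.card * Real.exp (K * (2 ^ n * l)) ≤
      (((Finset.Ioc ⌊x₁⌋₊ ⌊x₂⌋₊).filter fun k => (k ≡ v [MOD A] ∧
        ∀ p ∈ T, (p : ℤ) ∣ F.eval (k : ℤ)) ∧
        ∀ p ∈ primesLog l (2 ^ n * l) \ T, ¬ (p : ℤ) ∣ F.eval (k : ℤ)).card : ℝ) := by
  have hg1 := hW.one_le
  have hC0 := hW.C_pos
  refine ⟨1 + 4 * C + 2 * g, Real.exp (-2) / 2, 14 * (1 + g) + 2, by positivity, by positivity,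
    by linarith, ?_⟩
  intro l hl n T A v x₁ x₂ h0 h12 hA hT hcT hcl
  set w : ℕ → ℝ := fun p => (polyRho F p : ℝ) / p with hw
  have hl1 : 1 ≤ l := by linarith
  set B : ℕ → Finset ℕ := fun i => block l i \ T with hB
  set k : ℕ → ℕ := fun i => n - i + 1 with hk
  have hBu : (Finset.range n).biUnion B = primesLog l (2 ^ n * l) \ T := by
    rw [← biUnion_block (by linarith : 0 ≤ l)]
    ext p
    simp only [hB, Finset.mem_biUnion, Finset.mem_sdiff]
    constructor
    · rintro ⟨i, h1, h2, h3⟩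
      exact ⟨⟨i, h1, h2⟩, h3⟩
    · rintro ⟨⟨i, h1, h2⟩, h3⟩
      exact ⟨i, h1, h2, h3⟩
  have hrho : ∀ p : ℕ, p.Prime → (polyRho F p : ℝ) ≤ g := fun p hp => by
    have h := hW.le_div p hp
    have hp0 : (0 : ℝ) < p := by exact_mod_cast hp.pos
    rwa [div_le_div_iff_of_pos_right hp0] at h
  have hVle (i : ℕ) : ∏ p ∈ block l i, (1 - w p) ≤ ∏ p ∈ B i, (1 - w p) := by
    rw [← Finset.prod_inter_mul_prod_sdiff (block l i) T]
    refine mul_le_of_le_one_left (Finset.prod_nonneg fun p _ => sub_nonneg.2 (hW.le_one p)) ?_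
    exact Finset.prod_le_one (fun p _ => sub_nonneg.2 (hW.le_one p))
      fun p _ => sub_le_self _ (hW.nonneg p)
  have hfrac (i : ℕ) : (C + 2 * g) / (2 ^ i * l) ≤ (1 / 2) ^ i := by
    rw [one_div_pow, div_le_div_iff₀ (by positivity) (by positivity), mul_comm, one_mul]
    exact mul_le_mul_of_nonneg_left (by linarith) (by positivity)
  have hV (i : ℕ) : 1 / 2 * Real.exp (-(1 / 2) ^ i) ≤ ∏ p ∈ B i, (1 - w p) := by
    refine le_trans ?_ ((hW.le_prod_block hl1 (by linarith) (by linarith) i).trans (hVle i))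
    refine mul_le_mul_of_nonneg_left (Real.exp_le_exp.2 (neg_le_neg (hfrac i))) (by norm_num)
  have hV8 (i : ℕ) : 1 / 8 ≤ ∏ p ∈ B i, (1 - w p) := by
    refine le_trans ?_ (hV i)
    have h1 : (1 / 2 : ℝ) ^ i ≤ 1 := pow_le_one₀ (by norm_num) (by norm_num)
    have h2 : Real.exp (-1) ≤ Real.exp (-(1 / 2) ^ i) := Real.exp_le_exp.2 (neg_le_neg h1)
    have h3 : 1 / 4 ≤ Real.exp (-1) := by
      rw [Real.exp_neg, ← one_div]
      exact one_div_le_one_div_of_le (Real.exp_pos 1) (by linarith [Real.exp_one_lt_d9])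
    linarith
  have hprod : Real.exp (-2) / 2 ^ n ≤ ∏ i ∈ Finset.range n, ∏ p ∈ B i, (1 - w p) := by
    calc Real.exp (-2) / 2 ^ n
        ≤ (1 / 2) ^ n * Real.exp (∑ i ∈ Finset.range n, -(1 / 2) ^ i) := by
          rw [div_eq_mul_one_div, mul_comm, one_div_pow]
          refine mul_le_mul_of_nonneg_left (Real.exp_le_exp.2 ?_) (by positivity)
          rw [Finset.sum_neg_distrib, neg_le_neg_iff]
          exact sum_geometric_two_le n
      _ = ∏ i ∈ Finset.range n, (1 / 2 * Real.exp (-(1 / 2) ^ i)) := by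
          rw [Finset.prod_mul_distrib, Finset.prod_const, Finset.card_range, Real.exp_sum]
      _ ≤ _ := Finset.prod_le_prod (fun i _ => by positivity) fun i _ => hV i
  have hsum : ∑ i ∈ Finset.range n, esym (B i) w (2 * k i + 1) / ∏ p ∈ B i, (1 - w p) ≤ 1 / 2 := by
    refine (Finset.sum_le_sum fun i hi => ?_).trans ((sum_quarter_pow_le n).trans (by norm_num))
    have hi' := Finset.mem_range.1 hi
    refine le_trans ?_ (eight_div_factorial_le (m := n - i) (by omega))
    have hr : 2 * k i + 1 = 2 * (n - i) + 3 := by simp only [hk]; ring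
    have h1 : esym (B i) w (2 * k i + 1) ≤ 1 / ((2 * (n - i) + 3).factorial : ℝ) := by
      rw [hr]
      refine (esym_le hW.nonneg _).trans ?_
      refine div_le_div_of_nonneg_right (pow_le_one₀ (Finset.sum_nonneg fun p _ => hW.nonneg p) ?_)
        (by positivity)
      refine le_trans ?_ (hW.sum_block_le_one (l := l) (by linarith) (by linarith) i)
      exact Finset.sum_le_sum_of_subset_of_nonneg Finset.sdiff_subset fun p _ _ => hW.nonneg p
    refine (div_le_div₀ (by positivity) h1 (by norm_num) (hV8 i)).trans (le_of_eq ?_)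
    ring
  have hN : 0 ≤ (x₂ - x₁) / A * ∏ p ∈ T, w p :=
    mul_nonneg (div_nonneg (by linarith) (by positivity)) (Finset.prod_nonneg fun p _ => hW.nonneg p)
  have hmain := sieve_lower (g := g) (by linarith) B k
    (fun i j hij => Finset.disjoint_of_subset_left Finset.sdiff_subset
      (Finset.disjoint_of_subset_right Finset.sdiff_subset (disjoint_block (by linarith) hij)))
    n ((Finset.Ioc ⌊x₁⌋₊ ⌊x₂⌋₊).filter fun k => k ≡ v [MOD A] ∧
        ∀ p ∈ T, (p : ℤ) ∣ F.eval (k : ℤ)) (fun p k => (p : ℤ) ∣ F.eval (k : ℤ)) (w := w)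
    hW.nonneg hW.le_one hN (E := 2 * g ^ T.card) (by positivity) ?_
    (fun i _ => lt_of_lt_of_le (by norm_num) (hV8 i)) hsum
  · rw [Finset.filter_filter, hBu] at hmain
    refine (sub_le_sub ?_ ?_).trans (hmain.trans (le_of_eq (by congr!)))
    · rw [show Real.exp (-2) / 2 * ((x₂ - x₁) / A * ∏ p ∈ T, w p) / 2 ^ n =
        ((x₂ - x₁) / A * ∏ p ∈ T, w p) / 2 * (Real.exp (-2) / 2 ^ n) by ring]
      exact mul_le_mul_of_nonneg_left hprod (by linarith)
    · have hb : ∏ i ∈ Finset.range n, (1 + g * ((B i).card : ℝ)) ^ (2 * k i + 1) ≤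
          Real.exp (14 * (1 + g) * (2 ^ n * l)) := by
        calc _ ≤ ∏ i ∈ Finset.range n,
              Real.exp ((1 + g) * l * ((2 * ((n - i : ℕ) : ℝ) + 3) * 2 ^ (i + 1))) := by
              refine Finset.prod_le_prod (fun i _ => by positivity) fun i _ => ?_
              have hcard : ((B i).card : ℝ) ≤ Real.exp (2 ^ (i + 1) * l) :=
                (Nat.cast_le.2 (Finset.card_le_card Finset.sdiff_subset)).trans
                  (card_primesLog_le _ _)
              have ht : 1 ≤ 2 ^ (i + 1) * l :=
                one_le_mul_of_one_le_of_one_le (one_le_pow₀ one_le_two) hl1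
              have h1 : 1 + g * ((B i).card : ℝ) ≤ Real.exp ((1 + g) * (2 ^ (i + 1) * l)) := by
                have h2 := Real.add_one_le_exp (g * (2 ^ (i + 1) * l))
                have h3 : 1 ≤ Real.exp (2 ^ (i + 1) * l) := Real.one_le_exp (by linarith)
                rw [add_mul, one_mul, Real.exp_add]
                have h4 : 1 + g ≤ Real.exp (g * (2 ^ (i + 1) * l)) := by nlinarith
                have h5 := mul_le_mul_of_nonneg_left h4 (by linarith : 0 ≤ Real.exp (2 ^ (i + 1) * l))
                nlinarith [mul_le_mul_of_nonneg_left hcard (by linarith : 0 ≤ g)]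
              refine (pow_le_pow_left₀ (by positivity) h1 _).trans (le_of_eq ?_)
              rw [← Real.exp_nat_mul]
              congr 1
              simp only [hk]
              push_cast
              ring
          _ = Real.exp ((1 + g) * l * ∑ i ∈ Finset.range n,
                (2 * ((n - i : ℕ) : ℝ) + 3) * 2 ^ (i + 1)) := by
              rw [← Real.exp_sum, Finset.mul_sum]
          _ ≤ _ := by
              rw [Real.exp_le_exp]
              refine (mul_le_mul_of_nonneg_left (sum_level_mul_two_pow_le n)
                (by positivity)).trans (le_of_eq (by ring))
      have h2 : (2 : ℝ) ^ n ≤ Real.exp (2 ^ n * l) := by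
        have := Real.add_one_le_exp (2 ^ n * l)
        have : (2 : ℝ) ^ n ≤ 2 ^ n * l := le_mul_of_one_le_right (by positivity) hl1
        linarith
      have h3 : (2 : ℝ) ≤ Real.exp (2 ^ n * l) := by
        have := Real.add_one_le_exp (2 ^ n * l)
        have : (1 : ℝ) ≤ 2 ^ n * l := one_le_mul_of_one_le_of_one_le (one_le_pow₀ one_le_two) hl1
        linarith
      calc _ ≤ 2 * g ^ T.card * (Real.exp (2 ^ n * l) * Real.exp (14 * (1 + g) * (2 ^ n * l))) := by
            refine mul_le_mul_of_nonneg_left (mul_le_mul h2 hb ?_ (by positivity)) (by positivity)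
            exact Finset.prod_nonneg fun i _ => by positivity
        _ = g ^ T.card * (2 * (Real.exp (2 ^ n * l) * Real.exp (14 * (1 + g) * (2 ^ n * l)))) := by
            ring
        _ ≤ g ^ T.card * (Real.exp (2 ^ n * l) *
              (Real.exp (2 ^ n * l) * Real.exp (14 * (1 + g) * (2 ^ n * l)))) := by
            gcongr
        _ = _ := by
            rw [← Real.exp_add, ← Real.exp_add]
            congr 2
            ring
  · intro m hm
    rw [hBu] at hm
    have hdis : Disjoint T m := (Finset.disjoint_of_subset_left hm Finset.sdiff_disjoint).symm
    have hmp : ∀ p ∈ m, p.Prime := fun p hp =>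
      (mem_primesLog.1 (Finset.mem_sdiff.1 (hm hp)).1).1
    have h := abs_card_modEq_dvd_sub_le F h0 h12 (T ∪ m)
      (fun p hp => (Finset.mem_union.1 hp).elim (hT p) (hmp p)) hA
      (fun p hp => (Finset.mem_union.1 hp).elim (hcT p)
        fun h => hcl p (Finset.mem_sdiff.1 (hm h)).1) v
    rw [Finset.prod_union hdis, Finset.prod_union hdis, ← mul_assoc ((x₂ - x₁) / A)] at h
    rw [Finset.filter_filter]
    refine le_trans (le_of_eq ?_) (h.trans ?_)
    · congr 3
      refine congrArg Finset.card ?_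
      ext a
      simp only [Finset.mem_filter, Finset.mem_union, or_imp, forall_and, and_assoc]
    rw [mul_assoc]
    have hpow : ∀ S : Finset ℕ, (∀ p ∈ S, p.Prime) →
        ∏ p ∈ S, (polyRho F p : ℝ) ≤ g ^ S.card := fun S hS => by
      rw [← Finset.prod_const]
      exact Finset.prod_le_prod (fun p _ => by positivity) fun p hp => hrho p (hS p hp)
    refine mul_le_mul_of_nonneg_left ?_ (by norm_num)
    exact mul_le_mul (hpow T hT) (hpow m hmp) (Finset.prod_nonneg fun p _ => by positivity)
      (by positivity)

end

section

theorem sum_powersetCard_union {A B : Finset ℕ} (h : Disjoint A B) (m : ℕ) (f : Finset ℕ → ℝ) :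
    ∑ S ∈ (A ∪ B).powersetCard m, f S = ∑ p ∈ Finset.HasAntidiagonal.antidiagonal m,
      ∑ U ∈ B.powersetCard p.1, ∑ V ∈ A.powersetCard p.2, f (U ∪ V) := by
  simp only [← Finset.sum_product']
  rw [Finset.sum_sigma']
  have hAB : ∀ U ⊆ B, ∀ V ⊆ A, (U ∪ V) ∩ B = U ∧ (U ∪ V) ∩ A = V := by
    intro U hU V hV
    have h1 : V ∩ B = ∅ := Finset.disjoint_iff_inter_eq_empty.1
      (Finset.disjoint_of_subset_left hV h)
    have h2 : U ∩ A = ∅ := Finset.disjoint_iff_inter_eq_empty.1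
      (Finset.disjoint_of_subset_left hU h.symm)
    rw [Finset.union_inter_distrib_right, Finset.union_inter_distrib_right, h1, h2,
      Finset.inter_eq_left.2 hU, Finset.inter_eq_left.2 hV, Finset.union_empty,
      Finset.empty_union]
    exact ⟨rfl, rfl⟩
  have hS : ∀ S ⊆ A ∪ B, S ∩ B ∪ S ∩ A = S := fun S hS => by
    rw [← Finset.inter_union_distrib_left, Finset.union_comm B A, Finset.inter_eq_left.2 hS]
  refine Finset.sum_bij' (fun S _ => ⟨((S ∩ B).card, (S ∩ A).card), (S ∩ B, S ∩ A)⟩)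
    (fun a _ => a.2.1 ∪ a.2.2) ?_ ?_ ?_ ?_ ?_
  · intro S hS'
    obtain ⟨h1, h2⟩ := Finset.mem_powersetCard.1 hS'
    simp only [Finset.mem_sigma, Finset.HasAntidiagonal.mem_antidiagonal, Finset.mem_product,
      Finset.mem_powersetCard, Finset.inter_subset_right, and_true]
    rw [← Finset.card_union_of_disjoint, hS S h1, h2]
    exact (Finset.disjoint_of_subset_left Finset.inter_subset_right
      (Finset.disjoint_of_subset_right Finset.inter_subset_right h.symm))
  · rintro ⟨⟨i, k⟩, U, V⟩ ha
    simp only [Finset.mem_sigma, Finset.HasAntidiagonal.mem_antidiagonal, Finset.mem_product,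
      Finset.mem_powersetCard] at ha ⊢
    obtain ⟨h1, ⟨h2, h3⟩, h4, h5⟩ := ha
    refine ⟨Finset.union_subset (h2.trans Finset.subset_union_right)
      (h4.trans Finset.subset_union_left), ?_⟩
    rw [Finset.card_union_of_disjoint, h3, h5, h1]
    exact Finset.disjoint_of_subset_left h2 (Finset.disjoint_of_subset_right h4 h.symm)
  · intro S hS'
    exact hS S (Finset.mem_powersetCard.1 hS').1
  · rintro ⟨⟨i, k⟩, U, V⟩ ha
    simp only [Finset.mem_sigma, Finset.HasAntidiagonal.mem_antidiagonal, Finset.mem_product,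
      Finset.mem_powersetCard] at ha ⊢
    obtain ⟨h1, ⟨h2, h3⟩, h4, h5⟩ := ha
    obtain ⟨e1, e2⟩ := hAB U h2 V h4
    rw [e1, e2, h3, h5]
  · intro S hS'
    dsimp only
    rw [hS S (Finset.mem_powersetCard.1 hS').1]

/-- The `m`-element sets of primes in the first `J` blocks having at most `j` elements in the
first `j` blocks for all `j ≤ J`. -/
noncomputable def pathSets (l : ℝ) (J m : ℕ) : Finset (Finset ℕ) :=
  ((primesLog l (2 ^ J * l)).powersetCard m).filter fun S =>
    ∀ j ≤ J, (S ∩ primesLog l (2 ^ j * l)).card ≤ j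

theorem mem_pathSets {l : ℝ} {J m : ℕ} {S : Finset ℕ} : S ∈ pathSets l J m ↔
    (S ⊆ primesLog l (2 ^ J * l) ∧ S.card = m) ∧
      ∀ j ≤ J, (S ∩ primesLog l (2 ^ j * l)).card ≤ j := by
  rw [pathSets, Finset.mem_filter, Finset.mem_powersetCard]

/-- The sum of the products of `a` over `pathSets`. -/
noncomputable def pathSum (a : ℕ → ℝ) (l : ℝ) (J m : ℕ) : ℝ :=
  ∑ S ∈ pathSets l J m, ∏ p ∈ S, a p

theorem pathSum_nonneg {a : ℕ → ℝ} (ha : ∀ p, 0 ≤ a p) (l : ℝ) (J m : ℕ) :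
    0 ≤ pathSum a l J m :=
  Finset.sum_nonneg fun _ _ => Finset.prod_nonneg fun p _ => ha p

theorem pathSum_eq_zero (a : ℕ → ℝ) (l : ℝ) {J m : ℕ} (h : J < m) : pathSum a l J m = 0 := by
  rw [pathSum]
  refine Finset.sum_eq_zero fun S hS => ?_
  obtain ⟨⟨h1, h2⟩, h3⟩ := mem_pathSets.1 hS
  have := h3 J le_rfl
  rw [Finset.inter_eq_left.2 h1] at this
  omega

theorem pathSum_zero (a : ℕ → ℝ) (l : ℝ) (m : ℕ) :
    pathSum a l 0 m = if m = 0 then 1 else 0 := by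
  split_ifs with h
  · subst h
    have : pathSets l 0 0 = {∅} := by
      ext S
      rw [mem_pathSets, Finset.mem_singleton]
      constructor
      · exact fun h => Finset.card_eq_zero.1 h.1.2
      · rintro rfl
        simp
    rw [pathSum, this]
    simp
  · exact pathSum_eq_zero a l (Nat.pos_of_ne_zero h)

theorem primesLog_mono {l : ℝ} (hl : 0 ≤ l) {i j : ℕ} (h : i ≤ j) :
    primesLog l (2 ^ i * l) ⊆ primesLog l (2 ^ j * l) := by
  intro p hp
  obtain ⟨h1, h2, h3⟩ := mem_primesLog.1 hp
  exact mem_primesLog.2 ⟨h1, h2, h3.trans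
    (mul_le_mul_of_nonneg_right (pow_le_pow_right₀ one_le_two h) hl)⟩

theorem primesLog_succ {l : ℝ} (hl : 0 ≤ l) (J : ℕ) :
    primesLog l (2 ^ (J + 1) * l) = primesLog l (2 ^ J * l) ∪ block l J :=
  (primesLog_union (le_mul_of_one_le_left hl (one_le_pow₀ one_le_two))
    (mul_le_mul_of_nonneg_right (pow_le_pow_right₀ one_le_two J.le_succ) hl)).symm

theorem pathSum_succ (a : ℕ → ℝ) {l : ℝ} (hl : 0 ≤ l) {J m : ℕ} (hm : m ≤ J + 1) :
    pathSum a l (J + 1) m = ∑ p ∈ Finset.HasAntidiagonal.antidiagonal m,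
      esym (block l J) a p.1 * pathSum a l J p.2 := by
  have hd : Disjoint (primesLog l (2 ^ J * l)) (block l J) := disjoint_primesLog le_rfl
  rw [pathSum, pathSets, Finset.sum_filter, primesLog_succ hl, sum_powersetCard_union hd]
  refine Finset.sum_congr rfl fun q hq => ?_
  rw [esym, pathSum, pathSets, Finset.sum_filter, Finset.sum_mul_sum]
  refine Finset.sum_congr rfl fun U hU => Finset.sum_congr rfl fun V hV => ?_
  obtain ⟨hU1, hU2⟩ := Finset.mem_powersetCard.1 hU
  obtain ⟨hV1, hV2⟩ := Finset.mem_powersetCard.1 hV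
  have hUV : Disjoint U V :=
    Finset.disjoint_of_subset_left hU1 (Finset.disjoint_of_subset_right hV1 hd.symm)
  rw [Finset.prod_union hUV, mul_ite, mul_zero]
  refine if_congr ⟨fun h j hj => ?_, fun h j hj => ?_⟩ rfl rfl
  · exact (Finset.card_le_card (Finset.inter_subset_inter_right Finset.subset_union_right)).trans
      (h j (by omega))
  · rcases hj.lt_or_eq with hj | rfl
    · have hj' : j ≤ J := by omega
      have : U ∩ primesLog l (2 ^ j * l) = ∅ := Finset.disjoint_iff_inter_eq_empty.1
        (Finset.disjoint_of_subset_left hU1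
          (Finset.disjoint_of_subset_right (primesLog_mono hl hj') hd.symm))
      rw [Finset.union_inter_distrib_right, this, Finset.empty_union]
      exact h j hj'
    · refine (Finset.card_le_card Finset.inter_subset_left).trans ?_
      rw [Finset.card_union_of_disjoint hUV, hU2, hV2, Finset.HasAntidiagonal.mem_antidiagonal.1 hq]
      exact hm

theorem esym_smul {D : Finset ℕ} {a w : ℕ → ℝ} {t : ℝ} (h : ∀ p ∈ D, a p = t * w p) (r : ℕ) :
    esym D a r = t ^ r * esym D w r := by
  rw [esym, esym, Finset.mul_sum]
  refine Finset.sum_congr rfl fun S hS => ?_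
  obtain ⟨h1, h2⟩ := Finset.mem_powersetCard.1 hS
  rw [Finset.prod_congr rfl fun p hp => h p (h1 hp), Finset.prod_mul_distrib, Finset.prod_const, h2]

theorem sum_succ_mul_half_pow_le (J : ℕ) :
    ∑ l ∈ Finset.range J, ((l : ℝ) + 1) * (1 / 2) ^ (l + 1) ≤ 2 := by
  suffices h : ∑ l ∈ Finset.range J, ((l : ℝ) + 1) * (1 / 2) ^ (l + 1) =
      2 - (J + 2) * (1 / 2) ^ J by
    rw [h]
    have : (0 : ℝ) ≤ (J + 2) * (1 / 2) ^ J := by positivity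
    linarith
  induction J with
  | zero => norm_num
  | succ J ih =>
    rw [Finset.sum_range_succ, ih, pow_succ]
    push_cast
    ring

theorem MertensWeight.pathSum_le {w : ℕ → ℝ} {g C : ℝ} (h : MertensWeight w g C) {l : ℝ}
    (hl : 0 < l) (hC : 4 * (C + 2 * g) ≤ l) {a : ℕ → ℝ} {t : ℕ → ℝ} {N : ℕ} (ht : ∀ j, 0 ≤ t j)
    (ha0 : ∀ p, 0 ≤ a p) (ha : ∀ j < N, ∀ p ∈ block l j, a p = t j * w p) (m : ℕ) :
    pathSum a l N m ≤ Real.exp 2 * (Real.log 2 ^ m * pathWt t N m) := by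
  have hlog := Real.log_two_gt_d9
  have hg := h.one_le
  have h1 := le_prod_mul_pathWt (Z := pathSum a l) (e := fun J i => esym (block l J) a i)
    (x := fun j => Real.log 2 * t j) (ε := fun j => (1 / 2) ^ (j + 1)) (N := N)
    (fun j => mul_nonneg (by linarith) (ht j)) (fun j => by positivity) (pathSum_nonneg ha0 l)
    (fun m => (pathSum_zero a l m).le) (fun J m hJ => pathSum_eq_zero a l hJ)
    (fun J m _ hm => (pathSum_succ a hl.le hm).le) (fun J i hJ _ => by
      rw [esym_smul (ha J hJ)]
      have h2 := esym_le (D := block l J) h.nonneg i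
      have h3 := (abs_le.1 (h.abs_sum_block_sub_le hl J)).2
      have h4 : C / (2 ^ J * l) ≤ Real.log 2 * (1 / 2) ^ (J + 1) := by
        have h5 : C / (2 ^ J * l) ≤ 1 / 4 * (1 / 2) ^ J := by
          rw [div_le_iff₀ (by positivity),
            show (1 : ℝ) / 4 * (1 / 2) ^ J * (2 ^ J * l) = 1 / 4 * l * (1 / 2 * 2) ^ J by
              rw [mul_pow]; ring]
          norm_num
          linarith
        have : (0 : ℝ) < (1 / 2) ^ J := by positivity
        rw [pow_succ]
        nlinarith
      have h5 : ∑ p ∈ block l J, w p ≤ (1 + (1 / 2) ^ (J + 1)) * Real.log 2 := by linarith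
      calc t J ^ i * esym (block l J) w i
          ≤ t J ^ i * (((1 + (1 / 2) ^ (J + 1)) * Real.log 2) ^ i / (i.factorial : ℝ)) := by
            refine mul_le_mul_of_nonneg_left (h2.trans ?_) (pow_nonneg (ht J) i)
            gcongr
            exact Finset.sum_nonneg fun p _ => h.nonneg p
        _ = _ := by
            rw [mul_pow, mul_pow]
            ring) N m le_rfl
  rw [pathWt_smul] at h1
  refine h1.trans (mul_le_mul_of_nonneg_right ?_
    (mul_nonneg (pow_nonneg (by linarith) m) (pathWt_nonneg ht N m)))
  calc ∏ l ∈ Finset.range N, (1 + (1 / 2 : ℝ) ^ (l + 1)) ^ (l + 1)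
      ≤ ∏ l ∈ Finset.range N, Real.exp (((l : ℝ) + 1) * (1 / 2) ^ (l + 1)) := by
        refine Finset.prod_le_prod (fun i _ => by positivity) fun i _ => ?_
        have := Real.add_one_le_exp ((1 / 2 : ℝ) ^ (i + 1))
        refine (pow_le_pow_left₀ (by positivity) (by linarith :
          1 + (1 / 2 : ℝ) ^ (i + 1) ≤ Real.exp ((1 / 2) ^ (i + 1))) _).trans (le_of_eq ?_)
        rw [← Real.exp_nat_mul]
        push_cast
        rfl
    _ = Real.exp (∑ l ∈ Finset.range N, ((l : ℝ) + 1) * (1 / 2) ^ (l + 1)) :=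
        (Real.exp_sum _ _).symm
    _ ≤ Real.exp 2 := Real.exp_le_exp.2 (sum_succ_mul_half_pow_le N)

theorem le_factorial_mul_esym {D : Finset ℕ} {x : ℕ → ℝ} (hx : ∀ p, 0 ≤ x p) {M B : ℝ}
    (hM0 : 0 ≤ M) (hM : ∀ p ∈ D, x p ≤ M) (hB : 0 ≤ B) {N : ℕ}
    (hs : B + N * M ≤ ∑ p ∈ D, x p) (i : ℕ) (hi : i ≤ N + 1) :
    B ^ i / (i.factorial : ℝ) ≤ esym D x i := by
  induction i with
  | zero => simp [esym_zero]
  | succ i ih =>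
    have h1 := ih (by omega)
    have h2 := le_succ_mul_esym_succ hx hM i
    have h3 : (i : ℝ) ≤ N := by exact_mod_cast (by omega : i ≤ N)
    have h4 : B ≤ ∑ p ∈ D, x p - i * M := by nlinarith
    have h5 : B * (B ^ i / (i.factorial : ℝ)) ≤ (i + 1) * esym D x (i + 1) :=
      (mul_le_mul h4 h1 (by positivity) (hB.trans h4)).trans h2
    rw [Nat.factorial_succ, Nat.cast_mul, div_le_iff₀ (by positivity)]
    have h6 : (i.factorial : ℝ) ≠ 0 := by positivity
    calc B ^ (i + 1) = B * (B ^ i / (i.factorial : ℝ)) * i.factorial := by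
          rw [mul_assoc, div_mul_cancel₀ _ h6, pow_succ']
      _ ≤ (i + 1) * esym D x (i + 1) * i.factorial :=
          mul_le_mul_of_nonneg_right h5 (by positivity)
      _ = _ := by push_cast; ring

theorem MertensWeight.le_pathSum {w : ℕ → ℝ} {g C : ℝ} (h : MertensWeight w g C) {l : ℝ}
    (hl : 1 ≤ l) (hC : 4 * (C + 2 * g) ≤ l) (N m : ℕ) :
    Real.exp (-4) * (Real.log 2 ^ m * pathWt (fun _ => 1) N m) ≤ pathSum w l N m := by
  have hlog := Real.log_two_gt_d9
  have hg := h.one_le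
  have h1 := prod_mul_pathWt_le (Z := pathSum w l) (e := fun J i => esym (block l J) w i)
    (x := fun j => Real.log 2 * 1) (ε := fun j => (1 / 2) ^ (j + 1)) (N := N)
    (fun j => by linarith) (fun j => ⟨by positivity, pow_le_one₀ (by norm_num) (by norm_num)⟩)
    (pathSum_nonneg h.nonneg l)
    (by simp [pathSum_zero])
    (fun J m _ hm => (pathSum_succ w (by linarith) hm).ge) (fun J i _ hi => by
      have hM : ∀ p ∈ block l J, w p ≤ g * Real.exp (-(2 ^ J * l)) := fun p hp =>
        h.le_exp (mem_block.1 hp).1 (mem_block.1 hp).2.1.le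
      have h3 := (abs_le.1 (h.abs_sum_block_sub_le (l := l) (by linarith) J)).1
      have h4 : (J : ℝ) * (g * Real.exp (-(2 ^ J * l))) ≤ 2 * g / (2 ^ J * l) := by
        have e1 := Real.quadratic_le_exp_of_nonneg (by positivity : (0 : ℝ) ≤ 2 ^ J * l)
        have e2 : (J : ℝ) ≤ 2 ^ J * l := by
          have : (J : ℝ) ≤ 2 ^ J := by exact_mod_cast Nat.lt_two_pow_self.le
          nlinarith [pow_pos (two_pos : (0 : ℝ) < 2) J]
        rw [Real.exp_neg, ← div_eq_mul_inv, ← mul_div_assoc, div_le_div_iff₀ (Real.exp_pos _)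
          (by positivity)]
        have e3 : (J : ℝ) * (2 ^ J * l) ≤ (2 ^ J * l) ^ 2 := by
          rw [sq]; exact mul_le_mul_of_nonneg_right e2 (by positivity)
        have e4 : (J : ℝ) * (2 ^ J * l) ≤ 2 * Real.exp (2 ^ J * l) := by
          have : (0 : ℝ) ≤ 2 ^ J * l := by positivity
          linarith
        nlinarith
      have h5 : (C + 2 * g) / (2 ^ J * l) ≤ Real.log 2 * (1 / 2) ^ (J + 1) := by
        have h5 : (C + 2 * g) / (2 ^ J * l) ≤ 1 / 4 * (1 / 2) ^ J := by
          rw [div_le_iff₀ (by positivity),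
            show (1 : ℝ) / 4 * (1 / 2) ^ J * (2 ^ J * l) = 1 / 4 * l * (1 / 2 * 2) ^ J by
              rw [mul_pow]; ring]
          norm_num
          linarith
        have : (0 : ℝ) < (1 / 2) ^ J := by positivity
        rw [pow_succ]
        nlinarith
      rw [add_div] at h5
      have h6 : (1 / 2 : ℝ) ^ (J + 1) ≤ 1 := pow_le_one₀ (by norm_num) (by norm_num)
      have h7 := le_factorial_mul_esym (D := block l J) h.nonneg (by positivity) hM
        (B := (1 - (1 / 2) ^ (J + 1)) * Real.log 2)
        (mul_nonneg (by linarith) (by linarith)) (N := J) (by linarith) i hi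
      refine le_trans (le_of_eq ?_) h7
      rw [mul_one, mul_pow, mul_div_assoc]) N m le_rfl
  rw [pathWt_smul] at h1
  refine le_trans (mul_le_mul_of_nonneg_right ?_
    (mul_nonneg (pow_nonneg (by linarith) m) (pathWt_nonneg (fun _ => zero_le_one) N m))) h1
  calc Real.exp (-4) ≤ Real.exp (∑ l ∈ Finset.range N, -2 * (((l : ℝ) + 1) * (1 / 2) ^ (l + 1))) := by
        rw [Real.exp_le_exp, ← Finset.mul_sum]
        linarith [sum_succ_mul_half_pow_le N]
    _ = ∏ l ∈ Finset.range N, Real.exp (-2 * (((l : ℝ) + 1) * (1 / 2) ^ (l + 1))) :=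
        Real.exp_sum _ _
    _ ≤ _ := by
        refine Finset.prod_le_prod (fun i _ => (Real.exp_pos _).le) fun i _ => ?_
        have hi : (1 / 2 : ℝ) ^ (i + 1) ≤ 1 / 2 := by
          rw [pow_succ]
          have : (1 / 2 : ℝ) ^ i ≤ 1 := pow_le_one₀ (by norm_num) (by norm_num)
          linarith
        have h2 := exp_le_one_sub hi
        have h3 : Real.exp (-2 * (1 / 2) ^ (i + 1)) ≤ 1 - (1 / 2) ^ (i + 1) := by
          refine le_trans (Real.exp_le_exp.2 ?_) h2
          have : (0 : ℝ) < (1 / 2) ^ (i + 1) := by positivity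
          nlinarith
        refine le_trans (le_of_eq ?_) (pow_le_pow_left₀ (Real.exp_pos _).le h3 (i + 1))
        rw [← Real.exp_nat_mul]
        push_cast
        ring_nf

end

section

theorem erase_mem_pathSets {l : ℝ} {J r p : ℕ} {S : Finset ℕ} (hS : S ∈ pathSets l J (r + 1))
    (hp : p ∈ S) : S.erase p ∈ pathSets l J r := by
  obtain ⟨⟨h1, h2⟩, h3⟩ := mem_pathSets.1 hS
  refine mem_pathSets.2 ⟨⟨(Finset.erase_subset _ _).trans h1, ?_⟩, fun j hj => ?_⟩
  · rw [Finset.card_erase_of_mem hp, h2, Nat.add_sub_cancel]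
  · exact (Finset.card_le_card
      (Finset.inter_subset_inter_right (Finset.erase_subset _ _))).trans (h3 j hj)

theorem sum_pathSets_sum_erase_le {w : ℕ → ℝ} (hw : ∀ p, 0 ≤ w p) (l : ℝ) (J r : ℕ)
    {f : Finset ℕ → ℕ → ℝ} (hf : ∀ T p, 0 ≤ f T p) :
    ∑ S ∈ pathSets l J (r + 1), (∏ q ∈ S, w q) * ∑ p ∈ S, f (S.erase p) p ≤
      ∑ T ∈ pathSets l J r, (∏ q ∈ T, w q) * ∑ p ∈ primesLog l (2 ^ J * l), w p * f T p := by
  set P := primesLog l (2 ^ J * l) with hP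
  set G : Finset ℕ → ℕ → ℝ := fun T p =>
    if T ∈ pathSets l J r then (∏ q ∈ T, w q) * (w p * f T p) else 0 with hG
  have hG0 : ∀ T p, 0 ≤ G T p := fun T p => by
    simp only [hG]
    split_ifs
    · exact mul_nonneg (Finset.prod_nonneg fun q _ => hw q) (mul_nonneg (hw p) (hf T p))
    · exact le_rfl
  have hsub : ∀ m, pathSets l J m ⊆ P.powersetCard m := fun m => Finset.filter_subset _ _
  calc ∑ S ∈ pathSets l J (r + 1), (∏ q ∈ S, w q) * ∑ p ∈ S, f (S.erase p) p
      ≤ ∑ S ∈ pathSets l J (r + 1), ∑ p ∈ S, G (S.erase p) p := by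
        refine Finset.sum_le_sum fun S hS => ?_
        rw [Finset.mul_sum]
        refine Finset.sum_le_sum fun p hp => ?_
        simp only [hG]
        rw [if_pos (erase_mem_pathSets hS hp), ← Finset.mul_prod_erase S w hp]
        exact le_of_eq (by ring)
    _ ≤ ∑ S ∈ P.powersetCard (r + 1), ∑ p ∈ S, G (S.erase p) p :=
        Finset.sum_le_sum_of_subset_of_nonneg (hsub _) fun S _ _ =>
          Finset.sum_nonneg fun p _ => hG0 _ _
    _ = ∑ T ∈ P.powersetCard r, ∑ p ∈ P \ T, G T p := sum_powersetCard_succ_sum_erase P r G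
    _ ≤ ∑ T ∈ P.powersetCard r, ∑ p ∈ P, G T p :=
        Finset.sum_le_sum fun T _ => Finset.sum_le_sum_of_subset_of_nonneg Finset.sdiff_subset
          fun p _ _ => hG0 _ _
    _ = ∑ T ∈ pathSets l J r, ∑ p ∈ P, G T p := by
        refine (Finset.sum_subset (hsub r) fun T _ hT => ?_).symm
        exact Finset.sum_eq_zero fun p _ => if_neg hT
    _ = _ := by
        refine Finset.sum_congr rfl fun T hT => ?_
        rw [Finset.mul_sum]
        refine Finset.sum_congr rfl fun p _ => ?_
        simp only [hG]
        rw [if_pos hT]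

/-- The logarithm of the product of the elements of `d`. -/
noncomputable def logSum (d : Finset ℕ) : ℝ := ∑ p ∈ d, Real.log p

/-- Pairs of subsets of `S` whose products are within a factor `exp lam` of each other. -/
noncomputable def closePairs (lam : ℝ) (S : Finset ℕ) : Finset (Finset ℕ × Finset ℕ) :=
  (S.powerset ×ˢ S.powerset).filter fun a => |logSum a.1 - logSum a.2| ≤ lam

/-- Pairs of subsets of `T` that agree above `p` and become close when `p` is inserted into the
first one. -/
noncomputable def closePairsAt (lam : ℝ) (T : Finset ℕ) (p : ℕ) : Finset (Finset ℕ × Finset ℕ) :=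
  (T.powerset ×ˢ T.powerset).filter fun a => |Real.log p + logSum a.1 - logSum a.2| ≤ lam ∧
    ∀ q ∈ T, p < q → (q ∈ a.1 ↔ q ∈ a.2)

theorem card_closePairs_le (lam : ℝ) (S : Finset ℕ) : (closePairs lam S).card ≤
    2 ^ S.card + 2 * ∑ p ∈ S, (closePairsAt lam (S.erase p) p).card := by
  set X : ℕ → Finset (Finset ℕ × Finset ℕ) := fun p => (closePairs lam S).filter fun a =>
    (p ∈ a.1 ∧ p ∉ a.2) ∧ ∀ q ∈ S, p < q → (q ∈ a.1 ↔ q ∈ a.2) with hX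
  have hXc : ∀ p ∈ S, (X p).card ≤ (closePairsAt lam (S.erase p) p).card := by
    intro p hp
    refine Finset.card_le_card_of_injOn (fun a => (a.1.erase p, a.2)) ?_ ?_
    · rintro ⟨d, d'⟩ ha
      obtain ⟨h1, ⟨h2, h3⟩, h4⟩ := Finset.mem_filter.1 (Finset.mem_coe.1 ha)
      obtain ⟨h5, h6⟩ := Finset.mem_filter.1 h1
      obtain ⟨h7, h8⟩ := Finset.mem_product.1 h5
      dsimp only at h2 h3 h4 h6 h7 h8
      refine Finset.mem_coe.2 (Finset.mem_filter.2 ⟨Finset.mem_product.2 ⟨?_, ?_⟩, ?_, ?_⟩)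
      · exact Finset.mem_powerset.2 (Finset.erase_subset_erase p (Finset.mem_powerset.1 h7))
      · exact Finset.mem_powerset.2 fun q hq => Finset.mem_erase.2
          ⟨fun e => h3 (e ▸ hq), Finset.mem_powerset.1 h8 hq⟩
      · dsimp only
        rwa [logSum, Finset.add_sum_erase d (fun p : ℕ => Real.log p) h2]
      · intro q hq hpq
        dsimp only
        rw [Finset.mem_erase, and_iff_right hpq.ne']
        exact h4 q (Finset.mem_of_mem_erase hq) hpq
    · rintro ⟨d, d'⟩ ha ⟨e, e'⟩ hb hab
      have h2 := (Finset.mem_filter.1 (Finset.mem_coe.1 ha)).2.1.1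
      have h3 := (Finset.mem_filter.1 (Finset.mem_coe.1 hb)).2.1.1
      dsimp only at h2 h3
      obtain ⟨h4, h5⟩ := Prod.mk.inj hab
      dsimp only at h4 h5
      exact Prod.ext (by dsimp only; rw [← Finset.insert_erase h2, h4, Finset.insert_erase h3]) h5
  have hcover : closePairs lam S ⊆ (S.powerset.image fun d => (d, d)) ∪
      (S.biUnion X ∪ (S.biUnion X).image Prod.swap) := by
    rintro ⟨d, d'⟩ ha
    obtain ⟨h5, h6⟩ := Finset.mem_filter.1 ha
    obtain ⟨h7, h8⟩ := Finset.mem_product.1 h5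
    have hd := Finset.mem_powerset.1 h7
    have hd' := Finset.mem_powerset.1 h8
    dsimp only at h6 hd hd'
    by_cases hdd : d = d'
    · subst hdd
      exact Finset.mem_union_left _ (Finset.mem_image.2 ⟨d, h7, rfl⟩)
    refine Finset.mem_union_right _ ?_
    set Y := S.filter fun q => ¬ (q ∈ d ↔ q ∈ d') with hY
    have hYn : Y.Nonempty := by
      by_contra hne
      rw [Finset.not_nonempty_iff_eq_empty] at hne
      apply hdd
      ext q
      by_contra hq
      have : q ∈ Y := Finset.mem_filter.2 ⟨by
        by_contra hqS
        exact hq ⟨fun h => absurd (hd h) hqS, fun h => absurd (hd' h) hqS⟩, hq⟩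
      rw [hne] at this
      exact Finset.notMem_empty _ this
    set p := Y.max' hYn with hp
    obtain ⟨hpS, hpd⟩ := Finset.mem_filter.1 (Y.max'_mem hYn)
    have hagree : ∀ q ∈ S, p < q → (q ∈ d ↔ q ∈ d') := by
      intro q hq hpq
      by_contra hne
      exact absurd (Y.le_max' q (Finset.mem_filter.2 ⟨hq, hne⟩)) (not_le.2 hpq)
    by_cases hpd1 : p ∈ d
    · have hpd2 : p ∉ d' := fun h => hpd ⟨fun _ => h, fun _ => hpd1⟩
      exact Finset.mem_union_left _ (Finset.mem_biUnion.2 ⟨p, hpS, Finset.mem_filter.2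
        ⟨ha, ⟨hpd1, hpd2⟩, hagree⟩⟩)
    · have hpd2 : p ∈ d' := by
        by_contra h
        exact hpd ⟨fun h' => absurd h' hpd1, fun h' => absurd h' h⟩
      refine Finset.mem_union_right _ (Finset.mem_image.2 ⟨(d', d), Finset.mem_biUnion.2
        ⟨p, hpS, Finset.mem_filter.2 ⟨Finset.mem_filter.2 ⟨Finset.mem_product.2 ⟨h8, h7⟩, ?_⟩,
          ⟨hpd2, hpd1⟩, fun q hq hpq => (hagree q hq hpq).symm⟩⟩, rfl⟩)
      dsimp only
      rwa [abs_sub_comm]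
  have hXX : (S.biUnion X).card ≤ ∑ p ∈ S, (closePairsAt lam (S.erase p) p).card :=
    Finset.card_biUnion_le.trans (Finset.sum_le_sum hXc)
  calc (closePairs lam S).card ≤ _ := Finset.card_le_card hcover
    _ ≤ (S.powerset.image fun d => (d, d)).card +
        ((S.biUnion X).card + ((S.biUnion X).image Prod.swap).card) :=
        (Finset.card_union_le _ _).trans (Nat.add_le_add_left (Finset.card_union_le _ _) _)
    _ ≤ 2 ^ S.card + ((S.biUnion X).card + (S.biUnion X).card) := by
        refine Nat.add_le_add ?_ (Nat.add_le_add_left Finset.card_image_le _)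
        exact Finset.card_image_le.trans (Finset.card_powerset S).le
    _ ≤ _ := by omega

/-- Pairs of subsets of `T` agreeing outside `P`. -/
theorem card_pairs_agree_le (T P : Finset ℕ) :
    ((T.powerset ×ˢ T.powerset).filter fun a => ∀ q ∈ T, q ∉ P → (q ∈ a.1 ↔ q ∈ a.2)).card ≤
      2 ^ T.card * 2 ^ (T ∩ P).card := by
  rw [← Finset.card_powerset, ← Finset.card_powerset, ← Finset.card_product]
  refine Finset.card_le_card_of_injOn (fun a => (a.1, a.2 ∩ P)) ?_ ?_
  · rintro ⟨d, d'⟩ ha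
    obtain ⟨h5, _⟩ := Finset.mem_filter.1 (Finset.mem_coe.1 ha)
    obtain ⟨h7, h8⟩ := Finset.mem_product.1 h5
    exact Finset.mem_coe.2 (Finset.mem_product.2 ⟨h7, Finset.mem_powerset.2
      (Finset.inter_subset_inter_right (Finset.mem_powerset.1 h8))⟩)
  · rintro ⟨d, d'⟩ ha ⟨e, e'⟩ hb hab
    obtain ⟨h5, h6⟩ := Finset.mem_filter.1 (Finset.mem_coe.1 ha)
    obtain ⟨h7, h8⟩ := Finset.mem_filter.1 (Finset.mem_coe.1 hb)
    have hd' := Finset.mem_powerset.1 (Finset.mem_product.1 h5).2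
    have he' := Finset.mem_powerset.1 (Finset.mem_product.1 h7).2
    dsimp only at h6 h8 hd' he'
    obtain ⟨h1, h2⟩ := Prod.mk.inj hab
    subst h1
    refine Prod.ext rfl ?_
    ext q
    dsimp only
    by_cases hqP : q ∈ P
    · have := Finset.ext_iff.1 h2 q
      simpa [hqP] using this
    · constructor
      · exact fun h => (h8 q (hd' h) hqP).1 ((h6 q (hd' h) hqP).2 h)
      · exact fun h => (h6 q (he' h) hqP).1 ((h8 q (he' h) hqP).2 h)

theorem MertensWeight.sum_window_le {w : ℕ → ℝ} {g C : ℝ} (h : MertensWeight w g C) {a b : ℝ}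
    (ha : 0 < a) (v : ℝ) {lam : ℝ} (hlam : 0 ≤ lam) :
    ∑ p ∈ (primesLog a b).filter (fun p : ℕ => |Real.log p - v| ≤ lam), w p ≤
      (2 * lam + 1 + C) / a := by
  set a' := max a (v - lam - 1) with ha'
  have h0 : 0 < a' := ha.trans_le (le_max_left _ _)
  have hsub : (primesLog a b).filter (fun p : ℕ => |Real.log p - v| ≤ lam) ⊆
      primesLog a' (v + lam) := by
    intro p hp
    obtain ⟨h1, h2⟩ := Finset.mem_filter.1 hp
    obtain ⟨h3, h4, _⟩ := mem_primesLog.1 h1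
    rw [abs_le] at h2
    exact mem_primesLog.2 ⟨h3, max_lt h4 (by linarith), by linarith⟩
  refine (Finset.sum_le_sum_of_subset_of_nonneg hsub fun p _ _ => h.nonneg p).trans ?_
  rcases le_or_gt a' (v + lam) with hle | hlt
  · refine (h.sum_le h0 hle).trans ?_
    have h1 : v - lam - 1 ≤ a' := le_max_right _ _
    exact div_le_div₀ (by linarith [h.C_pos]) (by linarith) ha (le_max_left _ _)
  · rw [Finset.sum_eq_zero]
    · have := h.C_pos
      positivity
    · intro p hp
      obtain ⟨_, h4, h5⟩ := mem_primesLog.1 hp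
      linarith

theorem MertensWeight.sum_block_closePairsAt_le {w : ℕ → ℝ} {g C : ℝ} (h : MertensWeight w g C)
    {l lam K : ℝ} (hl : 1 ≤ l) (hC : C ≤ l) (hlam : 0 ≤ lam) (hK : lam ≤ K * l) (T : Finset ℕ)
    (j : ℕ) (hT : ∀ q ∈ T, q.Prime ∧ l < Real.log q) :
    ∑ p ∈ block l j, w p * (closePairsAt lam T p).card ≤
      (2 * K + 2) / 2 ^ j * (2 ^ T.card * 2 ^ (T ∩ primesLog l (2 ^ (j + 1) * l)).card) := by
  set Q := (T.powerset ×ˢ T.powerset).filter fun a =>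
    ∀ q ∈ T, q ∉ primesLog l (2 ^ (j + 1) * l) → (q ∈ a.1 ↔ q ∈ a.2) with hQ
  have h1 : ∀ p ∈ block l j, ((closePairsAt lam T p).card : ℝ) ≤
      ∑ a ∈ Q, if |Real.log p - (logSum a.2 - logSum a.1)| ≤ lam then (1 : ℝ) else 0 := by
    intro p hp
    obtain ⟨hp1, hp2, hp3⟩ := mem_block.1 hp
    rw [← Finset.sum_filter, Finset.sum_const, nsmul_eq_mul, mul_one]
    refine Nat.cast_le.2 (Finset.card_le_card fun a ha => ?_)
    obtain ⟨h2, h3, h4⟩ := Finset.mem_filter.1 ha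
    refine Finset.mem_filter.2 ⟨Finset.mem_filter.2 ⟨h2, fun q hq hqP => h4 q hq ?_⟩, ?_⟩
    · obtain ⟨hq1, hq2⟩ := hT q hq
      have hq3 : 2 ^ (j + 1) * l < Real.log q := by
        by_contra hcon
        exact hqP (mem_primesLog.2 ⟨hq1, hq2, not_lt.1 hcon⟩)
      have hp0 : (0 : ℝ) < p := by exact_mod_cast hp1.pos
      have hq0 : (0 : ℝ) < q := by exact_mod_cast hq1.pos
      exact_mod_cast (Real.log_lt_log_iff hp0 hq0).1 (hp3.trans_lt hq3)
    · rwa [show Real.log p - (logSum a.2 - logSum a.1) = Real.log p + logSum a.1 - logSum a.2 by ring]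
  calc ∑ p ∈ block l j, w p * (closePairsAt lam T p).card
      ≤ ∑ p ∈ block l j, w p * ∑ a ∈ Q,
          if |Real.log p - (logSum a.2 - logSum a.1)| ≤ lam then (1 : ℝ) else 0 :=
        Finset.sum_le_sum fun p hp => mul_le_mul_of_nonneg_left (h1 p hp) (h.nonneg p)
    _ = ∑ a ∈ Q, ∑ p ∈ (block l j).filter (fun p : ℕ =>
          |Real.log p - (logSum a.2 - logSum a.1)| ≤ lam), w p := by
        simp only [Finset.mul_sum]
        rw [Finset.sum_comm]
        refine Finset.sum_congr rfl fun a _ => ?_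
        rw [Finset.sum_filter]
        refine Finset.sum_congr rfl fun p _ => ?_
        rw [mul_ite, mul_one, mul_zero]
    _ ≤ ∑ _a ∈ Q, (2 * K + 2) / 2 ^ j := by
        refine Finset.sum_le_sum fun a _ => (h.sum_window_le (by positivity) _ hlam).trans ?_
        rw [div_le_div_iff₀ (by positivity) (by positivity)]
        have : 2 * lam + 1 + C ≤ (2 * K + 2) * l := by linarith
        nlinarith [pow_pos (two_pos : (0 : ℝ) < 2) j]
    _ = (2 * K + 2) / 2 ^ j * Q.card := by rw [Finset.sum_const, nsmul_eq_mul, mul_comm]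
    _ ≤ _ := by
        have hK0 : 0 ≤ K := by
          by_contra hcon
          nlinarith
        refine mul_le_mul_of_nonneg_left ?_ (by positivity)
        have := card_pairs_agree_le T (primesLog l (2 ^ (j + 1) * l))
        calc (Q.card : ℝ) ≤ ((2 ^ T.card * 2 ^ (T ∩ primesLog l (2 ^ (j + 1) * l)).card : ℕ) : ℝ) :=
              Nat.cast_le.2 this
          _ = _ := by rw [Nat.cast_mul, Nat.cast_pow, Nat.cast_pow, Nat.cast_ofNat]

end

section

theorem prime_of_mem_pathSets {l : ℝ} {J m : ℕ} {S : Finset ℕ} (hS : S ∈ pathSets l J m) {p : ℕ}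
    (hp : p ∈ S) : p.Prime ∧ l < Real.log p ∧ Real.log p ≤ 2 ^ J * l :=
  mem_primesLog.1 ((mem_pathSets.1 hS).1.1 hp)

theorem logSum_nonneg {d : Finset ℕ} : 0 ≤ logSum d :=
  Finset.sum_nonneg fun p _ => Real.log_natCast_nonneg p

theorem MertensWeight.pathSum_le_ballotT {w : ℕ → ℝ} {g C l : ℝ} (h : MertensWeight w g C)
    (hl : 0 < l) (hC : 4 * (C + 2 * g) ≤ l) {J m : ℕ} (hm : m ≤ J + 1) :
    pathSum w l J m ≤ Real.exp 2 * (Real.log 2 ^ m * ballotT J m) := by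
  have := h.pathSum_le (N := J) (t := fun _ => 1) (a := w) hl hC (fun _ => zero_le_one) h.nonneg
    (fun j _ p _ => (one_mul _).symm) m
  rwa [pathWt_one_eq hm fun _ _ => rfl] at this

theorem MertensWeight.pathSum_pred_le {w : ℕ → ℝ} {g C l : ℝ} (h : MertensWeight w g C)
    (hl : 1 ≤ l) (hC : 4 * (C + 2 * g) ≤ l) (J : ℕ) :
    pathSum w l (J + 1) J ≤ 2 * Real.exp 6 / Real.log 2 * pathSum w l (J + 1) (J + 1) := by
  have h2 : 0 < Real.log 2 := Real.log_pos one_lt_two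
  have h3 := h.pathSum_le_ballotT (by linarith) hC (show J ≤ J + 1 + 1 by omega)
  have h4 := h.le_pathSum hl hC (J + 1) (J + 1)
  rw [pathWt_one_eq (by omega) fun _ _ => rfl] at h4
  have h5 := ballotT_add_le J 1
  norm_num at h5
  calc pathSum w l (J + 1) J
      ≤ Real.exp 2 * (Real.log 2 ^ J * (2 * ballotT (J + 1) (J + 1))) := by
        refine h3.trans ?_
        gcongr
    _ = 2 * Real.exp 6 / Real.log 2 * (Real.exp (-4) *
          (Real.log 2 ^ (J + 1) * ballotT (J + 1) (J + 1))) := by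
        have : Real.exp 2 = Real.exp 6 * Real.exp (-4) := by rw [← Real.exp_add]; norm_num
        rw [this, pow_succ (Real.log 2) J]
        field_simp
    _ ≤ _ := by gcongr

theorem MertensWeight.pathSum_le_two_mul_sum_filter {w : ℕ → ℝ} {g C l : ℝ}
    (h : MertensWeight w g C) (hl : 1 ≤ l) (hC : 4 * (C + 2 * g) ≤ l) {J : ℕ} (hJ : 1 ≤ J) :
    pathSum w l J J ≤ 2 * ∑ S ∈ (pathSets l J J).filter
      (fun S => logSum S ≤ 8 * Real.exp 6 / Real.log 2 * (2 ^ J * l)), ∏ p ∈ S, w p := by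
  obtain ⟨J, rfl⟩ : ∃ k, J = k + 1 := ⟨J - 1, by omega⟩
  set Z := pathSum w l (J + 1) (J + 1) with hZ
  set X := 2 ^ (J + 1) * l with hX
  set K := 8 * Real.exp 6 / Real.log 2 with hK
  have h2 : 0 < Real.log 2 := Real.log_pos one_lt_two
  have hK0 : 0 < K := by positivity
  have hg := h.one_le
  have hCp := h.C_pos
  have hlX : l ≤ X := le_mul_of_one_le_left (by linarith) (one_le_pow₀ one_le_two)
  have hX0 : 0 < X := by linarith
  have hm : ∑ p ∈ primesLog l X, w p * Real.log p ≤ 2 * X := by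
    have := (abs_le.1 (h.mertens l X (by linarith) hlX)).2
    linarith
  have h0 : ∀ S : Finset ℕ, 0 ≤ ∏ p ∈ S, w p := fun S => Finset.prod_nonneg fun p _ => h.nonneg p
  have hfirst : ∑ S ∈ pathSets l (J + 1) (J + 1), (∏ p ∈ S, w p) * logSum S ≤ K * X * Z / 2 := by
    calc ∑ S ∈ pathSets l (J + 1) (J + 1), (∏ p ∈ S, w p) * logSum S
        ≤ ∑ T ∈ pathSets l (J + 1) J, (∏ q ∈ T, w q) * ∑ p ∈ primesLog l X, w p * Real.log p :=
          sum_pathSets_sum_erase_le (f := fun _ p => Real.log p) h.nonneg l (J + 1) J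
            fun _ p => Real.log_natCast_nonneg p
      _ = pathSum w l (J + 1) J * ∑ p ∈ primesLog l X, w p * Real.log p := by
          rw [← Finset.sum_mul, pathSum]
      _ ≤ 2 * Real.exp 6 / Real.log 2 * Z * (2 * X) := by
          refine mul_le_mul (h.pathSum_pred_le hl hC J) hm (Finset.sum_nonneg fun p _ =>
            mul_nonneg (h.nonneg p) (Real.log_natCast_nonneg p)) ?_
          exact mul_nonneg (by positivity) (Finset.sum_nonneg fun S _ => h0 S)
      _ = K * X * Z / 2 := by rw [hK]; ring
  have hbad : K * X * ∑ S ∈ (pathSets l (J + 1) (J + 1)).filter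
      (fun S => ¬ logSum S ≤ K * X), ∏ p ∈ S, w p ≤ K * X * Z / 2 := by
    refine le_trans ?_ hfirst
    rw [Finset.mul_sum]
    calc _ ≤ ∑ S ∈ (pathSets l (J + 1) (J + 1)).filter (fun S => ¬ logSum S ≤ K * X),
          (∏ p ∈ S, w p) * logSum S := by
          refine Finset.sum_le_sum fun S hS => ?_
          rw [mul_comm]
          exact mul_le_mul_of_nonneg_left (not_le.1 (Finset.mem_filter.1 hS).2).le (h0 S)
      _ ≤ _ := Finset.sum_le_sum_of_subset_of_nonneg (Finset.filter_subset _ _) fun S _ _ =>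
          mul_nonneg (h0 S) logSum_nonneg
  have hsplit := Finset.sum_filter_add_sum_filter_not (pathSets l (J + 1) (J + 1))
    (fun S => logSum S ≤ K * X) fun S => ∏ p ∈ S, w p
  have hKX : 0 < K * X := mul_pos hK0 hX0
  have hbad' : ∑ S ∈ (pathSets l (J + 1) (J + 1)).filter
      (fun S => ¬ logSum S ≤ K * X), ∏ p ∈ S, w p ≤ Z / 2 := by
    rw [mul_div_assoc] at hbad
    exact le_of_mul_le_mul_left hbad hKX
  have : Z = ∑ S ∈ pathSets l (J + 1) (J + 1), ∏ p ∈ S, w p := rfl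
  linarith

theorem MertensWeight.exists_sum_closePairs_le {w : ℕ → ℝ} {g C : ℝ} (h : MertensWeight w g C)
    {K : ℝ} (hK : 0 ≤ K) : ∃ B, 0 < B ∧ ∀ l lam : ℝ, 1 ≤ l → 4 * (C + 2 * g) ≤ l → 0 ≤ lam →
      lam ≤ K * l → ∀ J : ℕ, 1 ≤ J →
      ∑ S ∈ pathSets l J J, (∏ p ∈ S, w p) * (closePairs lam S).card ≤
        B * ((2 * Real.log 2) ^ J * ballotT J J) := by
  obtain ⟨C₁, hC₁, hpath⟩ := exists_sum_pathWt_two_le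
  have h2 : 0 < Real.log 2 := Real.log_pos one_lt_two
  refine ⟨Real.exp 2 + 2 * ((2 * K + 2) * (Real.exp 2 * C₁ / Real.log 2)), by positivity, ?_⟩
  intro l lam hl hC hlam hlamK J hJ
  obtain ⟨r, rfl⟩ : ∃ k, J = k + 1 := ⟨J - 1, by omega⟩
  have hl0 : 0 < l := by linarith
  have hCp := h.C_pos
  have hg := h.one_le
  have h0 : ∀ S : Finset ℕ, 0 ≤ ∏ p ∈ S, w p := fun S => Finset.prod_nonneg fun p _ => h.nonneg p
  have hdiag : ∑ S ∈ pathSets l (r + 1) (r + 1), (∏ p ∈ S, w p) * 2 ^ (r + 1) ≤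
      Real.exp 2 * ((2 * Real.log 2) ^ (r + 1) * ballotT (r + 1) (r + 1)) := by
    have := h.pathSum_le_ballotT hl0 hC (show r + 1 ≤ r + 1 + 1 by omega)
    rw [← Finset.sum_mul]
    calc _ ≤ Real.exp 2 * (Real.log 2 ^ (r + 1) * ballotT (r + 1) (r + 1)) * 2 ^ (r + 1) := by
          gcongr
          exact this
      _ = _ := by rw [mul_pow]; ring
  have hweight : ∀ j < r + 1, ∑ T ∈ pathSets l (r + 1) r, (∏ q ∈ T, w q) *
      2 ^ (T ∩ primesLog l (2 ^ (j + 1) * l)).card ≤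
      Real.exp 2 * (Real.log 2 ^ r *
        pathWt (fun i => if i < j + 1 then (2 : ℝ) else 1) (r + 1) r) := by
    intro j hj
    set P := primesLog l (2 ^ (j + 1) * l) with hP
    set a : ℕ → ℝ := fun p => if p ∈ P then 2 * w p else w p with ha
    have := h.pathSum_le (N := r + 1) (t := fun i => if i < j + 1 then (2 : ℝ) else 1) (a := a)
      hl0 hC (fun i => by split_ifs <;> norm_num)
      (fun p => by
        simp only [ha]
        split_ifs
        · exact mul_nonneg zero_le_two (h.nonneg p)
        · exact h.nonneg p)
      (fun i hi p hp => by
        simp only [ha]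
        by_cases hij : i < j + 1
        · have hpP : p ∈ P := by
            rw [hP, ← biUnion_block hl0.le]
            exact Finset.mem_biUnion.2 ⟨i, Finset.mem_range.2 hij, hp⟩
          rw [if_pos hpP, if_pos hij]
        · have hpP : p ∉ P := by
            rw [hP, ← biUnion_block hl0.le]
            intro hmem
            obtain ⟨i', hi', hp'⟩ := Finset.mem_biUnion.1 hmem
            exact Finset.disjoint_left.1 (disjoint_block hl0.le
              (show i' < i by have := Finset.mem_range.1 hi'; omega)) hp' hp
          rw [if_neg hpP, if_neg hij, one_mul]) r
    refine le_trans (le_of_eq ?_) this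
    refine Finset.sum_congr rfl fun T _ => ?_
    have e1 : ∀ p ∈ T, a p = w p * if p ∈ P then (2 : ℝ) else 1 := fun p _ => by
      simp only [ha]
      split_ifs <;> ring
    rw [Finset.prod_congr rfl e1, Finset.prod_mul_distrib, Finset.prod_ite, Finset.prod_const,
      Finset.prod_const_one, mul_one, Finset.filter_mem_eq_inter]
  have hoff : ∑ S ∈ pathSets l (r + 1) (r + 1), (∏ p ∈ S, w p) *
      ∑ p ∈ S, ((closePairsAt lam (S.erase p) p).card : ℝ) ≤
      (2 * K + 2) * (Real.exp 2 * C₁ / Real.log 2) *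
        ((2 * Real.log 2) ^ (r + 1) * ballotT (r + 1) (r + 1)) := by
    calc ∑ S ∈ pathSets l (r + 1) (r + 1), (∏ p ∈ S, w p) *
          ∑ p ∈ S, ((closePairsAt lam (S.erase p) p).card : ℝ)
        ≤ ∑ T ∈ pathSets l (r + 1) r, (∏ q ∈ T, w q) *
            ∑ p ∈ primesLog l (2 ^ (r + 1) * l), w p * (closePairsAt lam T p).card :=
          sum_pathSets_sum_erase_le (f := fun T p => ((closePairsAt lam T p).card : ℝ)) h.nonneg l
            (r + 1) r fun _ _ => Nat.cast_nonneg _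
      _ ≤ ∑ T ∈ pathSets l (r + 1) r, (∏ q ∈ T, w q) * ∑ j ∈ Finset.range (r + 1),
            (2 * K + 2) / 2 ^ j * (2 ^ r * 2 ^ (T ∩ primesLog l (2 ^ (j + 1) * l)).card) := by
          refine Finset.sum_le_sum fun T hT => mul_le_mul_of_nonneg_left ?_ (h0 T)
          rw [← biUnion_block hl0.le, Finset.sum_biUnion]
          · refine Finset.sum_le_sum fun j _ => ?_
            have hTc := (mem_pathSets.1 hT).1.2
            have := h.sum_block_closePairsAt_le hl (by linarith) hlam hlamK T j fun q hq =>
              ⟨(prime_of_mem_pathSets hT hq).1, (prime_of_mem_pathSets hT hq).2.1⟩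
            rwa [hTc] at this
          · intro i _ j _ hij
            rcases lt_or_gt_of_ne hij with hlt | hlt
            · exact disjoint_block hl0.le hlt
            · exact (disjoint_block hl0.le hlt).symm
      _ = ∑ j ∈ Finset.range (r + 1), (2 * K + 2) / 2 ^ j * 2 ^ r *
            ∑ T ∈ pathSets l (r + 1) r, (∏ q ∈ T, w q) *
              2 ^ (T ∩ primesLog l (2 ^ (j + 1) * l)).card := by
          simp only [Finset.mul_sum]
          rw [Finset.sum_comm]
          exact Finset.sum_congr rfl fun j _ => Finset.sum_congr rfl fun T _ => by ring
      _ ≤ ∑ j ∈ Finset.range (r + 1), (2 * K + 2) / 2 ^ j * 2 ^ r * (Real.exp 2 *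
            (Real.log 2 ^ r * pathWt (fun i => if i < j + 1 then (2 : ℝ) else 1) (r + 1) r)) := by
          refine Finset.sum_le_sum fun j hj => mul_le_mul_of_nonneg_left
            (hweight j (Finset.mem_range.1 hj)) (by positivity)
      _ = (2 * K + 2) * 2 ^ (r + 1) * Real.exp 2 * Real.log 2 ^ r *
            ∑ j ∈ Finset.range (r + 1), (1 / 2) ^ (j + 1) *
              pathWt (fun i => if i < j + 1 then (2 : ℝ) else 1) (r + 1) r := by
          rw [Finset.mul_sum]
          refine Finset.sum_congr rfl fun j _ => ?_
          rw [div_pow, one_pow, pow_succ (2 : ℝ) j, pow_succ (2 : ℝ) r]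
          field_simp
      _ ≤ (2 * K + 2) * 2 ^ (r + 1) * Real.exp 2 * Real.log 2 ^ r *
            (C₁ * ballotT (r + 1) (r + 1)) := by
          refine mul_le_mul_of_nonneg_left (hpath (r + 1) hJ) (by positivity)
      _ = _ := by
          rw [mul_pow, pow_succ (Real.log 2) r]
          field_simp
  calc ∑ S ∈ pathSets l (r + 1) (r + 1), (∏ p ∈ S, w p) * ((closePairs lam S).card : ℝ)
      ≤ ∑ S ∈ pathSets l (r + 1) (r + 1), ((∏ p ∈ S, w p) * 2 ^ (r + 1) + 2 * ((∏ p ∈ S, w p) *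
          ∑ p ∈ S, ((closePairsAt lam (S.erase p) p).card : ℝ))) := by
        refine Finset.sum_le_sum fun S hS => ?_
        have h1 := card_closePairs_le lam S
        rw [(mem_pathSets.1 hS).1.2] at h1
        have h3 : ((closePairs lam S).card : ℝ) ≤ 2 ^ (r + 1) +
            2 * ∑ p ∈ S, ((closePairsAt lam (S.erase p) p).card : ℝ) := by exact_mod_cast h1
        refine (mul_le_mul_of_nonneg_left h3 (h0 S)).trans (le_of_eq (by ring))
    _ = _ := Finset.sum_add_distrib
    _ ≤ _ := by
        rw [← Finset.mul_sum]
        nlinarith [hdiag, hoff]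

end

section

/-- The primes `q` such that `q * ∏ p ∈ d, p` has its logarithm in `(Y, Y + lam]`. -/
noncomputable def windowPrimes (Y lam : ℝ) (d : Finset ℕ) : Finset ℕ :=
  primesLog (Y - logSum d) (Y + lam - logSum d)

/-- The primes `q` lying in the window of some subset of `S`. -/
noncomputable def hitPrimes (Y lam : ℝ) (S : Finset ℕ) : Finset ℕ :=
  S.powerset.biUnion (windowPrimes Y lam)

theorem mem_hitPrimes {Y lam : ℝ} {S : Finset ℕ} {q : ℕ} :
    q ∈ hitPrimes Y lam S ↔ ∃ d ⊆ S, q.Prime ∧ Y - logSum d < Real.log q ∧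
      Real.log q ≤ Y + lam - logSum d := by
  simp only [hitPrimes, Finset.mem_biUnion, Finset.mem_powerset, windowPrimes, mem_primesLog]

theorem logSum_mono {d S : Finset ℕ} (h : d ⊆ S) : logSum d ≤ logSum S :=
  Finset.sum_le_sum_of_subset_of_nonneg h fun p _ _ => Real.log_natCast_nonneg p

theorem MertensWeight.sum_windowPrimes_le {w : ℕ → ℝ} {g C : ℝ} (h : MertensWeight w g C)
    {Y lam : ℝ} (hY : 0 < Y) (hlam : C ≤ lam) {d : Finset ℕ} (hd : logSum d ≤ Y / 2) :
    ∑ q ∈ windowPrimes Y lam d, w q ≤ 4 * (lam / Y) := by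
  have hC := h.C_pos
  refine (h.sum_le (by linarith) (by linarith)).trans ?_
  rw [show 4 * (lam / Y) = (2 * lam) / (Y / 2) by field_simp; ring]
  exact div_le_div₀ (by linarith) (by linarith) (by linarith) (by linarith)

theorem MertensWeight.le_sum_windowPrimes {w : ℕ → ℝ} {g C : ℝ} (h : MertensWeight w g C)
    {Y lam : ℝ} (hY : 0 < Y) (hlam : 2 * C ≤ lam) (hlamY : lam ≤ Y) {d : Finset ℕ}
    (hd : logSum d ≤ Y / 2) : lam / Y / 4 ≤ ∑ q ∈ windowPrimes Y lam d, w q := by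
  have hC := h.C_pos
  have := logSum_nonneg (d := d)
  refine le_trans ?_ (h.le_sum (a := Y - logSum d) (b := Y + lam - logSum d) (by linarith)
    (by linarith) (by linarith))
  rw [show lam / Y / 4 = (lam / 2) / (2 * Y) by field_simp; norm_num]
  exact div_le_div₀ (by linarith) (by linarith) (by linarith) (by linarith)

theorem MertensWeight.sq_le_sum_hitPrimes_mul {w : ℕ → ℝ} {g C : ℝ} (h : MertensWeight w g C)
    {Y lam : ℝ} (hY : 0 < Y) (hlam : 2 * C ≤ lam) (hlamY : lam ≤ Y) (𝒮 : Finset (Finset ℕ))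
    (h𝒮 : ∀ S ∈ 𝒮, logSum S ≤ Y / 2) :
    (lam / Y / 4 * ∑ S ∈ 𝒮, (∏ p ∈ S, w p) * 2 ^ S.card) ^ 2 ≤
      (∑ S ∈ 𝒮, (∏ p ∈ S, w p) * ∑ q ∈ hitPrimes Y lam S, w q) *
        (4 * (lam / Y) * ∑ S ∈ 𝒮, (∏ p ∈ S, w p) * (closePairs lam S).card) := by
  have hCp := h.C_pos
  have hW : ∀ S : Finset ℕ, 0 ≤ ∏ p ∈ S, w p := fun S => Finset.prod_nonneg fun p _ => h.nonneg p
  set f : Finset ℕ → ℕ → ℝ := fun S q =>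
    ∑ d ∈ S.powerset, if q ∈ windowPrimes Y lam d then (1 : ℝ) else 0 with hf
  have hsum : ∀ S, ∀ d ∈ S.powerset, ∑ q ∈ hitPrimes Y lam S,
      (w q * if q ∈ windowPrimes Y lam d then (1 : ℝ) else 0) =
        ∑ q ∈ windowPrimes Y lam d, w q := by
    intro S d hd
    simp only [mul_ite, mul_one, mul_zero]
    rw [← Finset.sum_filter]
    congr 1
    rw [Finset.filter_mem_eq_inter, Finset.inter_eq_right]
    exact Finset.subset_biUnion_of_mem (windowPrimes Y lam) hd
  have hlow : lam / Y / 4 * ∑ S ∈ 𝒮, (∏ p ∈ S, w p) * 2 ^ S.card ≤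
      ∑ i ∈ 𝒮.sigma (hitPrimes Y lam), (∏ p ∈ i.1, w p) * w i.2 * f i.1 i.2 := by
    rw [Finset.sum_sigma, Finset.mul_sum]
    refine Finset.sum_le_sum fun S hS => ?_
    have e : ∑ q ∈ hitPrimes Y lam S, (∏ p ∈ S, w p) * w q * f S q =
        (∏ p ∈ S, w p) * ∑ d ∈ S.powerset, ∑ q ∈ windowPrimes Y lam d, w q := by
      rw [← Finset.sum_congr rfl (hsum S), Finset.sum_comm, Finset.mul_sum]
      refine Finset.sum_congr rfl fun q _ => ?_
      rw [← Finset.mul_sum, mul_assoc]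
    dsimp only
    rw [e]
    calc lam / Y / 4 * ((∏ p ∈ S, w p) * 2 ^ S.card)
        = (∏ p ∈ S, w p) * ∑ _d ∈ S.powerset, lam / Y / 4 := by
          rw [Finset.sum_const, Finset.card_powerset, nsmul_eq_mul, Nat.cast_pow, Nat.cast_ofNat]
          ring
      _ ≤ _ := mul_le_mul_of_nonneg_left (Finset.sum_le_sum fun d hd =>
          h.le_sum_windowPrimes hY hlam hlamY
            ((logSum_mono (Finset.mem_powerset.1 hd)).trans (h𝒮 S hS))) (hW S)
  have hup : ∑ i ∈ 𝒮.sigma (hitPrimes Y lam), (∏ p ∈ i.1, w p) * w i.2 * f i.1 i.2 ^ 2 ≤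
      4 * (lam / Y) * ∑ S ∈ 𝒮, (∏ p ∈ S, w p) * (closePairs lam S).card := by
    rw [Finset.sum_sigma, Finset.mul_sum]
    refine Finset.sum_le_sum fun S hS => ?_
    dsimp only
    have e : ∑ q ∈ hitPrimes Y lam S, (∏ p ∈ S, w p) * w q * f S q ^ 2 =
        (∏ p ∈ S, w p) * ∑ a ∈ S.powerset ×ˢ S.powerset, ∑ q ∈ hitPrimes Y lam S,
          if q ∈ windowPrimes Y lam a.1 ∧ q ∈ windowPrimes Y lam a.2 then w q else 0 := by
      rw [Finset.sum_comm, Finset.mul_sum]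
      refine Finset.sum_congr rfl fun q _ => ?_
      rw [sq, hf]
      dsimp only
      rw [Finset.sum_mul_sum, Finset.sum_product, mul_assoc]
      congr 1
      rw [Finset.mul_sum]
      refine Finset.sum_congr rfl fun d _ => ?_
      rw [Finset.mul_sum]
      refine Finset.sum_congr rfl fun d' _ => ?_
      by_cases h1 : q ∈ windowPrimes Y lam d <;> by_cases h2 : q ∈ windowPrimes Y lam d' <;>
        simp [h1, h2]
    rw [e]
    calc (∏ p ∈ S, w p) * ∑ a ∈ S.powerset ×ˢ S.powerset, ∑ q ∈ hitPrimes Y lam S,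
          (if q ∈ windowPrimes Y lam a.1 ∧ q ∈ windowPrimes Y lam a.2 then w q else 0)
        ≤ (∏ p ∈ S, w p) * ∑ a ∈ S.powerset ×ˢ S.powerset,
            if |logSum a.1 - logSum a.2| ≤ lam then 4 * (lam / Y) else 0 := by
          refine mul_le_mul_of_nonneg_left (Finset.sum_le_sum fun a ha => ?_) (hW S)
          have ha1 := (Finset.mem_product.1 ha).1
          split_ifs with hclose
          · refine le_trans ?_ (h.sum_windowPrimes_le hY (by linarith)
              ((logSum_mono (Finset.mem_powerset.1 ha1)).trans (h𝒮 S hS)))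
            rw [← hsum S a.1 ha1]
            refine Finset.sum_le_sum fun q _ => ?_
            have := h.nonneg q
            by_cases h1 : q ∈ windowPrimes Y lam a.1 <;>
              by_cases h2 : q ∈ windowPrimes Y lam a.2 <;> simp [h1, h2, this]
          · refine le_of_eq (Finset.sum_eq_zero fun q _ => if_neg ?_)
            rintro ⟨h1, h2⟩
            obtain ⟨-, h3, h4⟩ := mem_primesLog.1 h1
            obtain ⟨-, h5, h6⟩ := mem_primesLog.1 h2
            exact hclose (abs_le.2 ⟨by linarith, by linarith⟩)
      _ = 4 * (lam / Y) * ((∏ p ∈ S, w p) * (closePairs lam S).card) := by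
          rw [← Finset.sum_filter, Finset.sum_const, nsmul_eq_mul, closePairs]
          ring
  have hcs := Finset.sum_sq_le_sum_mul_sum_of_sq_le_mul (𝒮.sigma (hitPrimes Y lam))
    (r := fun i => (∏ p ∈ i.1, w p) * w i.2 * f i.1 i.2)
    (f := fun i => (∏ p ∈ i.1, w p) * w i.2)
    (g := fun i => (∏ p ∈ i.1, w p) * w i.2 * f i.1 i.2 ^ 2)
    (fun i _ => mul_nonneg (hW _) (h.nonneg _))
    (fun i _ => mul_nonneg (mul_nonneg (hW _) (h.nonneg _)) (sq_nonneg _))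
    (fun i _ => le_of_eq (by ring))
  have hfst : ∑ i ∈ 𝒮.sigma (hitPrimes Y lam), (∏ p ∈ i.1, w p) * w i.2 =
      ∑ S ∈ 𝒮, (∏ p ∈ S, w p) * ∑ q ∈ hitPrimes Y lam S, w q := by
    rw [Finset.sum_sigma]
    exact Finset.sum_congr rfl fun S _ => by rw [Finset.mul_sum]
  rw [hfst] at hcs
  have hlam0 : 0 ≤ lam / Y / 4 := by
    have : 0 ≤ lam := by linarith
    positivity
  calc _ ≤ _ := pow_le_pow_left₀ (mul_nonneg hlam0 (Finset.sum_nonneg fun S _ =>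
        mul_nonneg (hW S) (by positivity))) hlow 2
    _ ≤ _ := hcs
    _ ≤ _ := mul_le_mul_of_nonneg_left hup (Finset.sum_nonneg fun S _ =>
        mul_nonneg (hW S) (Finset.sum_nonneg fun q _ => h.nonneg q))

/-- The members of `pathSets l J J` whose product is not much larger than `exp (2 ^ J * l)`. -/
noncomputable def lightSets (l : ℝ) (J : ℕ) : Finset (Finset ℕ) :=
  (pathSets l J J).filter fun S => logSum S ≤ 8 * Real.exp 6 / Real.log 2 * (2 ^ J * l)

theorem MertensWeight.exists_le_sum_hitPrimes {w : ℕ → ℝ} {g C : ℝ} (h : MertensWeight w g C)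
    {K : ℝ} (hK : 0 ≤ K) : ∃ c, 0 < c ∧ ∀ l lam Y : ℝ, 1 ≤ l → 4 * (C + 2 * g) ≤ l →
      2 * C ≤ lam → lam ≤ K * l → lam ≤ Y → ∀ J : ℕ, 1 ≤ J →
      8 * Real.exp 6 / Real.log 2 * (2 ^ J * l) ≤ Y / 2 →
      c * (lam / Y) * ((2 * Real.exp 1 * Real.log 2) ^ J * decay J) ≤
        ∑ S ∈ lightSets l J, (∏ p ∈ S, w p) * ∑ q ∈ hitPrimes Y lam S, w q := by
  obtain ⟨B, hB, hclose⟩ := h.exists_sum_closePairs_le hK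
  refine ⟨Real.exp (-8) / (256 * B), by positivity, ?_⟩
  intro l lam Y hl hC hlam hlamK hlamY J hJ hJY
  have hCp := h.C_pos
  have hlam0 : 0 < lam := by linarith
  have hY : 0 < Y := by linarith
  have h2 : 0 < Real.log 2 := Real.log_pos one_lt_two
  have hW : ∀ S : Finset ℕ, 0 ≤ ∏ p ∈ S, w p := fun S => Finset.prod_nonneg fun p _ => h.nonneg p
  set b := ballotT J J with hb
  set D := (2 * Real.log 2) ^ J * b with hD
  set H := ∑ S ∈ lightSets l J, (∏ p ∈ S, w p) * ∑ q ∈ hitPrimes Y lam S, w q with hH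
  have hsub : lightSets l J ⊆ pathSets l J J := Finset.filter_subset _ _
  have hb1 : Real.exp J * decay J ≤ b := le_ballotT_self J
  have hb0 : 0 < b := lt_of_lt_of_le (mul_pos (Real.exp_pos _) (decay_pos J)) hb1
  have hD0 : 0 < D := by positivity
  have hcs := h.sq_le_sum_hitPrimes_mul hY hlam hlamY (lightSets l J) fun S hS =>
    (Finset.mem_filter.1 hS).2.trans hJY
  rw [← hH] at hcs
  have hS1 : Real.exp (-4) / 2 * D ≤ ∑ S ∈ lightSets l J, (∏ p ∈ S, w p) * 2 ^ S.card := by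
    have h3 := h.le_pathSum hl hC J J
    rw [pathWt_one_eq (by omega) fun _ _ => rfl] at h3
    have h4 := h.pathSum_le_two_mul_sum_filter hl hC hJ
    have h5 : ∑ S ∈ lightSets l J, (∏ p ∈ S, w p) * (2 : ℝ) ^ S.card =
        (∑ S ∈ lightSets l J, ∏ p ∈ S, w p) * 2 ^ J := by
      rw [Finset.sum_mul]
      refine Finset.sum_congr rfl fun S hS => ?_
      rw [(mem_pathSets.1 (hsub hS)).1.2]
    rw [h5]
    have h6 : Real.exp (-4) * (Real.log 2 ^ J * b) ≤ 2 * ∑ S ∈ lightSets l J, ∏ p ∈ S, w p :=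
      h3.trans h4
    calc _ = Real.exp (-4) * (Real.log 2 ^ J * b) / 2 * 2 ^ J := by rw [hD, mul_pow]; ring
      _ ≤ _ := mul_le_mul_of_nonneg_right (by linarith) (by positivity)
  have hS2 : ∑ S ∈ lightSets l J, (∏ p ∈ S, w p) * (closePairs lam S).card ≤ B * D :=
    (Finset.sum_le_sum_of_subset_of_nonneg hsub fun S _ _ =>
      mul_nonneg (hW S) (Nat.cast_nonneg _)).trans (hclose l lam hl hC hlam0.le hlamK J hJ)
  have hH0 : 0 ≤ H := Finset.sum_nonneg fun S _ =>
    mul_nonneg (hW S) (Finset.sum_nonneg fun q _ => h.nonneg q)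
  have hr : 0 < lam / Y := by positivity
  have hmain : (lam / Y / 4 * (Real.exp (-4) / 2 * D)) ^ 2 ≤ H * (4 * (lam / Y) * (B * D)) := by
    refine le_trans ?_ (hcs.trans ?_)
    · exact pow_le_pow_left₀ (by positivity) (mul_le_mul_of_nonneg_left hS1 (by positivity)) 2
    · gcongr
  have hkey : Real.exp (-8) / (256 * B) * (lam / Y) * D ≤ H := by
    have e8 : Real.exp (-8) = Real.exp (-4) ^ 2 := by rw [← Real.exp_nat_mul]; norm_num
    have hpos : 0 < 4 * (lam / Y) * (B * D) := by positivity
    refine le_of_mul_le_mul_right (le_trans (le_of_eq ?_) hmain) hpos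
    rw [e8]
    field_simp
    ring
  refine le_trans ?_ hkey
  refine mul_le_mul_of_nonneg_left ?_ (by positivity)
  calc (2 * Real.exp 1 * Real.log 2) ^ J * decay J
      = (2 * Real.log 2) ^ J * (Real.exp J * decay J) := by
        rw [show 2 * Real.exp 1 * Real.log 2 = 2 * Real.log 2 * Real.exp 1 by ring, mul_pow _ (Real.exp 1),
          ← Real.exp_nat_mul, mul_one]
        ring
    _ ≤ _ := mul_le_mul_of_nonneg_left hb1 (by positivity)

end

section

/-- The primes of positive weight whose logarithm lies in `(c / 100, (c + 1) / 100]`. -/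
noncomputable def goodCell (w : ℕ → ℝ) (c : ℕ) : Finset ℕ :=
  (primesLog (c / 100) ((c + 1) / 100)).filter fun p => 0 < w p

theorem disjoint_goodCell (w : ℕ → ℝ) {i j : ℕ} (hij : i ≠ j) :
    Disjoint (goodCell w i) (goodCell w j) := by
  have key : ∀ {i j : ℕ}, i < j → Disjoint (goodCell w i) (goodCell w j) := by
    intro i j h
    refine Finset.disjoint_left.2 fun p hp hp' => ?_
    have h1 := (mem_primesLog.1 (Finset.mem_filter.1 hp).1).2.2
    have h2 := (mem_primesLog.1 (Finset.mem_filter.1 hp').1).2.1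
    have h3 : (i : ℝ) + 1 ≤ j := by exact_mod_cast h
    linarith
  rcases lt_or_gt_of_ne hij with h | h
  · exact key h
  · exact (key h).symm

theorem MertensWeight.sum_range_sum_goodCell {w : ℕ → ℝ} {g C : ℝ} (h : MertensWeight w g C)
    (N : ℕ) : ∑ c ∈ Finset.range N, ∑ p ∈ goodCell w c, w p =
      ∑ p ∈ primesLog 0 (N / 100), w p := by
  induction N with
  | zero =>
    symm
    simp only [Finset.range_zero, Finset.sum_empty]
    refine Finset.sum_eq_zero fun p hp => ?_
    obtain ⟨-, h1, h2⟩ := mem_primesLog.1 hp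
    norm_num at h2
    linarith
  | succ N ih =>
    have e : ∑ p ∈ goodCell w N, w p =
        ∑ p ∈ primesLog ((N : ℝ) / 100) (((N : ℝ) + 1) / 100), w p := by
      refine Finset.sum_subset (Finset.filter_subset _ _) fun p hp hp' => ?_
      exact le_antisymm (not_lt.1 fun hlt => hp' (Finset.mem_filter.2 ⟨hp, hlt⟩)) (h.nonneg p)
    rw [Finset.sum_range_succ, ih, e, Nat.cast_succ,
      ← primesLog_union (a := 0) (b := (N : ℝ) / 100) (c := ((N : ℝ) + 1) / 100) (by positivity) (by linarith),
      Finset.sum_union (disjoint_primesLog le_rfl)]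

theorem MertensWeight.exists_swap {w : ℕ → ℝ} {g C : ℝ} (h : MertensWeight w g C) (c : ℕ) :
    ∃ lo hi : Finset ℕ, lo ⊆ goodCell w c ∧ hi ⊆ goodCell w c ∧ logSum lo ≤ logSum hi ∧
      logSum hi ≤ logSum lo + 1 / 100 ∧
      (∑ p ∈ goodCell w c, w p) / (2 * g) - Real.exp (-1 / 100) ^ c ≤ logSum hi - logSum lo := by
  have hg := h.one_le
  rcases (goodCell w c).eq_empty_or_nonempty with he | hne
  · refine ⟨∅, ∅, by simp, by simp, le_rfl, by linarith [logSum_nonneg (d := ∅)], ?_⟩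
    rw [he, Finset.sum_empty, zero_div, sub_self]
    linarith [pow_pos (Real.exp_pos (-1 / 100)) c]
  set a := (goodCell w c).min' hne with ha
  set b := (goodCell w c).max' hne with hb
  have hmem : ∀ p ∈ goodCell w c, p.Prime ∧ (c : ℝ) / 100 < Real.log p ∧
      Real.log p ≤ (c + 1) / 100 := fun p hp => mem_primesLog.1 (Finset.mem_filter.1 hp).1
  have ham : a ∈ goodCell w c := Finset.min'_mem _ _
  have hbm : b ∈ goodCell w c := Finset.max'_mem _ _
  have hab : a ≤ b := Finset.min'_le _ _ hbm
  obtain ⟨hap, ha1, ha2⟩ := hmem a ham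
  obtain ⟨hbp, hb1, hb2⟩ := hmem b hbm
  have ha0 : (0 : ℝ) < a := by exact_mod_cast hap.pos
  have hb0 : (0 : ℝ) < b := by exact_mod_cast hbp.pos
  have hab' : (a : ℝ) ≤ b := by exact_mod_cast hab
  refine ⟨{a}, {b}, by simpa using ham, by simpa using hbm, ?_⟩
  simp only [logSum, Finset.sum_singleton]
  refine ⟨Real.log_le_log ha0 hab', by linarith, ?_⟩
  have hcard : ((goodCell w c).card : ℝ) ≤ b - a + 1 := by
    have h1 : goodCell w c ⊆ Finset.Icc a b := fun p hp =>
      Finset.mem_Icc.2 ⟨Finset.min'_le _ _ hp, Finset.le_max' _ _ hp⟩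
    have h2 := Finset.card_le_card h1
    rw [Nat.card_Icc] at h2
    have h3 : (goodCell w c).card + a ≤ b + 1 := by omega
    have h4 : ((goodCell w c).card : ℝ) + a ≤ b + 1 := by exact_mod_cast h3
    linarith
  have hsum : ∑ p ∈ goodCell w c, w p ≤ (b - a + 1) * (g / a) := by
    calc ∑ p ∈ goodCell w c, w p ≤ ∑ _p ∈ goodCell w c, g / a := by
          refine Finset.sum_le_sum fun p hp => (h.le_div p (hmem p hp).1).trans ?_
          have : (a : ℝ) ≤ p := by exact_mod_cast Finset.min'_le _ _ hp
          gcongr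
      _ = (goodCell w c).card * (g / a) := by rw [Finset.sum_const, nsmul_eq_mul]
      _ ≤ _ := by gcongr
  have hba : (b : ℝ) ≤ 2 * a := by
    have h1 : Real.log b ≤ Real.log (2 * a) := by
      rw [Real.log_mul two_ne_zero ha0.ne']
      linarith [Real.log_two_gt_d9]
    exact (Real.log_le_log_iff hb0 (by positivity)).1 h1
  have hbexp : 1 / (b : ℝ) ≤ Real.exp (-1 / 100) ^ c := by
    rw [← Real.exp_nat_mul, one_div, ← Real.exp_log hb0, ← Real.exp_neg]
    refine Real.exp_le_exp.2 ?_
    linarith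
  have hgap : (b - a) / (b : ℝ) ≤ Real.log b - Real.log a := by
    have h1 := Real.log_le_sub_one_of_pos (show 0 < (a : ℝ) / b by positivity)
    rw [Real.log_div ha0.ne' hb0.ne'] at h1
    rw [sub_div, div_self hb0.ne']
    linarith
  have hfin : (∑ p ∈ goodCell w c, w p) / (2 * g) ≤ (b - a + 1) / b := by
    calc _ ≤ (b - a + 1) * (g / a) / (2 * g) := by gcongr
      _ = (b - a + 1) / (2 * a) := by field_simp
      _ ≤ _ := by
        refine div_le_div_of_nonneg_left (by linarith) hb0 hba
  rw [add_div] at hfin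
  linarith

/-- Finitely many primes of positive weight have enough subset products to meet every short
logarithmic interval in a window of prescribed length. -/
theorem MertensWeight.exists_dense_logSum {w : ℕ → ℝ} {g C : ℝ} (h : MertensWeight w g C)
    (L : ℝ) : ∃ (T : Finset ℕ) (v₀ : ℝ), 0 ≤ v₀ ∧ (∀ p ∈ T, p.Prime ∧ 0 < w p) ∧
      ∀ v, v₀ ≤ v → v ≤ v₀ + L → ∃ d ⊆ T, v < logSum d ∧ logSum d ≤ v + 1 / 100 := by
  have hg := h.one_le
  choose lo hi hlo hhi hle hstep hgap using h.exists_swap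
  set r := Real.exp (-1 / 100) with hr
  have hr0 : 0 < r := Real.exp_pos _
  have hr1 : r < 1 := by rw [hr, Real.exp_lt_one_iff]; norm_num
  set M := 2 * g * (L + 1 + 1 / (1 - r)) with hM
  obtain ⟨N, hN⟩ := exists_nat_ge (100 * Real.exp (|M| + C))
  have hN1 : (1 : ℝ) ≤ N / 100 := by
    have := Real.one_le_exp (show 0 ≤ |M| + C by linarith [abs_nonneg M, h.C_pos])
    linarith
  have hW : M ≤ ∑ c ∈ Finset.range N, ∑ p ∈ goodCell w c, w p := by
    rw [h.sum_range_sum_goodCell]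
    have h1 := (abs_le.1 (h.abs_sum_sub_log_le one_pos hN1)).1
    have h2 : |M| + C ≤ Real.log (N / 100 / 1) := by
      rw [Real.le_log_iff_exp_le (by positivity)]
      linarith
    have h3 : ∑ p ∈ primesLog 1 (N / 100), w p ≤ ∑ p ∈ primesLog 0 (N / 100), w p := by
      refine Finset.sum_le_sum_of_subset_of_nonneg (fun p hp => ?_) fun p _ _ => h.nonneg p
      obtain ⟨h4, h5, h6⟩ := mem_primesLog.1 hp
      exact mem_primesLog.2 ⟨h4, by linarith, h6⟩
    have h4 := le_abs_self M
    linarith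
  set x : ℕ → ℕ → Finset ℕ := fun k i => if i < k then hi i else lo i with hx
  have hxs : ∀ k i, x k i ⊆ goodCell w i := fun k i => by
    simp only [hx]
    split_ifs
    · exact hhi i
    · exact hlo i
  set D : ℕ → Finset ℕ := fun k => (Finset.range N).biUnion (x k) with hD
  have hDsum : ∀ k, logSum (D k) = ∑ i ∈ Finset.range N, logSum (x k i) := fun k =>
    Finset.sum_biUnion fun i _ j _ hij =>
      (disjoint_goodCell w hij).mono (hxs k i) (hxs k j)
  have hsucc : ∀ k, logSum (D (k + 1)) ≤ logSum (D k) + 1 / 100 := by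
    intro k
    rw [hDsum, hDsum, ← sub_le_iff_le_add', ← Finset.sum_sub_distrib]
    calc ∑ i ∈ Finset.range N, (logSum (x (k + 1) i) - logSum (x k i))
        ≤ ∑ i ∈ Finset.range N, if i = k then 1 / 100 else 0 := by
          refine Finset.sum_le_sum fun i _ => ?_
          simp only [hx]
          rcases lt_trichotomy i k with hik | hik | hik
          · rw [if_pos (by omega), if_pos hik, if_neg (by omega), sub_self]
          · rw [if_pos (by omega), if_neg (by omega), if_pos hik]
            linarith [hstep i]
          · rw [if_neg (by omega), if_neg (by omega), if_neg (by omega), sub_self]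
      _ ≤ 1 / 100 := by
          rw [Finset.sum_ite_eq']
          split_ifs <;> norm_num
  have htop : logSum (D 0) + L < logSum (D N) := by
    rw [hDsum, hDsum]
    have h1 : ∑ i ∈ Finset.range N, ((∑ p ∈ goodCell w i, w p) / (2 * g) - r ^ i) ≤
        ∑ i ∈ Finset.range N, (logSum (x N i) - logSum (x 0 i)) := by
      refine Finset.sum_le_sum fun i hi' => ?_
      simp only [hx]
      rw [if_pos (Finset.mem_range.1 hi'), if_neg (by omega)]
      exact hgap i
    rw [Finset.sum_sub_distrib, Finset.sum_sub_distrib, ← Finset.sum_div] at h1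
    have h2 : ∑ i ∈ Finset.range N, r ^ i ≤ 1 / (1 - r) := by
      rw [geom_sum_eq hr1.ne, ← neg_div_neg_eq, neg_sub, neg_sub]
      have := pow_pos hr0 N
      exact div_le_div_of_nonneg_right (by linarith) (by linarith)
    have h3 : L + 1 + 1 / (1 - r) ≤
        (∑ c ∈ Finset.range N, ∑ p ∈ goodCell w c, w p) / (2 * g) := by
      rw [le_div_iff₀ (by positivity), mul_comm]
      exact hW
    linarith
  refine ⟨(Finset.range N).biUnion (goodCell w), logSum (D 0), logSum_nonneg, fun p hp => ?_,
    fun v hv hvL => ?_⟩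
  · obtain ⟨i, -, hi'⟩ := Finset.mem_biUnion.1 hp
    obtain ⟨h1, h2⟩ := Finset.mem_filter.1 hi'
    exact ⟨(mem_primesLog.1 h1).1, h2⟩
  · have hex : ∃ k, v < logSum (D k) := ⟨N, by linarith⟩
    obtain ⟨k, hk⟩ : ∃ k, Nat.find hex = k + 1 := by
      refine Nat.exists_eq_succ_of_ne_zero fun h0 => ?_
      have := Nat.find_spec hex
      rw [h0] at this
      linarith
    have h1 := Nat.find_spec hex
    have h2 := Nat.find_min hex (show k < Nat.find hex by omega)
    rw [hk] at h1
    refine ⟨D (k + 1), ?_, h1, ?_⟩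
    · exact Finset.biUnion_mono fun i _ => hxs _ i
    · linarith [hsucc k, not_lt.1 h2]

end

section

/-- The integers `k` in `(x₁, x₂]` for which every prime of `T`, and no other prime with logarithm
in `(l, 2 ^ n * l]`, divides `F k`. -/
noncomputable def siftedSet (F : Polynomial ℤ) (l : ℝ) (n : ℕ) (x₁ x₂ : ℝ) (T : Finset ℕ) :
    Finset ℕ :=
  (Finset.Ioc ⌊x₁⌋₊ ⌊x₂⌋₊).filter fun k => (∀ p ∈ T, (p : ℤ) ∣ F.eval (k : ℤ)) ∧
    ∀ p ∈ primesLog l (2 ^ n * l) \ T, ¬(p : ℤ) ∣ F.eval (k : ℤ)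

theorem mem_siftedSet {F : Polynomial ℤ} {l : ℝ} {n : ℕ} {x₁ x₂ : ℝ} {T : Finset ℕ} {k : ℕ} :
    k ∈ siftedSet F l n x₁ x₂ T ↔ (⌊x₁⌋₊ < k ∧ k ≤ ⌊x₂⌋₊) ∧
      (∀ p ∈ T, (p : ℤ) ∣ F.eval (k : ℤ)) ∧
      ∀ p ∈ primesLog l (2 ^ n * l), p ∉ T → ¬(p : ℤ) ∣ F.eval (k : ℤ) := by
  simp only [siftedSet, Finset.mem_filter, Finset.mem_Ioc, Finset.mem_sdiff, and_imp]

theorem exists_le_card_siftedSet {F : Polynomial ℤ} {g C : ℝ}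
    (hW : MertensWeight (fun p => (polyRho F p : ℝ) / p) g C) :
    ∃ l₀ c K : ℝ, 0 < c ∧ 0 < K ∧ 1 ≤ l₀ ∧ ∀ l, l₀ ≤ l → ∀ (n : ℕ) (T : Finset ℕ) (x₁ x₂ : ℝ),
      0 ≤ x₁ → x₁ ≤ x₂ → (∀ p ∈ T, p.Prime) →
      c * ((x₂ - x₁) * ∏ p ∈ T, (polyRho F p : ℝ) / p) / 2 ^ n -
        g ^ T.card * Real.exp (K * (2 ^ n * l)) ≤ ((siftedSet F l n x₁ x₂ T).card : ℝ) := by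
  obtain ⟨l₀, c, K, hc, hK, hl₀, h⟩ := exists_sifted_count_le hW
  refine ⟨l₀, c, K, hc, hK, hl₀, fun l hl n T x₁ x₂ h1 h2 hT => ?_⟩
  have := h l hl n T 1 0 x₁ x₂ h1 h2 one_pos hT (fun p _ => Nat.coprime_one_left p)
    (fun p _ => Nat.coprime_one_left p)
  rw [Nat.cast_one, div_one] at this
  refine this.trans (Nat.cast_le.2 (Finset.card_le_card fun k hk => ?_))
  simp only [siftedSet, Finset.mem_filter] at hk ⊢
  exact ⟨hk.1, hk.2.1.2, hk.2.2⟩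

theorem eq_filter_of_mem_siftedSet {F : Polynomial ℤ} {l : ℝ} {J n : ℕ} {x₁ x₂ : ℝ}
    {T₀ S : Finset ℕ} {q k : ℕ} (hl : 0 ≤ l) (hJn : J ≤ n) (hS : S ⊆ primesLog l (2 ^ J * l))
    (hT₀ : ∀ p ∈ T₀, Real.log p ≤ l) (hq : 2 ^ J * l < Real.log q)
    (hk : k ∈ siftedSet F l n x₁ x₂ (insert q (T₀ ∪ S))) :
    S = (primesLog l (2 ^ J * l)).filter fun p : ℕ => (p : ℤ) ∣ F.eval (k : ℤ) := by
  obtain ⟨-, h1, h2⟩ := mem_siftedSet.1 hk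
  ext p
  rw [Finset.mem_filter]
  constructor
  · intro hp
    exact ⟨hS hp, h1 p (Finset.mem_insert_of_mem (Finset.mem_union_right _ hp))⟩
  · rintro ⟨hp, hpk⟩
    by_contra hpS
    obtain ⟨-, h3, h4⟩ := mem_primesLog.1 hp
    refine h2 p (primesLog_mono hl hJn hp) (fun hmem => ?_) hpk
    rcases Finset.mem_insert.1 hmem with rfl | hmem
    · linarith
    · rcases Finset.mem_union.1 hmem with hmem | hmem
      · linarith [hT₀ p hmem]
      · exact hpS hmem

theorem sum_card_siftedSet_le {F : Polynomial ℤ} {l : ℝ} {J n M : ℕ} {x₁ x₂ : ℝ}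
    {T₀ : Finset ℕ} {𝒮 : Finset (Finset ℕ)} {Q : Finset ℕ → Finset ℕ} (hl : 0 ≤ l) (hJn : J ≤ n)
    (h𝒮 : ∀ S ∈ 𝒮, S ⊆ primesLog l (2 ^ J * l)) (hT₀ : ∀ p ∈ T₀, Real.log p ≤ l)
    (hQ : ∀ S ∈ 𝒮, ∀ q ∈ Q S, 2 ^ J * l < Real.log q)
    (hM : ∀ S ∈ 𝒮, ∀ k, ((Q S).filter fun q =>
      k ∈ siftedSet F l n x₁ x₂ (insert q (T₀ ∪ S))).card ≤ M) :
    ∑ S ∈ 𝒮, ∑ q ∈ Q S, (siftedSet F l n x₁ x₂ (insert q (T₀ ∪ S))).card ≤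
      M * (𝒮.biUnion fun S => (Q S).biUnion fun q =>
        siftedSet F l n x₁ x₂ (insert q (T₀ ∪ S))).card := by
  set U := 𝒮.biUnion fun S => (Q S).biUnion fun q =>
    siftedSet F l n x₁ x₂ (insert q (T₀ ∪ S)) with hU
  set r : (Σ _ : Finset ℕ, ℕ) → ℕ → Prop := fun i k =>
    k ∈ siftedSet F l n x₁ x₂ (insert i.2 (T₀ ∪ i.1)) with hr
  have h1 : ∑ S ∈ 𝒮, ∑ q ∈ Q S, (siftedSet F l n x₁ x₂ (insert q (T₀ ∪ S))).card =
      ∑ i ∈ 𝒮.sigma Q, (U.bipartiteAbove r i).card := by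
    rw [Finset.sum_sigma]
    refine Finset.sum_congr rfl fun S hS => Finset.sum_congr rfl fun q hq => ?_
    congr 1
    ext k
    rw [Finset.mem_bipartiteAbove]
    refine ⟨fun hk => ⟨?_, hk⟩, fun hk => hk.2⟩
    exact Finset.mem_biUnion.2 ⟨S, hS, Finset.mem_biUnion.2 ⟨q, hq, hk⟩⟩
  rw [h1, Finset.sum_card_bipartiteAbove_eq_sum_card_bipartiteBelow, mul_comm]
  refine Finset.sum_le_card_nsmul U _ M fun k hk => ?_
  obtain ⟨S, hS, hk'⟩ := Finset.mem_biUnion.1 hk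
  obtain ⟨q, hq, hk'⟩ := Finset.mem_biUnion.1 hk'
  have hSk := eq_filter_of_mem_siftedSet hl hJn (h𝒮 S hS) hT₀ (hQ S hS q hq) hk'
  refine le_trans (Finset.card_le_card_of_injOn (fun i => i.2) ?_ ?_) (hM S hS k)
  · rintro ⟨S', q'⟩ hi
    obtain ⟨h2, h3⟩ := Finset.mem_bipartiteBelow _ |>.1 (Finset.mem_coe.1 hi)
    obtain ⟨h4, h5⟩ := Finset.mem_sigma.1 h2
    have hSk' := eq_filter_of_mem_siftedSet hl hJn (h𝒮 S' h4) hT₀ (hQ S' h4 q' h5) h3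
    have e : S' = S := hSk'.trans hSk.symm
    subst e
    exact Finset.mem_coe.2 (Finset.mem_filter.2 ⟨h5, h3⟩)
  · rintro ⟨S₁, q₁⟩ hi ⟨S₂, q₂⟩ hj hij
    obtain ⟨h2, h3⟩ := Finset.mem_bipartiteBelow _ |>.1 (Finset.mem_coe.1 hi)
    obtain ⟨h4, h5⟩ := Finset.mem_sigma.1 h2
    obtain ⟨h2', h3'⟩ := Finset.mem_bipartiteBelow _ |>.1 (Finset.mem_coe.1 hj)
    obtain ⟨h4', h5'⟩ := Finset.mem_sigma.1 h2'
    have e1 := eq_filter_of_mem_siftedSet hl hJn (h𝒮 S₁ h4) hT₀ (hQ S₁ h4 q₁ h5) h3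
    have e2 := eq_filter_of_mem_siftedSet hl hJn (h𝒮 S₂ h4') hT₀ (hQ S₂ h4' q₂ h5') h3'
    have e : S₁ = S₂ := e1.trans e2.symm
    subst e
    dsimp only at hij
    rw [hij]

theorem card_filter_mem_siftedSet_le_one {F : Polynomial ℤ} {l : ℝ} {J n : ℕ} {x₁ x₂ : ℝ}
    {T₀ S Q : Finset ℕ} (hl : 0 ≤ l) (hS : S ⊆ primesLog l (2 ^ J * l))
    (hT₀ : ∀ p ∈ T₀, Real.log p ≤ l)
    (hQ : ∀ q ∈ Q, q.Prime ∧ 2 ^ J * l < Real.log q ∧ Real.log q ≤ 2 ^ n * l) (k : ℕ) :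
    (Q.filter fun q => k ∈ siftedSet F l n x₁ x₂ (insert q (T₀ ∪ S))).card ≤ 1 := by
  refine Finset.card_le_one.2 fun q hq q' hq' => ?_
  obtain ⟨h1, h2⟩ := Finset.mem_filter.1 hq
  obtain ⟨h1', h2'⟩ := Finset.mem_filter.1 hq'
  obtain ⟨h3, h4, h5⟩ := hQ q h1
  have hlJ : l ≤ 2 ^ J * l := le_mul_of_one_le_left hl (one_le_pow₀ one_le_two)
  by_contra hne
  refine (mem_siftedSet.1 h2').2.2 q (mem_primesLog.2 ⟨h3, by linarith, h5⟩) (fun hmem => ?_)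
    ((mem_siftedSet.1 h2).2.1 q (Finset.mem_insert_self _ _))
  rcases Finset.mem_insert.1 hmem with e | hmem
  · exact hne e
  · rcases Finset.mem_union.1 hmem with hmem | hmem
    · linarith [hT₀ q hmem]
    · linarith [(mem_primesLog.1 (hS hmem)).2.2]

theorem prod_primes_dvd_eval {F : Polynomial ℤ} {T : Finset ℕ} {k : ℕ} (hT : ∀ p ∈ T, p.Prime)
    (h : ∀ p ∈ T, (p : ℤ) ∣ F.eval (k : ℤ)) : ((∏ p ∈ T, p : ℕ) : ℤ) ∣ F.eval (k : ℤ) := by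
  rw [Int.natCast_dvd]
  exact Finset.prod_primes_dvd _ (fun p hp => (hT p hp).prime) fun p hp => Int.natCast_dvd.1 (h p hp)

theorem log_prod_eq_logSum {T : Finset ℕ} (hT : ∀ p ∈ T, p.Prime) :
    Real.log ((∏ p ∈ T, p : ℕ) : ℝ) = logSum T := by
  rw [Nat.cast_prod, Real.log_prod fun p hp => Nat.cast_ne_zero.2 (hT p hp).ne_zero, logSum]

theorem logSum_le_log_eval {F : Polynomial ℤ} {T : Finset ℕ} {k : ℕ} (hT : ∀ p ∈ T, p.Prime)
    (h : ∀ p ∈ T, (p : ℤ) ∣ F.eval (k : ℤ)) (h0 : F.eval (k : ℤ) ≠ 0) :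
    logSum T ≤ Real.log (|F.eval (k : ℤ)| : ℤ) := by
  rw [← log_prod_eq_logSum hT]
  have h1 := Int.le_of_dvd (abs_pos.2 h0) ((dvd_abs _ _).2 (prod_primes_dvd_eval hT h))
  have h2 : (((∏ p ∈ T, p : ℕ) : ℤ) : ℝ) ≤ ((|F.eval (k : ℤ)| : ℤ) : ℝ) := Int.cast_le.2 h1
  rw [Int.cast_natCast] at h2
  exact Real.log_le_log (Nat.cast_pos.2 (Finset.prod_pos fun p hp => (hT p hp).pos)) h2

theorem eval_ne_zero_of_irreducible {F : Polynomial ℤ} (hF : Irreducible F) (hdeg : 2 ≤ F.natDegree)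
    (k : ℤ) : F.eval k ≠ 0 := by
  intro h
  obtain ⟨G, hG⟩ := Polynomial.dvd_iff_isRoot.2 h
  rcases hF.isUnit_or_isUnit hG with hu | hu
  · have := Polynomial.natDegree_eq_zero_of_isUnit hu
    rw [Polynomial.natDegree_X_sub_C] at this
    omega
  · have h1 := Polynomial.natDegree_eq_zero_of_isUnit hu
    have h2 : F.natDegree ≤ (Polynomial.X - Polynomial.C k).natDegree + G.natDegree := by
      rw [hG]
      exact Polynomial.natDegree_mul_le
    rw [Polynomial.natDegree_X_sub_C, h1] at h2
    omega

theorem exists_log_eval_le (F : Polynomial ℤ) : ∃ B : ℝ, 0 < B ∧ ∀ k : ℕ, 0 < k →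
    F.eval (k : ℤ) ≠ 0 → Real.log (|F.eval (k : ℤ)| : ℤ) ≤ B + F.natDegree * Real.log k := by
  set A : ℝ := 1 + ∑ i ∈ Finset.range (F.natDegree + 1), |(F.coeff i : ℝ)| with hA
  have hA1 : 1 ≤ A := le_add_of_nonneg_right (Finset.sum_nonneg fun i _ => abs_nonneg _)
  refine ⟨Real.log A + 1, by linarith [Real.log_nonneg hA1], fun k hk h0 => ?_⟩
  have hk1 : (1 : ℝ) ≤ k := by exact_mod_cast hk
  have h1 : ((|F.eval (k : ℤ)| : ℤ) : ℝ) ≤ A * (k : ℝ) ^ F.natDegree := by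
    rw [Polynomial.eval_eq_sum_range, Int.cast_abs, Int.cast_sum]
    calc _ ≤ ∑ i ∈ Finset.range (F.natDegree + 1), |((F.coeff i * (k : ℤ) ^ i : ℤ) : ℝ)| :=
          Finset.abs_sum_le_sum_abs _ _
      _ ≤ ∑ i ∈ Finset.range (F.natDegree + 1), |(F.coeff i : ℝ)| * (k : ℝ) ^ F.natDegree := by
          refine Finset.sum_le_sum fun i hi => ?_
          rw [Int.cast_mul, Int.cast_pow, Int.cast_natCast, abs_mul, abs_pow, Nat.abs_cast]
          have := Finset.mem_range.1 hi
          gcongr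
          omega
      _ = (∑ i ∈ Finset.range (F.natDegree + 1), |(F.coeff i : ℝ)|) * (k : ℝ) ^ F.natDegree := by
          rw [Finset.sum_mul]
      _ ≤ _ := by
          gcongr
          linarith
  have h2 : (0 : ℝ) < (|F.eval (k : ℤ)| : ℤ) := Int.cast_pos.2 (abs_pos.2 h0)
  have h3 := Real.log_le_log h2 h1
  rw [Real.log_mul (by positivity) (by positivity), Real.log_pow] at h3
  linarith

theorem card_filter_mem_siftedSet_le {F : Polynomial ℤ} (hF : Irreducible F)
    (hdeg : 2 ≤ F.natDegree) {B : ℝ} (hB : ∀ k : ℕ, 0 < k →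
    F.eval (k : ℤ) ≠ 0 → Real.log (|F.eval (k : ℤ)| : ℤ) ≤ B + F.natDegree * Real.log k)
    {l : ℝ} {n : ℕ} {x₁ x₂ v : ℝ} {T₀ S Q : Finset ℕ} (hx₂ : 0 < x₂)
    (hv : 0 < v) (hQ : ∀ q ∈ Q, q.Prime ∧ v ≤ Real.log q) (k : ℕ) :
    ((Q.filter fun q => k ∈ siftedSet F l n x₁ x₂ (insert q (T₀ ∪ S))).card : ℝ) ≤
      max 0 ((B + F.natDegree * Real.log x₂) / v) := by
  set R := Q.filter fun q => k ∈ siftedSet F l n x₁ x₂ (insert q (T₀ ∪ S)) with hR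
  rcases R.eq_empty_or_nonempty with he | ⟨q, hq⟩
  · rw [he, Finset.card_empty, Nat.cast_zero]
    exact le_max_left _ _
  · refine le_max_of_le_right ?_
    obtain ⟨⟨hk1, hk2⟩, -, -⟩ := mem_siftedSet.1 (Finset.mem_filter.1 hq).2
    have hk0 : 0 < k := by omega
    have hkx : (k : ℝ) ≤ x₂ := (Nat.le_floor_iff hx₂.le).1 hk2
    have h0 := eval_ne_zero_of_irreducible hF hdeg k
    have h1 : logSum R ≤ Real.log (|F.eval (k : ℤ)| : ℤ) :=
      logSum_le_log_eval (fun p hp => (hQ p (Finset.mem_filter.1 hp).1).1) (fun p hp =>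
        (mem_siftedSet.1 (Finset.mem_filter.1 hp).2).2.1 p (Finset.mem_insert_self _ _)) h0
    have h2 : R.card * v ≤ logSum R := by
      rw [logSum, ← nsmul_eq_mul]
      exact Finset.card_nsmul_le_sum _ _ _ fun p hp => (hQ p (Finset.mem_filter.1 hp).1).2
    have h3 : Real.log k ≤ Real.log x₂ := Real.log_le_log (by exact_mod_cast hk0) hkx
    have h4 : (F.natDegree : ℝ) * Real.log k ≤ F.natDegree * Real.log x₂ := by gcongr
    rw [le_div_iff₀ hv]
    linarith [hB k hk0 h0]

theorem card_le_polyH_sub (F : Polynomial ℤ) {x y z : ℝ} (hx : 0 ≤ x) (U : Finset ℕ)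
    (hU : ∀ k ∈ U, (⌊x / 2⌋₊ < k ∧ k ≤ ⌊x⌋₊) ∧ ∃ d : ℕ, 0 < d ∧ (d : ℤ) ∣ F.eval (k : ℤ) ∧
      y < (d : ℝ) ∧ (d : ℝ) ≤ z) :
    (U.card : ℝ) ≤ (polyH F x y z : ℝ) - (polyH F (x / 2) y z : ℝ) := by
  rw [le_sub_iff_add_le, ← Nat.cast_add, Nat.cast_le, polyH, polyH, ← Set.ncard_coe_finset]
  have hfin : ∀ t : ℝ, {n : ℕ | 0 < n ∧ (n : ℝ) ≤ t ∧
      ∃ d : ℕ, 0 < d ∧ (d : ℤ) ∣ F.eval (n : ℤ) ∧ y < (d : ℝ) ∧ (d : ℝ) ≤ z}.Finite := fun t =>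
    (Set.finite_le_nat ⌊t⌋₊).subset fun n hn => Nat.le_floor hn.2.1
  rw [← Set.ncard_union_eq ?_ U.finite_toSet (hfin _)]
  · refine Set.ncard_le_ncard ?_ (hfin _)
    rintro k (hk | hk)
    · obtain ⟨⟨h1, h2⟩, h3⟩ := hU k (Finset.mem_coe.1 hk)
      exact ⟨by omega, (Nat.le_floor_iff hx).1 h2, h3⟩
    · obtain ⟨h1, h2, h3⟩ := hk
      exact ⟨h1, by linarith, h3⟩
  · refine Set.disjoint_left.2 fun k hk hk' => ?_
    obtain ⟨⟨h1, -⟩, -⟩ := hU k (Finset.mem_coe.1 hk)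
    have h2 : k ≤ ⌊x / 2⌋₊ := Nat.le_floor hk'.2.1
    omega

end

section

theorem sum_insert_union_eq {T₀ S : Finset ℕ} {q : ℕ} {l X : ℝ} (hlX : l ≤ X)
    (hT₀ : ∀ p ∈ T₀, Real.log p ≤ l) (hS : ∀ p ∈ S, l < Real.log p ∧ Real.log p ≤ X)
    (hq : X < Real.log q) : q ∉ T₀ ∪ S ∧ Disjoint T₀ S := by
  refine ⟨fun h => ?_, Finset.disjoint_left.2 fun p hp hp' => ?_⟩
  · rcases Finset.mem_union.1 h with h | h
    · linarith [hT₀ q h]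
    · linarith [hS q h]
  · linarith [hT₀ p hp, hS p hp']

theorem exists_dvd_of_mem_siftedSet {F : Polynomial ℤ} {l L v₀ y η : ℝ} {J n : ℕ} {x₁ x₂ : ℝ}
    {T₀ S : Finset ℕ} {q k : ℕ} (hl : 0 ≤ l) (hL : 0 ≤ L) (hy : 0 < y) (hη : 1 / 100 ≤ η)
    (hS : S ⊆ primesLog l (2 ^ J * l)) (hT₀ : ∀ p ∈ T₀, p.Prime ∧ Real.log p ≤ l)
    (hdense : ∀ v, v₀ ≤ v → v ≤ v₀ + L → ∃ d ⊆ T₀, v < logSum d ∧ logSum d ≤ v + 1 / 100)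
    (hq : q ∈ hitPrimes (Real.log y - v₀ - L) (L + η - 1 / 100) S) (hqJ : 2 ^ J * l < Real.log q)
    (hk : k ∈ siftedSet F l n x₁ x₂ (insert q (T₀ ∪ S))) :
    ∃ d : ℕ, 0 < d ∧ (d : ℤ) ∣ F.eval (k : ℤ) ∧ y < (d : ℝ) ∧ (d : ℝ) ≤ Real.exp η * y := by
  obtain ⟨d, hdS, hqp, h1, h2⟩ := mem_hitPrimes.1 hq
  obtain ⟨e, heT, h3, h4⟩ : ∃ e ⊆ T₀, Real.log y - logSum d - Real.log q < logSum e ∧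
      logSum e ≤ Real.log y - logSum d - Real.log q + η := by
    rcases le_or_gt v₀ (Real.log y - logSum d - Real.log q) with hv | hv
    · obtain ⟨e, h5, h6, h7⟩ := hdense _ hv (by linarith)
      exact ⟨e, h5, h6, by linarith⟩
    · obtain ⟨e, h5, h6, h7⟩ := hdense v₀ le_rfl (by linarith)
      exact ⟨e, h5, by linarith, by linarith⟩
  have hlJ : l ≤ 2 ^ J * l := le_mul_of_one_le_left hl (one_le_pow₀ one_le_two)
  obtain ⟨h5, h6⟩ := sum_insert_union_eq hlJ (fun p hp => (hT₀ p hp).2)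
    (fun p hp => (mem_primesLog.1 (hS hp)).2) hqJ
  have hsum : logSum (insert q (e ∪ d)) = Real.log q + (logSum e + logSum d) := by
    rw [logSum, Finset.sum_insert fun h => h5 (Finset.union_subset_union heT hdS h),
      Finset.sum_union (h6.mono heT hdS), logSum, logSum]
  have hsub : insert q (e ∪ d) ⊆ insert q (T₀ ∪ S) :=
    Finset.insert_subset_insert _ (Finset.union_subset_union heT hdS)
  have hprime : ∀ p ∈ insert q (e ∪ d), p.Prime := by
    intro p hp
    rcases Finset.mem_insert.1 hp with rfl | hp
    · exact hqp
    · rcases Finset.mem_union.1 hp with hp | hp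
      · exact (hT₀ p (heT hp)).1
      · exact (mem_primesLog.1 (hS (hdS hp))).1
  have hpos : 0 < ∏ p ∈ insert q (e ∪ d), p := Finset.prod_pos fun p hp => (hprime p hp).pos
  have hpos' : (0 : ℝ) < ((∏ p ∈ insert q (e ∪ d), p : ℕ) : ℝ) := Nat.cast_pos.2 hpos
  have hlog := log_prod_eq_logSum hprime
  rw [hsum] at hlog
  refine ⟨∏ p ∈ insert q (e ∪ d), p, hpos, prod_primes_dvd_eval hprime fun p hp =>
    (mem_siftedSet.1 hk).2.1 p (hsub hp), ?_, ?_⟩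
  · rw [← Real.log_lt_log_iff hy hpos', hlog]
    linarith
  · rw [← Real.log_le_log_iff hpos' (by positivity), hlog,
      Real.log_mul (Real.exp_ne_zero _) hy.ne', Real.log_exp]
    linarith

theorem exp_neg_logSum_le_prod {F : Polynomial ℤ} {T : Finset ℕ} (hT : ∀ p ∈ T, p.Prime)
    (h0 : ∏ p ∈ T, (polyRho F p : ℝ) / p ≠ 0) :
    Real.exp (-logSum T) ≤ ∏ p ∈ T, (polyRho F p : ℝ) / p := by
  rw [logSum, ← Finset.sum_neg_distrib, Real.exp_sum]
  refine Finset.prod_le_prod (fun p _ => (Real.exp_pos _).le) fun p hp => ?_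
  have hp0 : (0 : ℝ) < p := Nat.cast_pos.2 (hT p hp).pos
  have h1 : polyRho F p ≠ 0 := fun h => Finset.prod_ne_zero_iff.1 h0 p hp (by rw [h]; simp)
  have h2 : (1 : ℝ) ≤ polyRho F p := by exact_mod_cast Nat.one_le_iff_ne_zero.2 h1
  rw [Real.exp_neg, Real.exp_log hp0, ← one_div]
  gcongr

theorem exists_mul_prod_le_card_siftedSet {F : Polynomial ℤ} {g C : ℝ}
    (hW : MertensWeight (fun p => (polyRho F p : ℝ) / p) g C) :
    ∃ l₀ c K E : ℝ, 0 < c ∧ 0 < K ∧ 1 ≤ l₀ ∧ 0 ≤ E ∧ ∀ l, l₀ ≤ l → ∀ (n : ℕ) (T : Finset ℕ)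
      (x : ℝ), 0 < x → (∀ p ∈ T, p.Prime) →
      E + n + g * T.card + K * (2 ^ n * l) + logSum T ≤ Real.log x →
      c * (x * ∏ p ∈ T, (polyRho F p : ℝ) / p) / 2 ^ n ≤
        ((siftedSet F l n (x / 2) x T).card : ℝ) := by
  obtain ⟨l₀, c, K, hc, hK, hl₀, h⟩ := exists_le_card_siftedSet hW
  have hg := hW.one_le
  refine ⟨l₀, c / 4, K, |Real.log (4 / c)|, by positivity, hK, hl₀, abs_nonneg _,
    fun l hl n T x hx hT hlarge => ?_⟩
  by_cases h0 : ∏ p ∈ T, (polyRho F p : ℝ) / p = 0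
  · rw [h0, mul_zero, mul_zero, zero_div]
    exact Nat.cast_nonneg _
  have h1 := exp_neg_logSum_le_prod hT h0
  have h2 := h l hl n T (x / 2) x (by positivity) (by linarith) hT
  set P := ∏ p ∈ T, (polyRho F p : ℝ) / p with hP
  refine le_trans ?_ h2
  have h3 : g ^ T.card * Real.exp (K * (2 ^ n * l)) ≤ c / 4 * (x * P) / 2 ^ n := by
    rw [le_div_iff₀ (by positivity)]
    have e1 : g ^ T.card ≤ Real.exp (g * T.card) := by
      rw [mul_comm, Real.exp_nat_mul]
      exact pow_le_pow_left₀ (by linarith) (by linarith [Real.add_one_le_exp g]) _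
    have e2 : (2 : ℝ) ^ n ≤ Real.exp n := by
      rw [← mul_one (n : ℝ), Real.exp_nat_mul]
      exact pow_le_pow_left₀ zero_le_two (by linarith [Real.add_one_le_exp (1 : ℝ)]) _
    have e3 : c / 4 = Real.exp (-Real.log (4 / c)) := by
      rw [← Real.log_inv, Real.exp_log (by positivity), inv_div]
    calc g ^ T.card * Real.exp (K * (2 ^ n * l)) * 2 ^ n
        ≤ Real.exp (g * T.card) * Real.exp (K * (2 ^ n * l)) * Real.exp n := by gcongr
      _ = Real.exp (g * T.card + K * (2 ^ n * l) + n) := by rw [← Real.exp_add, ← Real.exp_add]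
      _ ≤ Real.exp (-Real.log (4 / c) + (Real.log x + -logSum T)) := by
          refine Real.exp_le_exp.2 ?_
          linarith [le_abs_self (Real.log (4 / c))]
      _ = c / 4 * (x * Real.exp (-logSum T)) := by
          rw [Real.exp_add, Real.exp_add, ← e3, Real.exp_log hx]
      _ ≤ c / 4 * (x * P) := by gcongr
  have h4 : c * ((x - x / 2) * P) / 2 ^ n = 2 * (c / 4 * (x * P) / 2 ^ n) := by ring
  rw [h4]
  linarith

end

section

theorem sum_hitPrimes_le_mul_polyH_sub {F : Polynomial ℤ} {c l L v₀ x y η R : ℝ} {J n M : ℕ}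
    {T₀ : Finset ℕ} (hx : 0 < x) (hl : 0 ≤ l) (hJn : J ≤ n) (hL : 0 ≤ L) (hy : 0 < y)
    (hη : 1 / 100 ≤ η) (hT₀ : ∀ p ∈ T₀, p.Prime ∧ Real.log p ≤ l)
    (hdense : ∀ v, v₀ ≤ v → v ≤ v₀ + L → ∃ d ⊆ T₀, v < logSum d ∧ logSum d ≤ v + 1 / 100)
    (hsift : ∀ T : Finset ℕ, (∀ p ∈ T, p.Prime) → T.card ≤ T₀.card + J + 1 → logSum T ≤ R →
      c * (x * ∏ p ∈ T, (polyRho F p : ℝ) / p) / 2 ^ n ≤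
        ((siftedSet F l n (x / 2) x T).card : ℝ))
    (hqJ : ∀ S ∈ lightSets l J, ∀ q ∈ hitPrimes (Real.log y - v₀ - L) (L + η - 1 / 100) S,
      2 ^ J * l < Real.log q ∧ logSum T₀ + logSum S + Real.log q ≤ R)
    (hM : ∀ S ∈ lightSets l J, ∀ k, ((hitPrimes (Real.log y - v₀ - L) (L + η - 1 / 100) S).filter
      fun q => k ∈ siftedSet F l n (x / 2) x (insert q (T₀ ∪ S))).card ≤ M) :
    c * x * (∏ p ∈ T₀, (polyRho F p : ℝ) / p) / 2 ^ n *
      ∑ S ∈ lightSets l J, (∏ p ∈ S, (polyRho F p : ℝ) / p) *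
        ∑ q ∈ hitPrimes (Real.log y - v₀ - L) (L + η - 1 / 100) S, (polyRho F q : ℝ) / q ≤
      M * ((polyH F x y (Real.exp η * y) : ℝ) - (polyH F (x / 2) y (Real.exp η * y) : ℝ)) := by
  set Q := hitPrimes (Real.log y - v₀ - L) (L + η - 1 / 100) with hQ
  have hpath : ∀ S ∈ lightSets l J, S ∈ pathSets l J J := fun S hS =>
    (Finset.mem_filter.1 hS).1
  have hsub : ∀ S ∈ lightSets l J, S ⊆ primesLog l (2 ^ J * l) := fun S hS =>
    (mem_pathSets.1 (hpath S hS)).1.1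
  have hlJ : l ≤ 2 ^ J * l := le_mul_of_one_le_left hl (one_le_pow₀ one_le_two)
  have hpair : ∀ S ∈ lightSets l J, ∀ q ∈ Q S,
      c * x * (∏ p ∈ T₀, (polyRho F p : ℝ) / p) / 2 ^ n * ((∏ p ∈ S, (polyRho F p : ℝ) / p) *
        ((polyRho F q : ℝ) / q)) ≤
      ((siftedSet F l n (x / 2) x (insert q (T₀ ∪ S))).card : ℝ) := by
    intro S hS q hq
    obtain ⟨hq1, hq2⟩ := hqJ S hS q hq
    obtain ⟨h1, h2⟩ := sum_insert_union_eq hlJ (fun p hp => (hT₀ p hp).2)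
      (fun p hp => (mem_primesLog.1 (hsub S hS hp)).2) hq1
    have h3 := hsift (insert q (T₀ ∪ S)) (fun p hp => by
        rcases Finset.mem_insert.1 hp with rfl | hp
        · obtain ⟨d, -, hp', -⟩ := mem_hitPrimes.1 hq
          exact hp'
        · rcases Finset.mem_union.1 hp with hp | hp
          · exact (hT₀ p hp).1
          · exact (mem_primesLog.1 (hsub S hS hp)).1)
      (by rw [Finset.card_insert_of_notMem h1, Finset.card_union_of_disjoint h2,
            (mem_pathSets.1 (hpath S hS)).1.2])
      (by
        have e : logSum (insert q (T₀ ∪ S)) = Real.log q + (logSum T₀ + logSum S) := by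
          rw [logSum, Finset.sum_insert h1, Finset.sum_union h2, logSum, logSum]
        rw [e]
        linarith)
    rw [Finset.prod_insert h1, Finset.prod_union h2] at h3
    refine le_trans (le_of_eq ?_) h3
    ring
  have hcount := sum_card_siftedSet_le (F := F) (x₁ := x / 2) (x₂ := x) hl hJn hsub
    (fun p hp => (hT₀ p hp).2) (fun S hS q hq => (hqJ S hS q hq).1) hM
  have hpoly := card_le_polyH_sub F (y := y) (z := Real.exp η * y) hx.le
    ((lightSets l J).biUnion fun S => (Q S).biUnion fun q =>
        siftedSet F l n (x / 2) x (insert q (T₀ ∪ S))) (fun k hk => by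
      obtain ⟨S, hS, hk⟩ := Finset.mem_biUnion.1 hk
      obtain ⟨q, hq, hk⟩ := Finset.mem_biUnion.1 hk
      exact ⟨(mem_siftedSet.1 hk).1, exists_dvd_of_mem_siftedSet hl hL hy hη (hsub S hS) hT₀ hdense
        hq (hqJ S hS q hq).1 hk⟩)
  refine le_trans ?_ (mul_le_mul_of_nonneg_left hpoly (Nat.cast_nonneg M))
  rw [Finset.mul_sum]
  calc _ = ∑ S ∈ lightSets l J, ∑ q ∈ Q S, c * x * (∏ p ∈ T₀, (polyRho F p : ℝ) / p) / 2 ^ n *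
        ((∏ p ∈ S, (polyRho F p : ℝ) / p) * ((polyRho F q : ℝ) / q)) := by
        refine Finset.sum_congr rfl fun S _ => ?_
        rw [Finset.mul_sum, Finset.mul_sum]
    _ ≤ ∑ S ∈ lightSets l J, ∑ q ∈ Q S,
        ((siftedSet F l n (x / 2) x (insert q (T₀ ∪ S))).card : ℝ) :=
        Finset.sum_le_sum fun S hS => Finset.sum_le_sum fun q hq => hpair S hS q hq
    _ ≤ _ := by
        have := (Nat.cast_le (α := ℝ)).2 hcount
        rw [Nat.cast_mul, Nat.cast_sum] at this
        simpa only [Nat.cast_sum] using this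

set_option maxHeartbeats 1600000 in
/-- The lower bound before the number `J` of blocks is expressed through `u`. -/
theorem exists_blocks_le_polyH_sub (F : Polynomial ℤ) (hF : Irreducible F)
    (hdeg : 2 ≤ F.natDegree) (δ : ℝ) (hδ0 : 0 < δ) (hδ1 : δ < 1) :
    ∃ β Y₀ c : ℝ, 1 ≤ β ∧ 0 < Y₀ ∧ 0 < c ∧ ∀ x y η : ℝ, 0 < x → 0 < y → Y₀ ≤ Real.log y →
      Real.log y ≤ (1 - δ) * Real.log x → 1 / 100 ≤ η → 2 * (β * η) ≤ Real.log y →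
      ∃ J : ℕ, 2 ^ J * (β * η) ≤ Real.log y ∧ Real.log y < 2 ^ (J + 1) * (β * η) ∧
        c * x * (η / Real.log y) * ((Real.exp 1 * Real.log 2) ^ J * decay J) ≤
          (polyH F x y (Real.exp η * y) : ℝ) - (polyH F (x / 2) y (Real.exp η * y) : ℝ) := by
  obtain ⟨C, hW⟩ := exists_mertensWeight_polyRho F hF (by omega)
  have hC := hW.C_pos
  have hg := hW.one_le
  obtain ⟨l₀, c₁, K₁, E, hc₁, hK₁, hl₀, hE, hsift⟩ := exists_mul_prod_le_card_siftedSet hW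
  set g : ℝ := (F.natDegree : ℝ) with hgdef
  set L := 2 * C + 1 with hL
  obtain ⟨T₀, v₀, hv₀, hT₀, hdense⟩ := hW.exists_dense_logSum L
  obtain ⟨c₂, hc₂, hhits⟩ := hW.exists_le_sum_hitPrimes (K := 100 * L + 1) (by positivity)
  obtain ⟨B, hB, hlogF⟩ := exists_log_eval_le F
  have hs₀ := logSum_nonneg (d := T₀)
  set Λ := l₀ + 4 * (C + 2 * g) + logSum T₀ with hΛ
  set K' := 8 * Real.exp 6 / Real.log 2 with hK'
  have hln2 : 0 < Real.log 2 := Real.log_pos one_lt_two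
  have hK'0 : 0 < K' := by positivity
  set A₁ := E + g * (T₀.card + 1) + logSum T₀ with hA₁
  have hA₁0 : 0 ≤ A₁ := by positivity
  set D := 2 + g + K₁ + K' with hD
  set κ := 4 * K' + 2 * (100 * L + 1) + 5 + 2 * D / δ with hκ
  have hDδ : 0 ≤ 2 * D / δ := by positivity
  have hκ5 : 5 ≤ κ := by linarith
  obtain ⟨h, hh⟩ := pow_unbounded_of_one_lt (4 * κ) (one_lt_two : (1 : ℝ) < 2)
  set D' := 2 + g + K₁ * 2 ^ h + K' with hD'
  set K₂ := 3 + D' with hK₂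
  have hD'0 : 0 ≤ D' := by positivity
  set M := ⌈4 * (1 + g * K₂)⌉₊ with hM
  have hM4 : (4 : ℝ) * (1 + g * K₂) ≤ M := Nat.le_ceil _
  have hM1 : (1 : ℝ) ≤ M := by
    refine le_trans ?_ hM4
    have : 0 ≤ g * K₂ := by positivity
    linarith
  set W₀ := ∏ p ∈ T₀, (polyRho F p : ℝ) / p with hW₀
  have hW₀0 : 0 < W₀ := Finset.prod_pos fun p hp => (hT₀ p hp).2
  have hΛ1 : 1 ≤ Λ := by linarith
  have hβ1 : 1 ≤ 100 * Λ * κ :=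
    one_le_mul_of_one_le_of_one_le (by linarith) (by linarith)
  refine ⟨100 * Λ * κ, 2 * (v₀ + L) + 2 * A₁ / δ + A₁ + h + B + 1, c₁ * W₀ * c₂ / (2 ^ h * M),
    hβ1, by positivity, by positivity, ?_⟩
  intro x y η hx hy hY₀ hxy hη hηy
  have hA₁δ : 0 ≤ 2 * A₁ / δ := by positivity
  have hh0 : (0 : ℝ) ≤ h := Nat.cast_nonneg h
  set ly := Real.log y with hly
  set l := 100 * Λ * η with hl
  have hη0 : 0 < η := by linarith
  have hΛl : Λ ≤ l := by
    have := mul_le_mul_of_nonneg_left (show 1 ≤ 100 * η by linarith) (by linarith : 0 ≤ Λ)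
    linarith
  have hηl : η ≤ l := le_mul_of_one_le_left hη0.le (by linarith)
  have hl0 : 0 < l := by linarith
  have hβ : 100 * Λ * κ * η = κ * l := by rw [hl]; ring
  rw [hβ] at hηy
  have hκl : 0 < κ * l := by positivity
  obtain ⟨J, hJ1, hJ2⟩ := exists_nat_pow_near (x := ly / (κ * l)) (y := (2 : ℝ))
    (by rw [le_div_iff₀ hκl]; linarith) one_lt_two
  rw [le_div_iff₀ hκl] at hJ1
  rw [div_lt_iff₀ hκl] at hJ2
  refine ⟨J, by rw [hβ]; exact hJ1, by rw [hβ]; exact hJ2, ?_⟩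
  have hJ : 1 ≤ J := by
    rcases Nat.eq_zero_or_pos J with h0 | h0
    · rw [h0] at hJ2
      norm_num at hJ2
      linarith
    · exact h0
  set X := 2 ^ J * l with hX
  have hX0 : 0 < X := by positivity
  have hlX : l ≤ X := le_mul_of_one_le_left hl0.le (one_le_pow₀ one_le_two)
  have hκX : κ * X ≤ ly := by rw [hX]; linarith
  have hκX2 : ly < 2 * κ * X := by
    rw [hX]
    rw [pow_succ] at hJ2
    linarith
  have hJX : (J : ℝ) ≤ X := by
    have h1 : (J : ℝ) ≤ 2 ^ J := by exact_mod_cast Nat.lt_two_pow_self.le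
    have h2 : (2 : ℝ) ^ J * 1 ≤ X := mul_le_mul_of_nonneg_left (by linarith) (by positivity)
    linarith
  have hly0 : 0 < ly := by linarith
  have hXly : X ≤ ly := (le_mul_of_one_le_left hX0.le (by linarith)).trans hκX
  have hL1 : 1 ≤ L := by linarith
  set Y := ly - v₀ - L with hY
  set lam := L + η - 1 / 100 with hlam
  have hY2 : ly / 2 ≤ Y := by linarith
  have hYly : Y ≤ ly := by linarith
  have hlaml : lam ≤ (100 * L + 1) * η := by
    have := mul_le_mul_of_nonneg_left (show 1 ≤ 100 * η by linarith) (by linarith : 0 ≤ L)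
    linarith
  have hlamK : lam ≤ (100 * L + 1) * l :=
    hlaml.trans (mul_le_mul_of_nonneg_left hηl (by linarith))
  have hlamY : lam ≤ Y := by
    have h1 : 2 * (100 * L + 1) * X ≤ κ * X :=
      mul_le_mul_of_nonneg_right (by linarith) hX0.le
    have h2 : (100 * L + 1) * l ≤ (100 * L + 1) * X :=
      mul_le_mul_of_nonneg_left hlX (by linarith)
    linarith
  have hK'X : K' * X ≤ Y / 2 := by
    have h1 : 4 * K' * X ≤ κ * X := mul_le_mul_of_nonneg_right (by linarith) hX0.le
    linarith
  have hT₀l : ∀ p ∈ T₀, p.Prime ∧ Real.log p ≤ l := fun p hp => ⟨(hT₀ p hp).1, by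
    have : Real.log p ≤ logSum T₀ :=
      Finset.single_le_sum (f := fun p : ℕ => Real.log p)
        (fun p _ => Real.log_natCast_nonneg p) hp
    linarith⟩
  have hhit : ∀ S ∈ lightSets l J, ∀ q ∈ hitPrimes Y lam S, q.Prime ∧ ly / 4 ≤ Real.log q ∧
      Real.log q ≤ ly + η := by
    intro S hS q hq
    obtain ⟨d, hd, hqp, h1, h2⟩ := mem_hitPrimes.1 hq
    have h3 := (logSum_mono hd).trans (Finset.mem_filter.1 hS).2
    have h4 := logSum_nonneg (d := d)
    exact ⟨hqp, by linarith, by linarith⟩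
  have hqX : ∀ S ∈ lightSets l J, ∀ q ∈ hitPrimes Y lam S, X < Real.log q := by
    intro S hS q hq
    have h1 := (hhit S hS q hq).2.1
    have h2 := mul_le_mul_of_nonneg_right hκ5 hX0.le
    linarith
  have hmain := hhits l lam Y (by linarith) (by linarith) (by linarith) hlamK hlamY J hJ hK'X
  -- the count, for an arbitrary sifting range
  have hcount : ∀ i : ℕ, i ≤ h → A₁ + i + (2 + g + K₁ * 2 ^ i + K') * X + ly ≤ Real.log x →
      (∀ S ∈ lightSets l J, ∀ k, ((hitPrimes Y lam S).filter
        fun q => k ∈ siftedSet F l (J + i) (x / 2) x (insert q (T₀ ∪ S))).card ≤ M) →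
      c₁ * W₀ * c₂ / (2 ^ h * M) * x * (η / ly) * ((Real.exp 1 * Real.log 2) ^ J * decay J) ≤
        (polyH F x y (Real.exp η * y) : ℝ) - (polyH F (x / 2) y (Real.exp η * y) : ℝ) := by
    intro i hi hlarge hmult
    have hfin := sum_hitPrimes_le_mul_polyH_sub (F := F) (c := c₁) (n := J + i) (M := M)
      (R := logSum T₀ + K' * X + ly + X) hx hl0.le (by omega)
      (by linarith) hy hη hT₀l hdense (fun T hT hcard hT' => hsift l (by linarith) (J + i) T x hx hT
        (by
          have h1 : (T.card : ℝ) ≤ T₀.card + J + 1 := by exact_mod_cast hcard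
          have h2 : g * T.card ≤ g * (T₀.card + J + 1) := by gcongr
          have h3 : g * J ≤ g * X := by gcongr
          have h4 : K₁ * (2 ^ (J + i) * l) = K₁ * 2 ^ i * X := by rw [hX, pow_add]; ring
          rw [h4, Nat.cast_add]
          linarith only [h1, h2, h3, hT', hlarge, hJX, hA₁, hlX]))
      (fun S hS q hq => ⟨hqX S hS q hq, by
        have h1 := (Finset.mem_filter.1 hS).2
        have h2 := (hhit S hS q hq).2.2
        linarith⟩) hmult
    have hpow : (2 : ℝ) ^ (J + i) ≤ 2 ^ J * 2 ^ h := by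
      rw [pow_add]
      gcongr
      exact one_le_two
    have hd := decay_pos J
    have hlow : c₁ * x * W₀ / (2 ^ J * 2 ^ h) *
        (c₂ * (η / ly) * ((2 * Real.exp 1 * Real.log 2) ^ J * decay J)) ≤
        M * ((polyH F x y (Real.exp η * y) : ℝ) - (polyH F (x / 2) y (Real.exp η * y) : ℝ)) := by
      refine le_trans ?_ hfin
      refine mul_le_mul ?_ (le_trans ?_ hmain) (by positivity) (by positivity)
      · gcongr
      · have hr : η / ly ≤ lam / Y := by
          apply div_le_div₀ <;> linarith
        gcongr
    have hMpos : (0 : ℝ) < M := by linarith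
    refine le_of_mul_le_mul_left (le_trans (le_of_eq ?_) hlow) hMpos
    rw [show 2 * Real.exp 1 * Real.log 2 = 2 * (Real.exp 1 * Real.log 2) by ring, mul_pow 2]
    field_simp
  have hlx : ly + δ * ly ≤ Real.log x := by
    have h1 : 0 < Real.log x := by
      by_contra hcon
      have := mul_nonneg (by linarith : 0 ≤ 1 - δ) (by linarith : 0 ≤ -Real.log x)
      linarith
    have h2 := mul_le_mul_of_nonneg_left hxy (by linarith : 0 ≤ 1 + δ)
    have h3 : 0 ≤ δ * (δ * Real.log x) := by positivity
    linarith
  rcases le_or_gt (Real.log x) (K₂ * ly) with hcase | hcase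
  · refine hcount 0 (Nat.zero_le _) ?_ fun S hS k => ?_
    · have h1 : 2 * D / δ * X ≤ ly := by
        refine le_trans (mul_le_mul_of_nonneg_right ?_ hX0.le) hκX
        linarith
      have h2 : 2 * A₁ / δ ≤ ly := by linarith
      rw [div_mul_eq_mul_div, div_le_iff₀ hδ0] at h1
      rw [div_le_iff₀ hδ0] at h2
      rw [pow_zero, mul_one, Nat.cast_zero]
      linarith
    · have h1 := card_filter_mem_siftedSet_le hF hdeg hlogF (l := l) (n := J + 0) (x₁ := x / 2)
        (T₀ := T₀) (S := S) (Q := hitPrimes Y lam S) (v := ly / 4) hx (by positivity)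
        (fun q hq => ⟨(hhit S hS q hq).1, (hhit S hS q hq).2.1⟩) k
      have h2 : max 0 ((B + F.natDegree * Real.log x) / (ly / 4)) ≤ M := by
        refine max_le (by linarith) (le_trans ?_ hM4)
        rw [div_le_iff₀ (by positivity)]
        have : g * Real.log x ≤ g * (K₂ * ly) := by gcongr
        have hBly : B ≤ ly := by linarith
        rw [← hgdef]
        linarith only [this, hBly]
      exact_mod_cast h1.trans h2
  · refine hcount h le_rfl ?_ fun S hS k => ?_
    · have h1 : D' * X ≤ D' * ly := by gcongr
      rw [hK₂] at hcase
      linarith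
    · refine (card_filter_mem_siftedSet_le_one hl0.le ?_ (fun p hp => (hT₀l p hp).2)
        (fun q hq => ⟨(hhit S hS q hq).1, hqX S hS q hq, ?_⟩) k).trans (by exact_mod_cast hM1)
      · exact (mem_pathSets.1 (Finset.mem_filter.1 hS).1).1.1
      · have h1 := (hhit S hS q hq).2.2
        have h2 : 4 * κ * X ≤ 2 ^ h * X := by gcongr
        rw [pow_add, mul_assoc, mul_comm (2 ^ h) l, ← mul_assoc, ← hX, mul_comm X]
        linarith

end

section

theorem polyH_eq_zero_of_nonpos (F : Polynomial ℤ) {x : ℝ} (hx : x ≤ 0) (y z : ℝ) :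
    polyH F x y z = 0 := by
  have h : {n : ℕ | 0 < n ∧ (n : ℝ) ≤ x ∧
      ∃ d : ℕ, 0 < d ∧ (d : ℤ) ∣ F.eval (n : ℤ) ∧ y < (d : ℝ) ∧ (d : ℝ) ≤ z} = ∅ := by
    ext n
    simp only [Set.mem_ofPred_eq, Set.mem_empty_iff_false, iff_false, not_and]
    intro hn hnx
    have : (0 : ℝ) < n := Nat.cast_pos.2 hn
    linarith
  rw [polyH, h, Set.ncard_empty]

theorem two_rpow_exponent :
    (2 : ℝ) ^ ((1 + Real.log (Real.log 2)) / Real.log 2) = Real.exp 1 * Real.log 2 := by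
  have h := Real.log_pos one_lt_two
  rw [Real.rpow_def_of_pos two_pos, mul_div_cancel₀ _ h.ne', Real.exp_add, Real.exp_log h]

theorem one_add_log_log_two_pos : 0 < 1 + Real.log (Real.log 2) := by
  have h : (1 / 2 : ℝ) < Real.log 2 := by
    have := Real.log_two_gt_d9
    linarith
  have h1 := Real.log_lt_log (by norm_num) h
  rw [one_div, Real.log_inv] at h1
  have := Real.log_two_lt_d9
  linarith

theorem rpow_exponent_div_le {β u : ℝ} {J : ℕ} (hβ : 1 ≤ β) (hu : 0 < u)
    (hJ1 : 2 ^ J * (β * u) ≤ 1) (hJ2 : 1 < 2 ^ (J + 1) * (β * u)) :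
    (2 * β) ^ (-((1 + Real.log (Real.log 2)) / Real.log 2)) * Real.log 2 ^ ((3 : ℝ) / 2) *
      (u ^ (1 - (1 + Real.log (Real.log 2)) / Real.log 2) / Real.log (2 / u) ^ ((3 : ℝ) / 2)) ≤
      u * ((Real.exp 1 * Real.log 2) ^ J * decay J) := by
  have hln := Real.log_pos one_lt_two
  have hβ0 : 0 < β := by linarith
  set s := (1 + Real.log (Real.log 2)) / Real.log 2 with hs
  have hs0 : 0 < s := div_pos one_add_log_log_two_pos hln
  have h1 : (2 * β) ^ (-s) * u ^ (1 - s) ≤ u * (Real.exp 1 * Real.log 2) ^ J := by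
    rw [← two_rpow_exponent, ← hs, ← Real.rpow_mul_natCast two_pos.le, mul_comm s,
      Real.rpow_mul two_pos.le, Real.rpow_natCast, Real.rpow_sub hu, Real.rpow_one, Real.rpow_neg
      (by positivity), mul_comm, div_mul_eq_mul_div, mul_div_assoc]
    refine mul_le_mul_of_nonneg_left ?_ hu.le
    rw [inv_eq_one_div, div_div, ← Real.mul_rpow (by positivity) hu.le,
      div_le_iff₀ (by positivity), ← Real.mul_rpow (by positivity) (by positivity)]
    refine Real.one_le_rpow ?_ hs0.le
    rw [pow_succ] at hJ2
    linarith
  have h2 : ((J : ℝ) + 1) * Real.log 2 ≤ Real.log (2 / u) := by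
    rw [← Nat.cast_succ, ← Real.log_pow]
    refine Real.log_le_log (by positivity) ?_
    rw [le_div_iff₀ hu, pow_succ]
    have : (2 : ℝ) ^ J * u ≤ 2 ^ J * (β * u) := by
      gcongr
      exact le_mul_of_one_le_left hu.le hβ
    linarith
  have h3 : Real.log 2 ^ ((3 : ℝ) / 2) / Real.log (2 / u) ^ ((3 : ℝ) / 2) ≤ decay J := by
    have hJ0 : (0 : ℝ) < (J : ℝ) + 1 := by positivity
    rw [decay, Real.rpow_neg hJ0.le, inv_eq_one_div, div_le_div_iff₀
      (Real.rpow_pos_of_pos ((mul_pos hJ0 hln).trans_le h2) _) (by positivity), one_mul,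
      ← Real.mul_rpow hln.le hJ0.le]
    refine Real.rpow_le_rpow (by positivity) ?_ (by norm_num)
    linarith
  have h4 : 0 ≤ Real.log (2 / u) := le_trans (by positivity) h2
  calc _ = (2 * β) ^ (-s) * u ^ (1 - s) *
        (Real.log 2 ^ ((3 : ℝ) / 2) / Real.log (2 / u) ^ ((3 : ℝ) / 2)) := by ring
    _ ≤ u * (Real.exp 1 * Real.log 2) ^ J * decay J :=
        mul_le_mul h1 h3 (by positivity) (by positivity)
    _ = _ := by ring

end

theorem stmt12 (F : Polynomial ℤ) (hF : Irreducible F) (hdeg : 2 ≤ F.natDegree)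
    (δ : ℝ) (hδ0 : 0 < δ) (hδ1 : δ < 1) :
    ∃ γ y₀ c : ℝ, 0 < γ ∧ 0 < c ∧
      ∀ x y z η u : ℝ, y₀ ≤ y → y ≤ x ^ (1 - δ) → z = Real.exp η * y →
        1 / 100 ≤ η → η ≤ γ * Real.log y → u = η / Real.log y →
        c * x * u ^ (1 - (1 + Real.log (Real.log 2)) / Real.log 2) /
            (Real.log (2 / u)) ^ ((3 : ℝ) / 2) ≤
          (polyH F x y z : ℝ) - (polyH F (x / 2) y z : ℝ) := by
  obtain ⟨β, Y₀, c, hβ, hY₀, hc, h⟩ := exists_blocks_le_polyH_sub F hF hdeg δ hδ0 hδ1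
  have hln := Real.log_pos one_lt_two
  set s := (1 + Real.log (Real.log 2)) / Real.log 2 with hs
  have hβ0 : 0 < β := by linarith
  refine ⟨1 / (2 * β), Real.exp Y₀, c * ((2 * β) ^ (-s) * Real.log 2 ^ ((3 : ℝ) / 2)),
    by positivity, by positivity, ?_⟩
  rintro x y _ η u hy hyx rfl hη hηγ rfl
  have hy0 : 0 < y := (Real.exp_pos _).trans_le hy
  have hlogy : Y₀ ≤ Real.log y := (Real.le_log_iff_exp_le hy0).2 hy
  have hly0 : 0 < Real.log y := by linarith
  have hη0 : 0 < η := by linarith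
  have hu : 0 < η / Real.log y := by positivity
  have hη2 : 2 * (β * η) ≤ Real.log y := by
    rw [div_mul_eq_mul_div, one_mul, le_div_iff₀ (by positivity)] at hηγ
    linarith
  have hu1 : η / Real.log y ≤ 1 := by
    rw [div_le_one hly0]
    have := le_mul_of_one_le_left hη0.le hβ
    linarith
  have hL : 0 ≤ Real.log (2 / (η / Real.log y)) := by
    refine Real.log_nonneg ?_
    rw [le_div_iff₀ hu]
    linarith
  rcases le_or_gt x 0 with hx | hx
  · rw [polyH_eq_zero_of_nonpos F hx, polyH_eq_zero_of_nonpos F (by linarith), sub_self]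
    refine div_nonpos_of_nonpos_of_nonneg (mul_nonpos_of_nonpos_of_nonneg
      (mul_nonpos_of_nonneg_of_nonpos (by positivity) hx) (by positivity)) (by positivity)
  · have hlogyx : Real.log y ≤ (1 - δ) * Real.log x := by
      rw [← Real.log_rpow hx]
      exact Real.log_le_log hy0 hyx
    obtain ⟨J, hJ1, hJ2, hJ⟩ := h x y η hx hy0 hlogy hlogyx hη hη2
    refine le_trans ?_ hJ
    have key := rpow_exponent_div_le (J := J) hβ hu
      (by rw [← mul_div_assoc, ← mul_div_assoc, div_le_one hly0]; exact hJ1)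
      (by rw [← mul_div_assoc, ← mul_div_assoc, one_lt_div hly0]; exact hJ2)
    have := mul_le_mul_of_nonneg_left key (mul_pos hc hx).le
    calc _ = _ := ?_
      _ ≤ _ := this
      _ = _ := by ring
    rw [← hs]
    ring
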